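/- Let k ≥ 1 be an integer and S > 0 a constant. Suppose that σ_k(Ω,1)·H¹(∂Ω) ≤ S for every bounded domain Ω ⊂ ℝ² with smooth boundary. Then σ_k(Ω,1)·H¹(∂Ω) ≤ S for every bounded Lipschitz domain Ω ⊂ ℝ², and moreover σ_k(Ω,ρ)·L_ρ(∂Ω) ≤ S for every bounded Lipschitz domain Ω ⊂ ℝ² and every nonnegative weight ρ ∈ L^∞(∂Ω) that is positive on a set of positive H¹-measure. (Planar case of Proposition 2.7 of the paper: extension of Steklov eigenvalue bounds from smooth to Lipschitz and weighted problems.) -/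

import Mathlib

open Set MeasureTheory Metric Filter Asymptotics
open scoped ENNReal Topology NNReal

noncomputable section

abbrev E2 : Type := EuclideanSpace ℝ (Fin 2)

def IsLipschitzDomain (Ω : Set E2) : Prop :=
  IsOpen Ω ∧ IsConnected Ω ∧ Bornology.IsBounded Ω ∧
    ∀ p ∈ frontier Ω, ∃ (e : E2 ≃ₗᵢ[ℝ] E2) (K : ℝ≥0) (φ : ℝ → ℝ) (U : Set E2),
      LipschitzWith K φ ∧ IsOpen U ∧ p ∈ U ∧
      ∀ x ∈ U, (x ∈ Ω ↔ φ (e x 0) < e x 1)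

def dirEnergy (Ω : Set E2) (f : E2 → ℝ) : ℝ≥0∞ :=
  ∫⁻ x in Ω, (‖fderiv ℝ f x‖₊ : ℝ≥0∞) ^ 2

def bdryInt (Γ : Set E2) (ρ f : E2 → ℝ) : ℝ≥0∞ :=
  ∫⁻ x in Γ, ENNReal.ofReal (ρ x * (f x) ^ 2) ∂μH[1]

def rayleigh (Ω Γ : Set E2) (ρ f : E2 → ℝ) : ℝ≥0∞ :=
  dirEnergy Ω f / bdryInt Γ ρ f

def steklovMixed (Ω ΓS ΓD : Set E2) (ρ : E2 → ℝ) (k : ℕ) : ℝ≥0∞ :=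
  ⨅ (V : Submodule ℝ (E2 → ℝ))
    (_ : Module.finrank ℝ V = k + 1)
    (_ : ∀ f ∈ V, ContDiff ℝ (⊤ : ℕ∞) f)
    (_ : ∀ f ∈ V, ∀ᶠ x in nhdsSet ΓD, f x = 0)
    (_ : ∀ f ∈ V, Set.EqOn f 0 (closure Ω) → f = 0),
    ⨆ f ∈ V, ⨆ (_ : ¬ Set.EqOn f 0 (closure Ω)), rayleigh Ω ΓS ρ f

def steklovN (Ω ΓS : Set E2) (k : ℕ) : ℝ≥0∞ :=
  steklovMixed Ω ΓS ∅ (fun _ => 1) k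

def steklovD (Ω ΓS ΓD : Set E2) (k : ℕ) : ℝ≥0∞ :=
  steklovMixed Ω ΓS ΓD (fun _ => 1) k

def steklovW (Ω : Set E2) (ρ : E2 → ℝ) (k : ℕ) : ℝ≥0∞ :=
  steklovMixed Ω (frontier Ω) ∅ ρ k

def steklov (Ω : Set E2) (k : ℕ) : ℝ≥0∞ := steklovW Ω (fun _ => 1) k

def IsArc (A : Set E2) : Prop :=
  ∃ γ : ℝ → E2, ContinuousOn γ (Icc 0 1) ∧ InjOn γ (Icc 0 1) ∧ A = γ '' Icc 0 1

def IsLoop (A : Set E2) : Prop :=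
  ∃ γ : ℝ → E2, ContinuousOn γ (Icc 0 1) ∧ InjOn γ (Ico 0 1) ∧ γ 0 = γ 1 ∧ A = γ '' Icc 0 1

def IsBoundaryPart (Γ : Set E2) : Prop :=
  ∃ F : Finset (Set E2), (∀ A ∈ F, IsArc A ∨ IsLoop A) ∧ Γ = ⋃₀ ↑F

structure SteklovDecomp (Ω ΓS Γstar : Set E2) : Prop where
  partS : IsBoundaryPart ΓS
  partStar : IsBoundaryPart Γstar
  union_eq : ΓS ∪ Γstar = frontier Ω
  inter_finite : (ΓS ∩ Γstar).Finite
  nonemptyS : ΓS.Nonempty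

/-- Bounded domain in the plane with smooth boundary. -/
def IsSmoothDomain (Ω : Set E2) : Prop :=
  IsOpen Ω ∧ IsConnected Ω ∧ Bornology.IsBounded Ω ∧
    ∀ p ∈ frontier Ω, ∃ (e : E2 ≃ₗᵢ[ℝ] E2) (φ : ℝ → ℝ) (U : Set E2),
      ContDiff ℝ (⊤ : ℕ∞) φ ∧ IsOpen U ∧ p ∈ U ∧
      ∀ x ∈ U, (x ∈ Ω ↔ φ (e x 0) < e x 1)

/-- The ρ-weighted length L_ρ(∂Ω). -/
def Lweight (Ω : Set E2) (ρ : E2 → ℝ) : ℝ≥0∞ :=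
  ∫⁻ x in frontier Ω, ENNReal.ofReal (ρ x) ∂μH[1]

/-! ### Pointwise inequalities along segments -/

/-- The energy density of `f`. -/
def gradSq (f : E2 → ℝ) (x : E2) : ℝ≥0∞ := (‖fderiv ℝ f x‖₊ : ℝ≥0∞) ^ 2

/-- The square of `f` as an extended nonnegative real. -/
def valSq (f : E2 → ℝ) (x : E2) : ℝ≥0∞ := ENNReal.ofReal (f x ^ 2)

lemma dirEnergy_eq (Ω : Set E2) (f : E2 → ℝ) : dirEnergy Ω f = ∫⁻ x in Ω, gradSq f x := rfl

lemma dirEnergy_mono {A B : Set E2} (h : A ⊆ B) (f : E2 → ℝ) : dirEnergy A f ≤ dirEnergy B f :=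
  lintegral_mono_set h

lemma continuous_gradSq {f : E2 → ℝ} (hf : ContDiff ℝ 1 f) : Continuous (gradSq f) := by
  have h1 : Continuous (fderiv ℝ f) := hf.continuous_fderiv (by norm_num)
  exact (ENNReal.continuous_pow 2).comp (ENNReal.continuous_coe.comp h1.nnnorm)

lemma measurable_gradSq {f : E2 → ℝ} (hf : ContDiff ℝ 1 f) : Measurable (gradSq f) :=
  (continuous_gradSq hf).measurable

lemma continuous_valSq {f : E2 → ℝ} (hf : ContDiff ℝ 1 f) : Continuous (valSq f) :=
  ENNReal.continuous_ofReal.comp (hf.continuous.pow 2)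

lemma measurable_valSq {f : E2 → ℝ} (hf : ContDiff ℝ 1 f) : Measurable (valSq f) :=
  (continuous_valSq hf).measurable

lemma gradSq_sub_const (f : E2 → ℝ) (m : ℝ) : gradSq (fun x => f x - m) = gradSq f := by
  ext x
  simp only [gradSq, fderiv_sub_const]

lemma dirEnergy_sub_const (Ω : Set E2) (f : E2 → ℝ) (m : ℝ) :
    dirEnergy Ω (fun x => f x - m) = dirEnergy Ω f := by
  simp only [dirEnergy_eq, gradSq_sub_const]

lemma ofReal_sq_sub_le {g g' : ℝ → ℝ} (h : ∀ x, HasDerivAt g (g' x) x) (hc : Continuous g')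
    {a b : ℝ} (hab : a ≤ b) :
    ENNReal.ofReal ((g b - g a) ^ 2) ≤
      ENNReal.ofReal (b - a) * ∫⁻ x in Ioc a b, ENNReal.ofReal (g' x ^ 2) := by
  have h1 : ∫ x in a..b, g' x = g b - g a :=
    intervalIntegral.integral_eq_sub_of_hasDerivAt (fun x _ => h x) (hc.intervalIntegrable _ _)
  have hsq : ∀ y : ℝ, ENNReal.ofReal (y ^ 2) = ‖y‖ₑ ^ 2 := by
    intro y
    rw [← ofReal_norm, ← ENNReal.ofReal_pow (norm_nonneg _), Real.norm_eq_abs, sq_abs]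
  simp only [hsq]
  rw [← h1, intervalIntegral.integral_of_le hab]
  have h2 : ‖∫ x in Ioc a b, g' x‖ₑ ≤ ∫⁻ x in Ioc a b, ‖g' x‖ₑ :=
    enorm_integral_le_lintegral_enorm _
  have h3 := ENNReal.lintegral_mul_le_Lp_mul_Lq (volume.restrict (Ioc a b))
    Real.HolderConjugate.two_two (f := fun _ => 1) (g := fun x => ‖g' x‖ₑ) aemeasurable_const
    hc.measurable.enorm.aemeasurable
  simp only [Pi.mul_apply, one_mul, one_pow, lintegral_const, MeasurableSet.univ,
    Measure.restrict_apply, univ_inter, Real.volume_Ioc, ENNReal.rpow_two] at h3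
  calc ‖∫ x in Ioc a b, g' x‖ₑ ^ 2 ≤ (∫⁻ x in Ioc a b, ‖g' x‖ₑ) ^ 2 := by gcongr
    _ ≤ (ENNReal.ofReal (b - a) ^ (1 / 2 : ℝ) *
          (∫⁻ x in Ioc a b, ‖g' x‖ₑ ^ 2) ^ (1 / 2 : ℝ)) ^ 2 := by gcongr
    _ = ENNReal.ofReal (b - a) * ∫⁻ x in Ioc a b, ‖g' x‖ₑ ^ 2 := by
        rw [mul_pow, ← ENNReal.rpow_two, ← ENNReal.rpow_two, ← ENNReal.rpow_mul,
          ← ENNReal.rpow_mul]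
        norm_num

lemma ofReal_sq_sub_le_segment {f : E2 → ℝ} (hf : ContDiff ℝ 1 f) (x v : E2) {a b : ℝ}
    (hab : a ≤ b) :
    ENNReal.ofReal ((f (x + b • v) - f (x + a • v)) ^ 2) ≤
      ENNReal.ofReal (b - a) * (ENNReal.ofReal (‖v‖ ^ 2) *
        ∫⁻ t in Ioc a b, gradSq f (x + t • v)) := by
  have hd : ∀ t : ℝ, HasDerivAt (fun t : ℝ => f (x + t • v)) (fderiv ℝ f (x + t • v) v) t := by
    intro t
    have h1 : HasFDerivAt f (fderiv ℝ f (x + t • v)) (x + t • v) :=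
      ((hf.differentiable (by norm_num)) _).hasFDerivAt
    have h2 : HasDerivAt (fun t : ℝ => x + t • v) v t := by
      simpa using ((hasDerivAt_id t).smul_const v).const_add x
    exact h1.comp_hasDerivAt t h2
  have hc : Continuous fun t : ℝ => fderiv ℝ f (x + t • v) v := by
    have h1 : Continuous (fderiv ℝ f) := hf.continuous_fderiv (by norm_num)
    fun_prop
  refine (ofReal_sq_sub_le hd hc hab).trans ?_
  gcongr
  rw [← lintegral_const_mul' _ _ ENNReal.ofReal_ne_top]
  refine lintegral_mono fun t => ?_
  have h1 : |fderiv ℝ f (x + t • v) v| ≤ ‖fderiv ℝ f (x + t • v)‖ * ‖v‖ :=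
    (fderiv ℝ f (x + t • v)).le_opNorm v
  have h2 : gradSq f (x + t • v) = ENNReal.ofReal (‖fderiv ℝ f (x + t • v)‖ ^ 2) := by
    rw [gradSq, ← enorm_eq_nnnorm, ← ofReal_norm, ENNReal.ofReal_pow (norm_nonneg _)]
  rw [h2, ← ENNReal.ofReal_mul (by positivity)]
  refine ENNReal.ofReal_le_ofReal ?_
  rw [← sq_abs]
  calc |fderiv ℝ f (x + t • v) v| ^ 2 ≤ (‖fderiv ℝ f (x + t • v)‖ * ‖v‖) ^ 2 := by gcongr
    _ = _ := by ring

lemma ofReal_sq_le_add {ε : ℝ} (hε : 0 < ε) (a b : ℝ) :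
    ENNReal.ofReal (a ^ 2) ≤ ENNReal.ofReal (1 + ε) * ENNReal.ofReal (b ^ 2) +
      ENNReal.ofReal (1 + 1 / ε) * ENNReal.ofReal ((a - b) ^ 2) := by
  rw [← ENNReal.ofReal_mul (by positivity), ← ENNReal.ofReal_mul (by positivity),
    ← ENNReal.ofReal_add (by positivity) (by positivity)]
  refine ENNReal.ofReal_le_ofReal ?_
  have h : (1 + ε) * b ^ 2 + (1 + 1 / ε) * (a - b) ^ 2 - a ^ 2 = (ε * b - (a - b)) ^ 2 / ε := by
    field_simp
    ring
  have : 0 ≤ (ε * b - (a - b)) ^ 2 / ε := by positivity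
  linarith

lemma ofReal_sq_le_two (a b : ℝ) :
    ENNReal.ofReal (a ^ 2) ≤ 2 * ENNReal.ofReal (b ^ 2) + 2 * ENNReal.ofReal ((a - b) ^ 2) := by
  have h := ofReal_sq_le_add one_pos a b
  norm_num at h
  exact h

/-! ### Orthonormal frames -/

/-- The point with coordinates `p` in the orthonormal frame given by `e`. -/
def frame (e : E2 ≃ₗᵢ[ℝ] E2) (p : ℝ × ℝ) : E2 := e.symm !₂[p.1, p.2]

lemma frame_apply_zero (e : E2 ≃ₗᵢ[ℝ] E2) (p : ℝ × ℝ) : e (frame e p) 0 = p.1 := by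
  simp [frame]

lemma frame_apply_one (e : E2 ≃ₗᵢ[ℝ] E2) (p : ℝ × ℝ) : e (frame e p) 1 = p.2 := by
  simp [frame]

lemma frame_coord (e : E2 ≃ₗᵢ[ℝ] E2) (x : E2) : frame e (e x 0, e x 1) = x := by
  rw [frame, LinearIsometryEquiv.symm_apply_eq]
  ext i
  fin_cases i <;> simp

lemma frame_sub (e : E2 ≃ₗᵢ[ℝ] E2) (p q : ℝ × ℝ) :
    frame e p - frame e q = e.symm !₂[p.1 - q.1, p.2 - q.2] := by
  rw [frame, frame, ← map_sub]
  congr 1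
  ext i
  fin_cases i <;> simp

lemma dist_frame (e : E2 ≃ₗᵢ[ℝ] E2) (p q : ℝ × ℝ) :
    dist (frame e p) (frame e q) = √((p.1 - q.1) ^ 2 + (p.2 - q.2) ^ 2) := by
  rw [dist_eq_norm, frame_sub, LinearIsometryEquiv.norm_map, EuclideanSpace.norm_eq]
  simp

lemma dist_frame_le (e : E2 ≃ₗᵢ[ℝ] E2) (p q : ℝ × ℝ) :
    dist (frame e p) (frame e q) ≤ |p.1 - q.1| + |p.2 - q.2| := by
  rw [dist_frame, Real.sqrt_le_left (by positivity)]
  have := mul_nonneg (abs_nonneg (p.1 - q.1)) (abs_nonneg (p.2 - q.2))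
  nlinarith [sq_abs (p.1 - q.1), sq_abs (p.2 - q.2)]

lemma abs_coord_sub_le (e : E2 ≃ₗᵢ[ℝ] E2) (x y : E2) (i : Fin 2) :
    |e x i - e y i| ≤ dist x y := by
  have h := EuclideanSpace.norm_eq (e x - e y)
  rw [← map_sub, LinearIsometryEquiv.norm_map, ← dist_eq_norm] at h
  rw [h, map_sub]
  refine Real.le_sqrt_of_sq_le ?_
  rw [sq_abs]
  simp only [PiLp.sub_apply, Real.norm_eq_abs, sq_abs, Fin.sum_univ_two]
  fin_cases i
  · simp; positivity
  · simp; positivity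

lemma frame_add_vertical (e : E2 ≃ₗᵢ[ℝ] E2) (t y : ℝ) :
    frame e (t, y) = frame e (t, 0) + y • e.symm !₂[0, 1] := by
  rw [frame, frame, ← map_smul, ← map_add]
  congr 1
  ext i
  fin_cases i <;> simp

lemma measurePreserving_frame (e : E2 ≃ₗᵢ[ℝ] E2) : MeasurePreserving (frame e) volume volume := by
  have h1 := (volume_preserving_finTwoArrow ℝ).symm
  have h2 := EuclideanSpace.volume_preserving_symm_measurableEquiv_toLp (Fin 2)
  have h3 := e.symm.measurePreserving
  have h4 := h3.comp (h2.symm.comp h1)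
  exact h4

lemma continuous_frame (e : E2 ≃ₗᵢ[ℝ] E2) : Continuous (frame e) := by
  unfold frame
  fun_prop

lemma measurable_frame (e : E2 ≃ₗᵢ[ℝ] E2) : Measurable (frame e) := (continuous_frame e).measurable

lemma continuous_coord (e : E2 ≃ₗᵢ[ℝ] E2) (i : Fin 2) : Continuous fun x => e x i := by
  fun_prop

lemma ofReal_sq_sub_le_vertical {f : E2 → ℝ} (hf : ContDiff ℝ 1 f) (e : E2 ≃ₗᵢ[ℝ] E2) (t : ℝ)
    {a b : ℝ} (hab : a ≤ b) :
    ENNReal.ofReal ((f (frame e (t, b)) - f (frame e (t, a))) ^ 2) ≤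
      ENNReal.ofReal (b - a) * ∫⁻ y in Ioc a b, gradSq f (frame e (t, y)) := by
  have h := ofReal_sq_sub_le_segment hf (frame e (t, 0)) (e.symm !₂[0, 1]) hab
  have hn : ‖e.symm !₂[(0 : ℝ), 1]‖ = 1 := by
    rw [LinearIsometryEquiv.norm_map, EuclideanSpace.norm_eq]
    simp
  simp only [← frame_add_vertical, hn, one_pow, ENNReal.ofReal_one, one_mul] at h
  exact h

lemma lintegral_lintegral_frame_le (e : E2 ≃ₗᵢ[ℝ] E2) {m : Measure ℝ} {C : ℝ≥0∞}
    (hm : m ≤ C • volume) {Z : Set E2} (hZ : MeasurableSet Z) {F : E2 → ℝ≥0∞}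
    (hF : Measurable F) {A : Set ℝ} (hA : MeasurableSet A) {I : ℝ → Set ℝ}
    (hI : ∀ t, MeasurableSet (I t)) (h : ∀ t ∈ A, ∀ y ∈ I t, frame e (t, y) ∈ Z) :
    ∫⁻ t in A, (∫⁻ y in I t, F (frame e (t, y))) ∂m ≤ C * ∫⁻ x in Z, F x := by
  have hG : Measurable (Z.indicator F) := hF.indicator hZ
  calc ∫⁻ t in A, (∫⁻ y in I t, F (frame e (t, y))) ∂m
      ≤ ∫⁻ t in A, (∫⁻ y, Z.indicator F (frame e (t, y))) ∂m := by
        refine setLIntegral_mono' hA fun t ht => ?_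
        rw [← lintegral_indicator (hI t)]
        refine lintegral_mono fun y => ?_
        by_cases hy : y ∈ I t
        · rw [indicator_of_mem hy, indicator_of_mem (h t ht y hy)]
        · rw [indicator_of_notMem hy]
          exact zero_le
    _ ≤ ∫⁻ t, (∫⁻ y, Z.indicator F (frame e (t, y))) ∂m := setLIntegral_le_lintegral _ _
    _ ≤ ∫⁻ t, (∫⁻ y, Z.indicator F (frame e (t, y))) ∂(C • volume) := lintegral_mono' hm le_rfl
    _ = C * ∫⁻ t, ∫⁻ y, Z.indicator F (frame e (t, y)) := by
        rw [lintegral_smul_measure, smul_eq_mul]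
    _ = C * ∫⁻ p : ℝ × ℝ, Z.indicator F (frame e p) := by
        rw [Measure.volume_eq_prod,
          lintegral_prod (fun p => Z.indicator F (frame e p))
            (hG.comp (measurable_frame e)).aemeasurable]
    _ = C * ∫⁻ x in Z, F x := by
        rw [(measurePreserving_frame e).lintegral_comp hG, lintegral_indicator hZ]

/-- The energy controls the vertical oscillation above a measure on the line. -/
lemma lintegral_sq_sub_vertical_le {f : E2 → ℝ} (hf : ContDiff ℝ 1 f) (e : E2 ≃ₗᵢ[ℝ] E2)
    {m : Measure ℝ} {C : ℝ≥0∞} (hm : m ≤ C • volume) {Z : Set E2} (hZ : MeasurableSet Z)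
    {A : Set ℝ} (hA : MeasurableSet A) {α β : ℝ → ℝ} {d : ℝ} (hαβ : ∀ t ∈ A, α t ≤ β t)
    (hd : ∀ t ∈ A, β t - α t ≤ d)
    (h : ∀ t ∈ A, ∀ y ∈ Ioo (α t) (β t), frame e (t, y) ∈ Z) :
    ∫⁻ t in A, ENNReal.ofReal ((f (frame e (t, β t)) - f (frame e (t, α t))) ^ 2) ∂m ≤
      ENNReal.ofReal d * (C * dirEnergy Z f) := by
  calc _ ≤ ∫⁻ t in A, (ENNReal.ofReal d *
          ∫⁻ y in Ioo (α t) (β t), gradSq f (frame e (t, y))) ∂m := by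
        refine setLIntegral_mono' hA fun t ht => ?_
        refine (ofReal_sq_sub_le_vertical hf e t (hαβ t ht)).trans ?_
        rw [restrict_Ioo_eq_restrict_Ioc]
        gcongr
        exact hd t ht
    _ = ENNReal.ofReal d * ∫⁻ t in A, (∫⁻ y in Ioo (α t) (β t), gradSq f (frame e (t, y))) ∂m :=
        lintegral_const_mul' _ _ ENNReal.ofReal_ne_top
    _ ≤ _ := by
        gcongr
        exact lintegral_lintegral_frame_le e hm hZ (measurable_gradSq hf) hA
          (fun t => measurableSet_Ioo) h

/-! ### Control of measures by the energy of a region -/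

lemma lintegral_translate_sub_le {f : E2 → ℝ} (hf : ContDiff ℝ 1 f) {β : Measure E2} {C : ℝ≥0∞}
    (hβ : β ≤ C • volume) {A G : Set E2} (hA : MeasurableSet A) (hG : MeasurableSet G) (τ : E2)
    (h : ∀ x ∈ A, ∀ t ∈ Icc (0 : ℝ) 1, x + t • τ ∈ G) :
    ∫⁻ x in A, ENNReal.ofReal ((f (x + τ) - f x) ^ 2) ∂β ≤
      C * (ENNReal.ofReal (‖τ‖ ^ 2) * dirEnergy G f) := by
  have hF : Measurable (G.indicator (gradSq f)) := (measurable_gradSq hf).indicator hG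
  calc ∫⁻ x in A, ENNReal.ofReal ((f (x + τ) - f x) ^ 2) ∂β
      ≤ ∫⁻ x in A, (ENNReal.ofReal (‖τ‖ ^ 2) *
          ∫⁻ t in Ioc (0 : ℝ) 1, G.indicator (gradSq f) (x + t • τ)) ∂β := by
        refine setLIntegral_mono' hA fun x hx => ?_
        have h1 := ofReal_sq_sub_le_segment hf x τ zero_le_one
        simp only [one_smul, zero_smul, add_zero, sub_zero, ENNReal.ofReal_one, one_mul] at h1
        refine h1.trans ?_
        refine mul_le_mul' le_rfl ?_
        refine setLIntegral_mono' measurableSet_Ioc fun t ht => ?_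
        rw [indicator_of_mem (h x hx t ⟨ht.1.le, ht.2⟩)]
    _ ≤ ∫⁻ x, (ENNReal.ofReal (‖τ‖ ^ 2) *
          ∫⁻ t in Ioc (0 : ℝ) 1, G.indicator (gradSq f) (x + t • τ)) ∂(C • volume) :=
        (setLIntegral_le_lintegral _ _).trans (lintegral_mono' hβ le_rfl)
    _ = C * (ENNReal.ofReal (‖τ‖ ^ 2) *
          ∫⁻ x, ∫⁻ t in Ioc (0 : ℝ) 1, G.indicator (gradSq f) (x + t • τ)) := by
        rw [lintegral_smul_measure, smul_eq_mul, lintegral_const_mul' _ _ ENNReal.ofReal_ne_top]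
    _ = C * (ENNReal.ofReal (‖τ‖ ^ 2) *
          ∫⁻ t in Ioc (0 : ℝ) 1, ∫⁻ x, G.indicator (gradSq f) (x + t • τ)) := by
        rw [lintegral_lintegral_swap]
        exact (hF.comp (by fun_prop)).aemeasurable
    _ = C * (ENNReal.ofReal (‖τ‖ ^ 2) * dirEnergy G f) := by
        simp only [lintegral_add_right_eq_self (G.indicator (gradSq f)), lintegral_indicator hG,
          dirEnergy_eq]
        simp

lemma lintegral_translate_le {f : E2 → ℝ} (hf : ContDiff ℝ 1 f) {β : Measure E2} {C : ℝ≥0∞}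
    (hβ : β ≤ C • volume) {A G : Set E2} (hA : MeasurableSet A) (hG : MeasurableSet G) (τ : E2)
    (h : ∀ x ∈ A, ∀ t ∈ Icc (0 : ℝ) 1, x + t • τ ∈ G) :
    ∫⁻ x in A, valSq f (x + τ) ∂β ≤ 2 * ∫⁻ x in A, valSq f x ∂β +
      2 * (C * (ENNReal.ofReal (‖τ‖ ^ 2) * dirEnergy G f)) := by
  have hm : Measurable fun x => ENNReal.ofReal ((f (x + τ) - f x) ^ 2) := by
    have := hf.continuous
    fun_prop
  calc ∫⁻ x in A, valSq f (x + τ) ∂β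
      ≤ ∫⁻ x in A, (2 * valSq f x + 2 * ENNReal.ofReal ((f (x + τ) - f x) ^ 2)) ∂β :=
        lintegral_mono fun x => ofReal_sq_le_two _ _
    _ = 2 * ∫⁻ x in A, valSq f x ∂β +
          2 * ∫⁻ x in A, ENNReal.ofReal ((f (x + τ) - f x) ^ 2) ∂β := by
        rw [lintegral_add_left ((measurable_valSq hf).const_mul _),
          lintegral_const_mul' _ _ (by simp), lintegral_const_mul' _ _ (by simp)]
    _ ≤ _ := by
        gcongr
        exact lintegral_translate_sub_le hf hβ hA hG τ h

/-- The `L²(m)` norm is controlled by the functional `T` and the energy on `G`. -/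
def Controlled (G : Set E2) (T : (E2 → ℝ) → ℝ≥0∞) (m : Measure E2) : Prop :=
  ∃ C : ℝ≥0, ∀ f : E2 → ℝ, ContDiff ℝ 1 f → ∫⁻ x, valSq f x ∂m ≤ C * (T f + dirEnergy G f)

lemma Controlled.mono {G : Set E2} {T : (E2 → ℝ) → ℝ≥0∞} {m m' : Measure E2}
    (h : Controlled G T m) (hm : m' ≤ m) : Controlled G T m' := by
  obtain ⟨C, hC⟩ := h
  exact ⟨C, fun f hf => (lintegral_mono' hm le_rfl).trans (hC f hf)⟩

lemma Controlled.add {G : Set E2} {T : (E2 → ℝ) → ℝ≥0∞} {m m' : Measure E2}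
    (h : Controlled G T m) (h' : Controlled G T m') : Controlled G T (m + m') := by
  obtain ⟨C, hC⟩ := h
  obtain ⟨C', hC'⟩ := h'
  refine ⟨C + C', fun f hf => ?_⟩
  rw [lintegral_add_measure]
  refine (add_le_add (hC f hf) (hC' f hf)).trans_eq ?_
  push_cast
  ring

lemma Controlled.of_isCompact {G : Set E2} {T : (E2 → ℝ) → ℝ≥0∞} {m : Measure E2} {L : Set E2}
    (hL : IsCompact L) (h : ∀ x ∈ L, ∃ N ∈ 𝓝 x, Controlled G T (m.restrict N)) :
    Controlled G T (m.restrict L) := by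
  refine hL.induction_on (p := fun s => Controlled G T (m.restrict s)) ?_ ?_ ?_ ?_
  · exact ⟨0, fun f _ => by simp⟩
  · intro s t hst ht
    exact ht.mono (Measure.restrict_mono hst le_rfl)
  · intro s t hs ht
    exact (hs.add ht).mono (Measure.restrict_union_le s t)
  · intro x hx
    obtain ⟨N, hN, h1⟩ := h x hx
    exact ⟨N, mem_nhdsWithin_of_mem_nhds hN, h1⟩

lemma Controlled.translate_ball {G : Set E2} (hG : MeasurableSet G) {T : (E2 → ℝ) → ℝ≥0∞}
    {x : E2} {r : ℝ} (h : Controlled G T (volume.restrict (ball x r))) {τ : E2}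
    (hτ : ∀ t ∈ Icc (0 : ℝ) 1, ball (x + t • τ) r ⊆ G) :
    Controlled G T (volume.restrict (ball (x + τ) r)) := by
  obtain ⟨C, hC⟩ := h
  refine ⟨2 * C + 2 * Real.toNNReal (‖τ‖ ^ 2), fun f hf => ?_⟩
  have h1 : ∫⁻ y in ball (x + τ) r, valSq f y = ∫⁻ y in ball x r, valSq f (y + τ) := by
    have h2 : (fun y : E2 => y + τ) ⁻¹' ball (x + τ) r = ball x r := by
      ext y
      simp
    rw [← h2, (measurePreserving_add_right volume τ).setLIntegral_comp_preimage measurableSet_ball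
      (measurable_valSq hf)]
  have h3 := lintegral_translate_le hf (β := volume) (C := 1) (by simp)
    (measurableSet_ball (x := x) (ε := r)) hG τ (fun y hy t ht => hτ t ht (by simpa using hy))
  rw [h1]
  refine h3.trans ?_
  have h4 := hC f hf
  rw [one_mul]
  calc _ ≤ 2 * (C * (T f + dirEnergy G f)) +
        2 * (ENNReal.ofReal (‖τ‖ ^ 2) * (T f + dirEnergy G f)) := by
          gcongr
          exact le_add_self
    _ = _ := by
      push_cast
      rw [ENNReal.ofReal]
      ring

lemma Controlled.ball_of_isPreconnected {G : Set E2} (hG : IsOpen G) (hc : IsPreconnected G)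
    {T : (E2 → ℝ) → ℝ≥0∞} {x₀ : E2} {r₀ : ℝ} (hx₀ : x₀ ∈ G) (hr₀ : 0 < r₀)
    (h : Controlled G T (volume.restrict (ball x₀ r₀))) :
    ∀ x ∈ G, ∃ r > 0, Controlled G T (volume.restrict (ball x r)) := by
  have key : ∀ z R, ball z (2 * R) ⊆ G → ∀ x ∈ ball z R, ∀ y ∈ ball z R,
      (∃ r > 0, Controlled G T (volume.restrict (ball x r))) →
      ∃ r > 0, Controlled G T (volume.restrict (ball y r)) := by
    intro z R hz x hx y hy ⟨r, hr, hr'⟩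
    have hR : 0 < R := dist_nonneg.trans_lt (mem_ball.1 hx)
    refine ⟨min r R, lt_min hr hR, ?_⟩
    have h1 : Controlled G T (volume.restrict (ball x (min r R))) :=
      hr'.mono (Measure.restrict_mono (ball_subset_ball (min_le_left _ _)) le_rfl)
    have h2 := h1.translate_ball hG.measurableSet (τ := y - x) ?_
    · simpa using h2
    · intro t ht
      refine Subset.trans ?_ hz
      have h3 : x + t • (y - x) ∈ ball z R :=
        (convex_ball z R).add_smul_sub_mem hx hy ht
      intro w hw
      rw [mem_ball] at h3 hw ⊢
      have := dist_triangle w (x + t • (y - x)) z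
      have := min_le_right r R
      linarith
  have hsub : G ⊆ {x | x ∈ G ∧ ∃ r > 0, Controlled G T (volume.restrict (ball x r))} := by
    refine hc.subset_of_closure_inter_subset ?_ ⟨x₀, hx₀, hx₀, r₀, hr₀, h⟩ ?_
    · refine Metric.isOpen_iff.2 ?_
      rintro x ⟨hx, hxr⟩
      obtain ⟨R, hR, hRG⟩ := Metric.isOpen_iff.1 hG x hx
      refine ⟨R / 2, by positivity, fun y hy => ⟨hRG (ball_subset_ball (by linarith) hy), ?_⟩⟩
      exact key x (R / 2) (by rwa [mul_div_cancel₀ _ two_ne_zero]) x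
        (mem_ball_self (by positivity)) y hy hxr
    · rintro x ⟨hx, hxG⟩
      obtain ⟨R, hR, hRG⟩ := Metric.isOpen_iff.1 hG x hxG
      obtain ⟨y, ⟨hy, hyr⟩, hxy⟩ := mem_closure_iff.1 hx (R / 2) (by positivity)
      refine ⟨hxG, key x (R / 2) (by rwa [mul_div_cancel₀ _ two_ne_zero]) y ?_ x
        (mem_ball_self (by positivity)) hyr⟩
      rwa [mem_ball, dist_comm]
  exact fun x hx => (hsub hx).2

lemma Controlled.of_isCompact_subset {G : Set E2} {T : (E2 → ℝ) → ℝ≥0∞}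
    (h : ∀ x ∈ G, ∃ r > 0, Controlled G T (volume.restrict (ball x r))) {L : Set E2}
    (hL : IsCompact L) (hLG : L ⊆ G) : Controlled G T (volume.restrict L) := by
  refine Controlled.of_isCompact hL fun x hx => ?_
  obtain ⟨r, hr, hr'⟩ := h x (hLG hx)
  exact ⟨ball x r, ball_mem_nhds x hr, hr'⟩

/-- Poincaré inequality on balls. -/
lemma exists_lintegral_ball_sub_le {x : E2} {r : ℝ} (hr : 0 < r) :
    ∃ C : ℝ≥0, ∀ f : E2 → ℝ, ContDiff ℝ 1 f → ∃ m : ℝ,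
      ∫⁻ z in ball x r, valSq (fun z => f z - m) z ≤ C * dirEnergy (ball x r) f := by
  set B := ball x r with hB
  have hBm : MeasurableSet B := measurableSet_ball
  have hB0 : volume B ≠ 0 := (measure_ball_pos volume x hr).ne'
  have hBt : volume B ≠ ∞ := measure_ball_lt_top.ne
  set D : ℝ≥0∞ := (volume B)⁻¹ * (volume (ball (0 : E2) (2 * r)) * ENNReal.ofReal ((2 * r) ^ 2))
    with hD
  have hDt : D ≠ ∞ := ENNReal.mul_ne_top (ENNReal.inv_ne_top.2 hB0)
    (ENNReal.mul_ne_top measure_ball_lt_top.ne ENNReal.ofReal_ne_top)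
  refine ⟨D.toNNReal, fun f hf => ?_⟩
  rw [ENNReal.coe_toNNReal hDt]
  have hfc := hf.continuous
  have hmeas : Measurable (Function.uncurry fun y z : E2 => ENNReal.ofReal ((f z - f y) ^ 2)) := by
    unfold Function.uncurry
    fun_prop
  obtain ⟨y, -, hy⟩ := exists_le_setLAverage (μ := volume) (s := B)
    (f := fun y => ∫⁻ z in B, ENNReal.ofReal ((f z - f y) ^ 2)) hB0 hBt
    (Measurable.lintegral_prod_right' hmeas).aemeasurable
  refine ⟨f y, hy.trans ?_⟩
  rw [setLAverage_eq, ENNReal.div_eq_inv_mul, hD, mul_assoc]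
  gcongr
  have h1 : ∀ y ∈ B, ∫⁻ z in B, ENNReal.ofReal ((f z - f y) ^ 2) ≤
      ∫⁻ τ in ball (0 : E2) (2 * r), {y | y ∈ B ∧ y + τ ∈ B}.indicator
        (fun y => ENNReal.ofReal ((f (y + τ) - f y) ^ 2)) y := by
    intro y hy
    rw [← lintegral_indicator hBm, ← lintegral_indicator measurableSet_ball,
      ← lintegral_add_left_eq_self _ y]
    refine lintegral_mono fun τ => ?_
    by_cases hτ : y + τ ∈ B
    · have h2 : τ ∈ ball (0 : E2) (2 * r) := by
        rw [mem_ball_zero_iff]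
        have h3 := dist_triangle_right (y + τ) y x
        rw [hB, mem_ball] at hy hτ
        rw [dist_eq_norm, add_sub_cancel_left] at h3
        linarith
      rw [indicator_of_mem hτ, indicator_of_mem h2,
        indicator_of_mem (show y ∈ {y | y ∈ B ∧ y + τ ∈ B} from ⟨hy, hτ⟩)]
    · rw [indicator_of_notMem hτ]
      exact zero_le
  have hS : ∀ τ : E2, MeasurableSet {y | y ∈ B ∧ y + τ ∈ B} := fun τ =>
    hBm.inter (hBm.preimage (by fun_prop))
  calc ∫⁻ y in B, ∫⁻ z in B, ENNReal.ofReal ((f z - f y) ^ 2)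
      ≤ ∫⁻ y in B, ∫⁻ τ in ball (0 : E2) (2 * r), {y | y ∈ B ∧ y + τ ∈ B}.indicator
        (fun y => ENNReal.ofReal ((f (y + τ) - f y) ^ 2)) y := setLIntegral_mono' hBm h1
    _ ≤ ∫⁻ y, ∫⁻ τ in ball (0 : E2) (2 * r), {y | y ∈ B ∧ y + τ ∈ B}.indicator
        (fun y => ENNReal.ofReal ((f (y + τ) - f y) ^ 2)) y := setLIntegral_le_lintegral _ _
    _ = ∫⁻ τ in ball (0 : E2) (2 * r), ∫⁻ y, {y | y ∈ B ∧ y + τ ∈ B}.indicator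
        (fun y => ENNReal.ofReal ((f (y + τ) - f y) ^ 2)) y := by
        rw [lintegral_lintegral_swap]
        refine Measurable.aemeasurable ?_
        have h5 : MeasurableSet {p : E2 × E2 | p.1 ∈ B ∧ p.1 + p.2 ∈ B} :=
          (hBm.preimage measurable_fst).inter (hBm.preimage (by fun_prop))
        have h6 : Measurable fun p : E2 × E2 => ENNReal.ofReal ((f (p.1 + p.2) - f p.1) ^ 2) := by
          fun_prop
        exact h6.indicator h5
    _ ≤ ∫⁻ τ in ball (0 : E2) (2 * r), ENNReal.ofReal ((2 * r) ^ 2) * dirEnergy B f := by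
        refine setLIntegral_mono' measurableSet_ball fun τ hτ => ?_
        rw [lintegral_indicator (hS τ)]
        have h7 := lintegral_translate_sub_le hf (β := volume) (C := 1) (by simp) (hS τ) hBm τ ?_
        · refine h7.trans ?_
          rw [one_mul]
          rw [mem_ball_zero_iff] at hτ
          gcongr
        · rintro z ⟨hz, hz'⟩ t ht
          have h8 := (convex_ball x r).add_smul_sub_mem hz hz' ht
          rw [add_sub_cancel_left] at h8
          exact h8
    _ = _ := by
        rw [setLIntegral_const, mul_comm, mul_assoc]

/-- A ball of positive `β`-measure is controlled by `β`, for a measure `β` of bounded density. -/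
lemma exists_controlled_ball {G : Set E2} (hG : IsOpen G) {T : (E2 → ℝ) → ℝ≥0∞} {β : Measure E2}
    [IsFiniteMeasure β] {C : ℝ≥0} (hβ : β ≤ (C : ℝ≥0∞) • volume) (h0 : β G ≠ 0)
    (h : Controlled G T β) :
    ∃ x ∈ G, ∃ r > 0, ball x r ⊆ G ∧ Controlled G T (volume.restrict (ball x r)) := by
  obtain ⟨x, hxG, hx⟩ : ∃ x ∈ G, ∀ N ∈ 𝓝[G] x, 0 < β N :=
    exists_mem_forall_mem_nhdsWithin_pos_measure h0
  obtain ⟨R, hR, hRG⟩ := Metric.isOpen_iff.1 hG x hxG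
  set r := R / 4 with hr
  have hr0 : 0 < r := by positivity
  have hpos : 0 < β (ball x r) := hx _ (mem_nhdsWithin_of_mem_nhds (ball_mem_nhds x hr0))
  refine ⟨x, hxG, r, hr0, (ball_subset_ball (by linarith)).trans hRG, ?_⟩
  obtain ⟨D, hD⟩ := h
  set V : ℝ≥0∞ := volume (ball (0 : E2) (2 * r)) with hV
  have hVt : V ≠ ∞ := measure_ball_lt_top.ne
  set M : ℝ≥0∞ := (β (ball x r))⁻¹ * (V * (2 * D + 2 * (C * ENNReal.ofReal ((2 * r) ^ 2))))
    with hM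
  have hMt : M ≠ ∞ := by
    refine ENNReal.mul_ne_top (ENNReal.inv_ne_top.2 hpos.ne') (ENNReal.mul_ne_top hVt ?_)
    finiteness
  refine ⟨M.toNNReal, fun f hf => ?_⟩
  rw [ENNReal.coe_toNNReal hMt, hM, mul_assoc, ← ENNReal.div_eq_inv_mul,
    ENNReal.le_div_iff_mul_le (Or.inl hpos.ne') (Or.inl (measure_ne_top _ _))]
  have hA : MeasurableSet (ball x r) := measurableSet_ball
  have h1 : ∀ z ∈ ball x r, ∫⁻ y in ball x r, valSq f y ≤
      ∫⁻ τ in ball (0 : E2) (2 * r), valSq f (z + τ) := by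
    intro z hz
    rw [← lintegral_indicator hA, ← lintegral_indicator measurableSet_ball,
      ← lintegral_add_left_eq_self _ z]
    refine lintegral_mono fun τ => ?_
    by_cases hτ : z + τ ∈ ball x r
    · have h2 : τ ∈ ball (0 : E2) (2 * r) := by
        rw [mem_ball_zero_iff]
        have h3 := dist_triangle_right (z + τ) z x
        rw [mem_ball] at hz hτ
        rw [dist_eq_norm, add_sub_cancel_left] at h3
        linarith
      rw [indicator_of_mem hτ, indicator_of_mem h2]
    · rw [indicator_of_notMem hτ]
      exact zero_le
  have hfc := hf.continuous
  calc (∫⁻ y in ball x r, valSq f y) * β (ball x r)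
      = ∫⁻ z in ball x r, (∫⁻ y in ball x r, valSq f y) ∂β := by rw [setLIntegral_const]
    _ ≤ ∫⁻ z in ball x r, (∫⁻ τ in ball (0 : E2) (2 * r), valSq f (z + τ)) ∂β :=
        setLIntegral_mono' hA h1
    _ = ∫⁻ τ in ball (0 : E2) (2 * r), (∫⁻ z in ball x r, valSq f (z + τ) ∂β) := by
        rw [lintegral_lintegral_swap]
        refine Measurable.aemeasurable ?_
        unfold Function.uncurry valSq
        fun_prop
    _ ≤ ∫⁻ τ in ball (0 : E2) (2 * r),
          (2 * D + 2 * (C * ENNReal.ofReal ((2 * r) ^ 2))) * (T f + dirEnergy G f) := by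
        refine setLIntegral_mono' measurableSet_ball fun τ hτ => ?_
        rw [mem_ball_zero_iff] at hτ
        refine (lintegral_translate_le hf hβ hA hG.measurableSet τ ?_).trans ?_
        · intro z hz t ht
          refine hRG ?_
          rw [mem_ball] at hz ⊢
          have h3 := dist_triangle (z + t • τ) z x
          have h5 : dist (z + t • τ) z = t * ‖τ‖ := by
            rw [dist_eq_norm, add_sub_cancel_left, norm_smul, Real.norm_of_nonneg ht.1]
          have h4 : t * ‖τ‖ ≤ 1 * ‖τ‖ := by gcongr; exact ht.2
          linarith
        · calc _ ≤ 2 * (D * (T f + dirEnergy G f)) +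
                2 * (C * (ENNReal.ofReal ((2 * r) ^ 2) * (T f + dirEnergy G f))) := by
                gcongr
                · exact (setLIntegral_le_lintegral _ _).trans (hD f hf)
                · exact le_add_self
            _ = _ := by ring
    _ = _ := by
        rw [setLIntegral_const, ← hV]
        ring

/-! ### Polar coordinates and circles -/

/-- The unit vector of angle `θ`. -/
def unitDir (θ : ℝ) : E2 := !₂[Real.cos θ, Real.sin θ]

lemma norm_unitDir (θ : ℝ) : ‖unitDir θ‖ = 1 := by
  rw [EuclideanSpace.norm_eq, unitDir]
  simp

lemma continuous_unitDir : Continuous unitDir := by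
  unfold unitDir
  fun_prop

lemma exists_unitDir (x : E2) : ∃ θ ∈ Ioc (-Real.pi) Real.pi, x = ‖x‖ • unitDir θ := by
  have h1 : ‖(⟨x 0, x 1⟩ : ℂ)‖ = ‖x‖ := by
    rw [EuclideanSpace.norm_eq, Complex.norm_eq_sqrt_sq_add_sq]
    simp
  refine ⟨Complex.arg ⟨x 0, x 1⟩, Complex.arg_mem_Ioc _, ?_⟩
  ext i
  fin_cases i
  · have := Complex.norm_mul_cos_arg ⟨x 0, x 1⟩
    rw [h1] at this
    simpa [unitDir] using this.symm
  · have := Complex.norm_mul_sin_arg ⟨x 0, x 1⟩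
    rw [h1] at this
    simpa [unitDir] using this.symm

lemma dist_unitDir_le (θ θ' : ℝ) : dist (unitDir θ) (unitDir θ') ≤ |θ - θ'| := by
  rw [EuclideanSpace.dist_eq]
  refine Real.sqrt_le_iff.2 ⟨abs_nonneg _, ?_⟩
  have h := Real.one_sub_sq_div_two_le_cos (x := θ - θ')
  rw [Real.cos_sub] at h
  simp only [unitDir, Fin.sum_univ_two, Real.dist_eq, sq_abs]
  simp
  nlinarith [Real.sin_sq_add_cos_sq θ, Real.sin_sq_add_cos_sq θ']

lemma lintegral_sphere_le (a : E2) {r : ℝ} (hr : 0 ≤ r) {F : E2 → ℝ≥0∞} (hF : Measurable F) :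
    ∫⁻ x in sphere a r, F x ∂μH[1] ≤
      ENNReal.ofReal r * ∫⁻ θ in Ioc (-Real.pi) Real.pi, F (a + r • unitDir θ) := by
  have hc : Continuous fun θ => a + r • unitDir θ := by
    have := continuous_unitDir
    fun_prop
  have hL : LipschitzWith r.toNNReal fun θ => a + r • unitDir θ := by
    refine LipschitzWith.of_dist_le_mul fun θ θ' => ?_
    rw [dist_add_left, dist_smul₀, Real.norm_of_nonneg hr, Real.coe_toNNReal _ hr, Real.dist_eq]
    gcongr
    exact dist_unitDir_le _ _
  have key : μH[1].restrict (sphere a r) ≤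
      (ENNReal.ofReal r • volume.restrict (Ioc (-Real.pi) Real.pi)).map
        fun θ => a + r • unitDir θ := by
    refine Measure.le_iff.2 fun A hA => ?_
    rw [Measure.map_apply hc.measurable hA, Measure.restrict_apply hA, Measure.smul_apply,
      Measure.restrict_apply (hc.measurable hA), smul_eq_mul]
    have h1 : A ∩ sphere a r ⊆ (fun θ => a + r • unitDir θ) ''
        ((fun θ => a + r • unitDir θ) ⁻¹' A ∩ Ioc (-Real.pi) Real.pi) := by
      rintro x ⟨hxA, hx⟩
      obtain ⟨θ, hθ, h2⟩ := exists_unitDir (x - a)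
      rw [mem_sphere, dist_eq_norm] at hx
      rw [hx] at h2
      have h3 : a + r • unitDir θ = x := by rw [← h2]; abel
      exact ⟨θ, ⟨by rwa [mem_preimage, h3], hθ⟩, h3⟩
    refine (measure_mono h1).trans ?_
    have h4 := hL.hausdorffMeasure_image_le zero_le_one
      ((fun θ => a + r • unitDir θ) ⁻¹' A ∩ Ioc (-Real.pi) Real.pi)
    rw [hausdorffMeasure_real, ENNReal.rpow_one] at h4
    exact h4
  refine (lintegral_mono' key le_rfl).trans_eq ?_
  rw [lintegral_map hF hc.measurable, lintegral_smul_measure, smul_eq_mul]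

lemma hausdorffMeasure_sphere_lt_top (a : E2) {r : ℝ} (hr : 0 ≤ r) : μH[1] (sphere a r) < ∞ := by
  have h := lintegral_sphere_le a hr (F := fun _ => 1) measurable_const
  simp only [lintegral_const, one_mul, Measure.restrict_apply_univ] at h
  refine h.trans_lt ?_
  rw [Real.volume_Ioc]
  finiteness

lemma lintegral_annulus_le (a : E2) {α β : ℝ} (hα : 0 ≤ α) {F : E2 → ℝ≥0∞} (hF : Measurable F) :
    ∫⁻ ρ in Ioo α β, (∫⁻ θ in Ioc (-Real.pi) Real.pi,
      ENNReal.ofReal ρ * F (a + ρ • unitDir θ)) ≤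
        ∫⁻ x in {x | α < dist x a ∧ dist x a < β}, F x := by
  set A : Set E2 := {x | α < dist x a ∧ dist x a < β} with hA
  have hAm : MeasurableSet A := by
    have h1 : Measurable fun x : E2 => dist x a := by fun_prop
    exact (measurableSet_lt measurable_const h1).inter (measurableSet_lt h1 measurable_const)
  have hFA : Measurable (A.indicator F) := hF.indicator hAm
  have hfr := measurePreserving_frame (LinearIsometryEquiv.refl ℝ E2)
  calc _ = ∫⁻ ρ in Ioo α β, (∫⁻ θ in Ioo (-Real.pi) Real.pi,
          ENNReal.ofReal ρ * F (a + ρ • unitDir θ)) := by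
        simp only [restrict_Ioo_eq_restrict_Ioc]
    _ = ∫⁻ p in Ioo α β ×ˢ Ioo (-Real.pi) Real.pi,
          ENNReal.ofReal p.1 * F (a + p.1 • unitDir p.2) := by
        rw [Measure.volume_eq_prod, setLIntegral_prod]
        have := continuous_unitDir
        exact ((by fun_prop : Measurable fun p : ℝ × ℝ => ENNReal.ofReal p.1).mul
          (hF.comp (by fun_prop))).aemeasurable
    _ ≤ ∫⁻ p in polarCoord.target, ENNReal.ofReal p.1 •
          (A.indicator F) (a + frame (LinearIsometryEquiv.refl ℝ E2) (polarCoord.symm p)) := by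
        have hs : Ioo α β ×ˢ Ioo (-Real.pi) Real.pi ⊆ polarCoord.target := by
          rintro p ⟨hp, hp'⟩
          exact ⟨hα.trans_lt hp.1, hp'⟩
        refine le_trans ?_ (lintegral_mono_set hs)
        refine setLIntegral_mono' (measurableSet_Ioo.prod measurableSet_Ioo) fun p hp => ?_
        have h1 : frame (LinearIsometryEquiv.refl ℝ E2) (polarCoord.symm p) =
            p.1 • unitDir p.2 := by
          ext i
          fin_cases i
          · simp [frame, unitDir]
            rfl
          · simp [frame, unitDir]
            rfl
        have h2 : a + p.1 • unitDir p.2 ∈ A := by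
          have h3 : dist (a + p.1 • unitDir p.2) a = p.1 := by
            rw [dist_eq_norm, add_sub_cancel_left, norm_smul, norm_unitDir, mul_one,
              Real.norm_of_nonneg (hα.trans hp.1.1.le)]
          exact ⟨h3.symm ▸ hp.1.1, h3.symm ▸ hp.1.2⟩
        rw [h1, indicator_of_mem h2, smul_eq_mul]
    _ = ∫⁻ p, (A.indicator F) (a + frame (LinearIsometryEquiv.refl ℝ E2) p) :=
        lintegral_comp_polarCoord_symm
          fun p => (A.indicator F) (a + frame (LinearIsometryEquiv.refl ℝ E2) p)
    _ = ∫⁻ x, (A.indicator F) (a + x) :=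
        hfr.lintegral_comp (f := fun x => (A.indicator F) (a + x)) (hFA.comp (by fun_prop))
    _ = _ := by
        rw [lintegral_add_left_eq_self (A.indicator F), lintegral_indicator hAm]

lemma controlled_sphere (a : E2) {α a₀ b₀ β r : ℝ} (hα : 0 < α) (ha : α ≤ a₀) (hab : a₀ < b₀)
    (hb : b₀ ≤ β) (hr : r ∈ Icc α β) :
    Controlled {x | α < dist x a ∧ dist x a < β}
      (fun f => ∫⁻ x in {x | a₀ < dist x a ∧ dist x a < b₀}, valSq f x)
      (μH[1].restrict (sphere a r)) := by
  have hr0 : 0 < r := hα.trans_le hr.1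
  set ℓ := b₀ - a₀ with hℓ
  have hℓ0 : 0 < ℓ := sub_pos.2 hab
  set I := Ioc (-Real.pi) Real.pi with hI
  refine ⟨(r * (ℓ⁻¹ * (2 * α⁻¹ * (1 + (β - α) * ℓ)))).toNNReal, fun f hf => ?_⟩
  have hfc := hf.continuous
  have hu := continuous_unitDir
  refine (lintegral_sphere_le a hr0.le (measurable_valSq hf)).trans ?_
  have hab' : α ≤ β := hr.1.trans hr.2
  set P : ℝ → ℝ → ℝ≥0∞ := fun ρ θ => valSq f (a + ρ • unitDir θ) with hP
  set Q : ℝ → ℝ≥0∞ := fun θ => ∫⁻ σ in Ioo α β, gradSq f (a + σ • unitDir θ) with hQ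
  have hQm : Measurable Q := by
    have h1 : Measurable fun p : ℝ × ℝ => gradSq f (a + p.2 • unitDir p.1) :=
      (measurable_gradSq hf).comp (by fun_prop)
    exact Measurable.lintegral_prod_right'
      (f := fun p : ℝ × ℝ => gradSq f (a + p.2 • unitDir p.1)) h1
  have h1 : ∀ ρ ∈ Ioo a₀ b₀, ∀ θ, P r θ ≤ 2 * P ρ θ + 2 * (ENNReal.ofReal (β - α) * Q θ) := by
    intro ρ hρ θ
    refine (ofReal_sq_le_two _ (f (a + ρ • unitDir θ))).trans (add_le_add le_rfl ?_)
    have h2 : ∀ s t, α ≤ s → s ≤ t → t ≤ β →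
        ENNReal.ofReal ((f (a + t • unitDir θ) - f (a + s • unitDir θ)) ^ 2) ≤
          ENNReal.ofReal (β - α) * Q θ := by
      intro s t hs hst ht
      refine (ofReal_sq_sub_le_segment hf a (unitDir θ) hst).trans ?_
      rw [norm_unitDir, one_pow, ENNReal.ofReal_one, one_mul, hQ]
      simp only [restrict_Ioo_eq_restrict_Ioc]
      refine mul_le_mul' (ENNReal.ofReal_le_ofReal (by linarith)) ?_
      exact lintegral_mono_set (Ioc_subset_Ioc hs ht)
    refine mul_le_mul' le_rfl ?_
    rcases le_total r ρ with h | h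
    · rw [← neg_sq, neg_sub]
      exact h2 r ρ hr.1 h (hρ.2.le.trans hb)
    · exact h2 ρ r (ha.trans hρ.1.le) h hr.2
  have hα' : ∀ (p q : ℝ) (F : E2 → ℝ≥0∞), Measurable F → α ≤ p →
      ∫⁻ ρ in Ioo p q, (∫⁻ θ in I, F (a + ρ • unitDir θ)) ≤
        ENNReal.ofReal α⁻¹ * ∫⁻ x in {x | p < dist x a ∧ dist x a < q}, F x := by
    intro p q F hF hp
    refine le_trans ?_ (mul_le_mul' le_rfl (lintegral_annulus_le a (hα.le.trans hp) hF))
    rw [← lintegral_const_mul' _ _ ENNReal.ofReal_ne_top]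
    refine setLIntegral_mono' measurableSet_Ioo fun ρ hρ => ?_
    rw [← lintegral_const_mul' _ _ ENNReal.ofReal_ne_top]
    refine lintegral_mono fun θ => ?_
    rw [← mul_assoc, ← ENNReal.ofReal_mul (by positivity)]
    refine le_mul_of_one_le_left' ?_
    rw [ENNReal.one_le_ofReal, ← div_eq_inv_mul, one_le_div hα]
    exact hp.trans hρ.1.le
  have h3 : ENNReal.ofReal ℓ * ∫⁻ θ in I, P r θ ≤
      ENNReal.ofReal (2 * α⁻¹ * (1 + (β - α) * ℓ)) *
        ((∫⁻ x in {x | a₀ < dist x a ∧ dist x a < b₀}, valSq f x) +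
          dirEnergy {x | α < dist x a ∧ dist x a < β} f) := by
    calc ENNReal.ofReal ℓ * ∫⁻ θ in I, P r θ = ∫⁻ ρ in Ioo a₀ b₀, (∫⁻ θ in I, P r θ) := by
          rw [setLIntegral_const, Real.volume_Ioo, mul_comm]
      _ ≤ ∫⁻ ρ in Ioo a₀ b₀, (∫⁻ θ in I, (2 * P ρ θ + 2 * (ENNReal.ofReal (β - α) * Q θ))) :=
          setLIntegral_mono' measurableSet_Ioo fun ρ hρ => lintegral_mono fun θ => h1 ρ hρ θ
      _ = ∫⁻ ρ in Ioo a₀ b₀, (2 * (∫⁻ θ in I, P ρ θ) +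
            2 * (ENNReal.ofReal (β - α) * ∫⁻ θ in I, Q θ)) := by
          refine lintegral_congr fun ρ => ?_
          rw [lintegral_add_right _ (by fun_prop), lintegral_const_mul' _ _ (by simp),
            lintegral_const_mul' _ _ (by simp), lintegral_const_mul' _ _ ENNReal.ofReal_ne_top]
      _ = 2 * (∫⁻ ρ in Ioo a₀ b₀, (∫⁻ θ in I, P ρ θ)) +
            2 * (ENNReal.ofReal (β - α) * ∫⁻ θ in I, Q θ) * ENNReal.ofReal ℓ := by
          rw [lintegral_add_right _ measurable_const, lintegral_const_mul' _ _ (by simp),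
            setLIntegral_const, Real.volume_Ioo]
      _ = 2 * (∫⁻ ρ in Ioo a₀ b₀, (∫⁻ θ in I, P ρ θ)) +
            2 * (ENNReal.ofReal (β - α) * ∫⁻ σ in Ioo α β, (∫⁻ θ in I,
              gradSq f (a + σ • unitDir θ))) * ENNReal.ofReal ℓ := by
          have h5 : Measurable fun p : ℝ × ℝ => gradSq f (a + p.2 • unitDir p.1) :=
            (measurable_gradSq hf).comp (by fun_prop)
          have h8 : ∫⁻ θ in I, Q θ = ∫⁻ σ in Ioo α β, (∫⁻ θ in I, gradSq f (a + σ • unitDir θ)) :=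
            lintegral_lintegral_swap h5.aemeasurable
          rw [h8]
      _ ≤ 2 * (ENNReal.ofReal α⁻¹ * ∫⁻ x in {x | a₀ < dist x a ∧ dist x a < b₀}, valSq f x) +
            2 * (ENNReal.ofReal (β - α) * (ENNReal.ofReal α⁻¹ *
              dirEnergy {x | α < dist x a ∧ dist x a < β} f)) * ENNReal.ofReal ℓ := by
          gcongr
          · exact hα' _ _ _ (measurable_valSq hf) ha
          · exact hα' _ _ _ (measurable_gradSq hf) le_rfl
      _ = ENNReal.ofReal (2 * α⁻¹) * (∫⁻ x in {x | a₀ < dist x a ∧ dist x a < b₀}, valSq f x) +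
            ENNReal.ofReal (2 * α⁻¹ * ((β - α) * ℓ)) *
              dirEnergy {x | α < dist x a ∧ dist x a < β} f := by
          rw [ENNReal.ofReal_mul (by positivity), ENNReal.ofReal_mul (by positivity),
            ENNReal.ofReal_mul (by positivity), ENNReal.ofReal_mul (sub_nonneg.2 hab')]
          norm_num
          ring
      _ ≤ _ := by
          have h6 : 0 ≤ (β - α) * ℓ := mul_nonneg (sub_nonneg.2 hab') hℓ0.le
          have h9 : 0 ≤ 2 * α⁻¹ := by positivity
          rw [mul_add]
          refine add_le_add (mul_le_mul' (ENNReal.ofReal_le_ofReal ?_) le_rfl)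
            (mul_le_mul' (ENNReal.ofReal_le_ofReal ?_) le_rfl)
          · exact le_mul_of_one_le_right h9 (by linarith)
          · exact mul_le_mul_of_nonneg_left (by linarith) h9
  calc ENNReal.ofReal r * ∫⁻ θ in I, P r θ
      = ENNReal.ofReal r * (ENNReal.ofReal ℓ⁻¹ * (ENNReal.ofReal ℓ * ∫⁻ θ in I, P r θ)) := by
        rw [← mul_assoc (ENNReal.ofReal ℓ⁻¹), ← ENNReal.ofReal_mul (by positivity),
          inv_mul_cancel₀ hℓ0.ne', ENNReal.ofReal_one, one_mul]
    _ ≤ ENNReal.ofReal r * (ENNReal.ofReal ℓ⁻¹ * _) :=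
        mul_le_mul' le_rfl (mul_le_mul' le_rfl h3)
    _ = _ := by
        have h7 : ∀ x : ℝ, ((x.toNNReal : ℝ≥0) : ℝ≥0∞) = ENNReal.ofReal x := fun x => rfl
        rw [h7, ENNReal.ofReal_mul hr0.le, ENNReal.ofReal_mul (inv_nonneg.2 hℓ0.le),
          mul_assoc (ENNReal.ofReal r), mul_assoc (ENNReal.ofReal ℓ⁻¹)]

/-! ### Balls with holes -/

lemma isPreconnected_setOf_dist_mem (a : E2) {I : Set ℝ} (hI : IsPreconnected I)
    (h0 : ∀ t ∈ I, 0 ≤ t) : IsPreconnected {x : E2 | dist x a ∈ I} := by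
  have h1 : {x : E2 | dist x a ∈ I} = (fun p : ℝ × ℝ => a + p.1 • unitDir p.2) '' (I ×ˢ univ) := by
    ext x
    constructor
    · intro hx
      obtain ⟨θ, -, h2⟩ := exists_unitDir (x - a)
      refine ⟨(‖x - a‖, θ), ⟨?_, mem_univ _⟩, ?_⟩
      · rw [← dist_eq_norm]
        exact hx
      · show a + ‖x - a‖ • unitDir θ = x
        rw [← h2]
        abel
    · rintro ⟨p, ⟨hp, -⟩, rfl⟩
      show dist (a + p.1 • unitDir p.2) a ∈ I
      rwa [dist_eq_norm, add_sub_cancel_left, norm_smul, norm_unitDir, mul_one,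
        Real.norm_of_nonneg (h0 _ hp)]
  rw [h1]
  have := continuous_unitDir
  exact (hI.prod isPreconnected_univ).image _ (by fun_prop)

lemma IsPreconnected.diff_closedBall {U : Set E2} (hU : IsOpen U) (hc : IsPreconnected U) {a : E2}
    {r R : ℝ} (hr : 0 ≤ r) (hrR : r < R) (hR : ball a R ⊆ U) :
    IsPreconnected (U \ closedBall a r) := by
  set A : Set E2 := {x | dist x a ∈ Ioo r R} with hA
  have hAc : IsPreconnected A := isPreconnected_setOf_dist_mem a isPreconnected_Ioo
    fun t ht => hr.trans ht.1.le
  have hXo : IsOpen (U \ closedBall a r) := hU.sdiff isClosed_closedBall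
  have hAX : A ⊆ U \ closedBall a r := by
    intro x hx
    refine ⟨hR (mem_ball.2 hx.2), ?_⟩
    rw [mem_closedBall, not_le]
    exact hx.1
  have haX : a ∉ U \ closedBall a r := fun h => h.2 (mem_closedBall_self hr)
  rw [isPreconnected_iff_subset_of_disjoint]
  have key : ∀ u v : Set E2, IsOpen u → IsOpen v → U \ closedBall a r ⊆ u ∪ v →
      (U \ closedBall a r) ∩ (u ∩ v) = ∅ → A ⊆ u → U \ closedBall a r ⊆ u := by
    intro u v hu hv huv hd hAu
    have h1 := isPreconnected_iff_subset_of_disjoint.1 hc (u ∩ (U \ closedBall a r) ∪ ball a R)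
      (v ∩ (U \ closedBall a r)) ((hu.inter hXo).union isOpen_ball) (hv.inter hXo) ?_ ?_
    · rcases h1 with h1 | h1
      · intro x hx
        rcases h1 hx.1 with h2 | h2
        · exact h2.1
        · refine hAu ⟨?_, h2⟩
          have := hx.2
          rwa [mem_closedBall, not_le] at this
      · exact absurd (h1 (hR (mem_ball_self (hr.trans_lt hrR)))).2 haX
    · intro x hx
      by_cases hxa : x ∈ closedBall a r
      · exact Or.inl (Or.inr (closedBall_subset_ball hrR hxa))
      · rcases huv ⟨hx, hxa⟩ with h2 | h2
        · exact Or.inl (Or.inl ⟨h2, hx, hxa⟩)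
        · exact Or.inr ⟨h2, hx, hxa⟩
    · refine eq_empty_iff_forall_notMem.2 ?_
      rintro x ⟨hx, h2 | h2, h3, h4⟩
      · exact eq_empty_iff_forall_notMem.1 hd x ⟨h4, h2.1, h3⟩
      · have h5 := h4.2
        rw [mem_closedBall, not_le] at h5
        exact eq_empty_iff_forall_notMem.1 hd x ⟨h4, hAu ⟨h5, h2⟩, h3⟩
  intro u v hu hv huv hd
  rcases isPreconnected_iff_subset_of_disjoint.1 hAc u v hu hv (hAX.trans huv)
    (subset_eq_empty (inter_subset_inter_left _ hAX) hd) with h | h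
  · exact Or.inl (key u v hu hv huv hd h)
  · exact Or.inr (key v u hv hu (by rwa [union_comm]) (by rwa [inter_comm v u]) h)

lemma isPreconnected_diff_biUnion_closedBall {U : Set E2} (hU : IsOpen U) (hc : IsPreconnected U)
    {r : ℝ} (hr : 0 < r) (H : Finset E2) (hH : ∀ a ∈ H, ball a (2 * r) ⊆ U)
    (hd : ∀ a ∈ H, ∀ b ∈ H, a ≠ b → 3 * r ≤ dist a b) :
    IsPreconnected (U \ ⋃ a ∈ H, closedBall a r) := by
  classical
  induction H using Finset.induction_on with
  | empty => simpa using hc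
  | insert a H ha ih =>
    have h1 := ih (fun b hb => hH b (Finset.mem_insert_of_mem hb)) fun b hb c hc =>
      hd b (Finset.mem_insert_of_mem hb) c (Finset.mem_insert_of_mem hc)
    rw [Finset.set_biUnion_insert, union_comm, ← sdiff_sdiff]
    have h2 : IsOpen (U \ ⋃ b ∈ H, closedBall b r) :=
      hU.sdiff (H.finite_toSet.isClosed_biUnion fun b _ => isClosed_closedBall)
    refine IsPreconnected.diff_closedBall h2 h1 hr.le (R := 2 * r) (by linarith) fun x hx =>
      ⟨hH a (Finset.mem_insert_self _ _) hx, ?_⟩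
    simp only [mem_iUnion, not_exists, mem_closedBall, not_le]
    intro b hb
    have h3 := hd a (Finset.mem_insert_self _ _) b (Finset.mem_insert_of_mem hb)
      (by rintro rfl; exact ha hb)
    rw [mem_ball] at hx
    have := dist_triangle_left a b x
    linarith

lemma exists_isometry_apply_eq {u w : E2} (h : ‖u‖ = ‖w‖) : ∃ e : E2 ≃ₗᵢ[ℝ] E2, e u = w :=
  ⟨(ℝ ∙ (u - w))ᗮ.reflection, Submodule.reflection_sub h⟩

lemma exists_contDiff_sqrt {r : ℝ} (hr : 0 < r) :
    ∃ φ : ℝ → ℝ, ContDiff ℝ (⊤ : ℕ∞) φ ∧ ∀ t, |t| < r / 2 → φ t = √(r ^ 2 - t ^ 2) := by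
  let χ : ContDiffBump (0 : ℝ) := ⟨r / 2, 3 * r / 4, by positivity, by linarith⟩
  refine ⟨fun t => √(r ^ 2 - t ^ 2 * χ t), ?_, fun t ht => ?_⟩
  · have h1 : ContDiff ℝ (⊤ : ℕ∞) fun t : ℝ => r ^ 2 - t ^ 2 * χ t :=
      contDiff_const.sub ((contDiff_id.pow 2).mul χ.contDiff)
    refine h1.sqrt fun t => ?_
    by_cases ht : |t| < 3 * r / 4
    · have h2 : t ^ 2 * χ t ≤ t ^ 2 * 1 := mul_le_mul_of_nonneg_left χ.le_one (sq_nonneg t)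
      have h3 : t ^ 2 ≤ (3 * r / 4) ^ 2 :=
        sq_le_sq' (by linarith [neg_abs_le t]) (by linarith [le_abs_self t])
      have : 0 < r ^ 2 := by positivity
      nlinarith
    · have h2 : χ t = 0 := by
        refine χ.zero_of_le_dist ?_
        rw [Real.dist_0_eq_abs]
        exact not_lt.1 ht
      rw [h2]
      have : 0 < r ^ 2 := by positivity
      linarith
  · have h2 : χ t = 1 := by
      refine χ.one_of_mem_closedBall ?_
      rw [mem_closedBall, Real.dist_0_eq_abs]
      exact ht.le
    show √(r ^ 2 - t ^ 2 * χ t) = _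
    rw [h2, mul_one]

lemma dist_sq_eq_coord (e : E2 ≃ₗᵢ[ℝ] E2) (x a : E2) :
    dist x a ^ 2 = (e x 0 - e a 0) ^ 2 + (e x 1 - e a 1) ^ 2 := by
  rw [← e.dist_map, EuclideanSpace.dist_eq, Real.sq_sqrt (by positivity)]
  simp [Real.dist_eq, sq_abs]

lemma exists_chart_exterior {a p : E2} {r : ℝ} (hr : 0 < r) (hp : dist p a = r) :
    ∃ (e : E2 ≃ₗᵢ[ℝ] E2) (φ : ℝ → ℝ) (U : Set E2), ContDiff ℝ (⊤ : ℕ∞) φ ∧ IsOpen U ∧ p ∈ U ∧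
      ∀ x ∈ U, (r < dist x a ↔ φ (e x 0) < e x 1) := by
  obtain ⟨φ, hφ, hφ'⟩ := exists_contDiff_sqrt hr
  obtain ⟨e, he⟩ := exists_isometry_apply_eq (u := p - a) (w := !₂[0, r]) (by
    rw [← dist_eq_norm, hp, EuclideanSpace.norm_eq]
    simp [hr.le])
  refine ⟨e, fun t => e a 1 + φ (t - e a 0),
    {x | |e x 0 - e a 0| < r / 2 ∧ e a 1 < e x 1}, ?_, ?_, ?_, ?_⟩
  · exact contDiff_const.add (hφ.comp (contDiff_id.sub contDiff_const))
  · exact IsOpen.inter (isOpen_lt (f := fun x => |e x 0 - e a 0|) (g := fun _ => r / 2)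
        (by fun_prop) (by fun_prop))
        (isOpen_lt (f := fun _ => e a 1) (g := fun x => e x 1) (by fun_prop)
        (by fun_prop))
  · rw [map_sub] at he
    have h0 := congrArg (fun z : E2 => z 0) he
    have h1 := congrArg (fun z : E2 => z 1) he
    simp at h0 h1
    refine ⟨?_, by linarith⟩
    rw [h0, abs_zero]
    positivity
  · rintro x ⟨h1, h2⟩
    show _ ↔ e a 1 + φ (e x 0 - e a 0) < e x 1
    rw [hφ' _ h1, ← sq_lt_sq₀ hr.le dist_nonneg, dist_sq_eq_coord e, ← lt_sub_iff_add_lt',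
      Real.sqrt_lt' (sub_pos.2 h2), sub_lt_iff_lt_add']

lemma exists_chart_interior {a p : E2} {r : ℝ} (hr : 0 < r) (hp : dist p a = r) :
    ∃ (e : E2 ≃ₗᵢ[ℝ] E2) (φ : ℝ → ℝ) (U : Set E2), ContDiff ℝ (⊤ : ℕ∞) φ ∧ IsOpen U ∧ p ∈ U ∧
      ∀ x ∈ U, (dist x a < r ↔ φ (e x 0) < e x 1) := by
  obtain ⟨φ, hφ, hφ'⟩ := exists_contDiff_sqrt hr
  obtain ⟨e, he⟩ := exists_isometry_apply_eq (u := p - a) (w := !₂[0, -r]) (by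
    rw [← dist_eq_norm, hp, EuclideanSpace.norm_eq]
    simp [hr.le])
  refine ⟨e, fun t => e a 1 - φ (t - e a 0),
    {x | |e x 0 - e a 0| < r / 2 ∧ e x 1 < e a 1}, ?_, ?_, ?_, ?_⟩
  · exact contDiff_const.sub (hφ.comp (contDiff_id.sub contDiff_const))
  · exact IsOpen.inter (isOpen_lt (f := fun x => |e x 0 - e a 0|) (g := fun _ => r / 2)
        (by fun_prop) (by fun_prop))
        (isOpen_lt (f := fun x => e x 1) (g := fun _ => e a 1) (by fun_prop)
        (by fun_prop))
  · rw [map_sub] at he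
    have h0 := congrArg (fun z : E2 => z 0) he
    have h1 := congrArg (fun z : E2 => z 1) he
    simp at h0 h1
    refine ⟨?_, by linarith⟩
    rw [h0, abs_zero]
    positivity
  · rintro x ⟨h1, h2⟩
    show _ ↔ e a 1 - φ (e x 0 - e a 0) < e x 1
    have h3 : e a 1 - √(r ^ 2 - (e x 0 - e a 0) ^ 2) < e x 1 ↔
        e a 1 - e x 1 < √(r ^ 2 - (e x 0 - e a 0) ^ 2) := by
      constructor <;> intro h <;> linarith
    rw [hφ' _ h1, h3, ← sq_lt_sq₀ dist_nonneg hr.le, dist_sq_eq_coord e,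
      Real.lt_sqrt (sub_nonneg.2 h2.le)]
    constructor <;> intro h <;> nlinarith

/-- The ball of radius `R` with the closed balls of radius `r` around the points of `H` removed. -/
def perforated (R r : ℝ) (H : Finset E2) : Set E2 := ball 0 R \ ⋃ a ∈ H, closedBall a r

section perforated

variable {R r : ℝ} {H : Finset E2}

lemma isOpen_perforated : IsOpen (perforated R r H) :=
  isOpen_ball.sdiff (H.finite_toSet.isClosed_biUnion fun _ _ => isClosed_closedBall)

lemma frontier_perforated_subset :
    frontier (perforated R r H) ⊆ sphere 0 R ∪ ⋃ a ∈ H, sphere a r := by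
  intro p hp
  rw [frontier, isOpen_perforated.interior_eq] at hp
  have h1 : p ∈ closedBall (0 : E2) R :=
    closure_minimal (sdiff_subset.trans ball_subset_closedBall) isClosed_closedBall hp.1
  by_cases h2 : p ∈ ball (0 : E2) R
  · right
    have h3 : p ∈ ⋃ a ∈ H, closedBall a r := by
      by_contra h
      exact hp.2 ⟨h2, h⟩
    simp only [mem_iUnion, exists_prop] at h3 ⊢
    obtain ⟨a, ha, hpa⟩ := h3
    refine ⟨a, ha, le_antisymm hpa ?_⟩
    have h4 : perforated R r H ⊆ {x | r ≤ dist x a} := by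
      intro x hx
      by_contra h
      refine hx.2 ?_
      simp only [mem_iUnion, exists_prop]
      exact ⟨a, ha, mem_closedBall.2 (not_le.1 h).le⟩
    exact closure_minimal h4 (isClosed_le continuous_const (by fun_prop)) hp.1
  · left
    exact le_antisymm h1 (not_lt.1 h2)

lemma notMem_closedBall_of_dist_lt
    (hd : ∀ a ∈ H, ∀ b ∈ H, a ≠ b → 3 * r ≤ dist a b)
    {a b x : E2} (ha : a ∈ H) (hb : b ∈ H) (hab : b ≠ a)
    (hx : dist x a < 2 * r) : r < dist x b := by
  have h1 := hd b hb a ha hab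
  have h2 := dist_triangle_left b a x
  linarith

lemma mem_perforated_iff_of_dist_lt
    (hH : ∀ a ∈ H, closedBall a (2 * r) ⊆ ball (0 : E2) R)
    (hd : ∀ a ∈ H, ∀ b ∈ H, a ≠ b → 3 * r ≤ dist a b)
    {a x : E2} (ha : a ∈ H) (hx : dist x a < 2 * r) :
    x ∈ perforated R r H ↔ r < dist x a := by
  simp only [perforated, Set.mem_sdiff, mem_iUnion, exists_prop, not_and, not_exists,
    mem_closedBall, not_le]
  constructor
  · exact fun h => h.2 a ha
  · refine fun h => ⟨hH a ha (mem_closedBall.2 hx.le), fun b hb => ?_⟩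
    by_cases hab : b = a
    · rwa [hab]
    · exact notMem_closedBall_of_dist_lt hd ha hb hab hx

lemma exists_mem_perforated_iff_of_mem_sphere
    (hr : 0 < r)
    (hH : ∀ a ∈ H, closedBall a (2 * r) ⊆ ball (0 : E2) R)
    {p : E2} (hp : dist p 0 = R) :
    ∃ U, IsOpen U ∧ p ∈ U ∧ ∀ x ∈ U, (x ∈ perforated R r H ↔ dist x 0 < R) := by
  refine ⟨(⋃ a ∈ H, closedBall a r)ᶜ,
    (H.finite_toSet.isClosed_biUnion fun _ _ => isClosed_closedBall).isOpen_compl, ?_, ?_⟩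
  · intro h
    simp only [mem_iUnion, exists_prop] at h
    obtain ⟨a, ha, hpa⟩ := h
    have := hH a ha (closedBall_subset_closedBall (by linarith) hpa)
    rw [mem_ball] at this
    exact this.ne hp
  · intro x hx
    exact ⟨fun h => h.1, fun h => ⟨h, hx⟩⟩

lemma sphere_subset_frontier_perforated
    (hr : 0 < r)
    (hH : ∀ a ∈ H, closedBall a (2 * r) ⊆ ball (0 : E2) R)
    (hd : ∀ a ∈ H, ∀ b ∈ H, a ≠ b → 3 * r ≤ dist a b)
    {a : E2} (ha : a ∈ H) :
    sphere a r ⊆ frontier (perforated R r H) := by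
  intro p hp
  rw [frontier, isOpen_perforated.interior_eq]
  refine ⟨?_, fun h => ?_⟩
  · have h1 : p ∈ closure (closedBall a r)ᶜ := by
      rw [closure_compl, interior_closedBall _ hr.ne']
      intro h
      exact (mem_ball.1 h).ne hp
    rw [mem_closure_iff_nhds] at h1 ⊢
    intro t ht
    obtain ⟨x, ⟨hx, hx'⟩, hxa⟩ := h1 (t ∩ ball a (2 * r)) (inter_mem ht (isOpen_ball.mem_nhds (by
      rw [mem_ball, mem_sphere.1 hp]
      linarith)))
    refine ⟨x, hx, (mem_perforated_iff_of_dist_lt hH hd ha hx').2 ?_⟩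
    rwa [mem_compl_iff, mem_closedBall, not_le] at hxa
  · have h2 := (mem_perforated_iff_of_dist_lt hH hd ha (by
      rw [mem_sphere.1 hp]
      linarith)).1 h
    exact h2.ne' hp

lemma isPreconnected_perforated
    (hr : 0 < r)
    (hH : ∀ a ∈ H, closedBall a (2 * r) ⊆ ball (0 : E2) R)
    (hd : ∀ a ∈ H, ∀ b ∈ H, a ≠ b → 3 * r ≤ dist a b) :
    IsPreconnected (perforated R r H) :=
  isPreconnected_diff_biUnion_closedBall isOpen_ball (convex_ball _ _).isPreconnected hr H
    (fun a ha => ball_subset_closedBall.trans (hH a ha)) hd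

lemma isSmoothDomain_perforated
    (hr : 0 < r)
    (hH : ∀ a ∈ H, closedBall a (2 * r) ⊆ ball (0 : E2) R)
    (hd : ∀ a ∈ H, ∀ b ∈ H, a ≠ b → 3 * r ≤ dist a b)
    (hne : (perforated R r H).Nonempty) :
    IsSmoothDomain (perforated R r H) := by
  refine ⟨isOpen_perforated, ⟨hne, isPreconnected_perforated hr hH hd⟩,
    isBounded_ball.subset sdiff_subset, fun p hp => ?_⟩
  have hR : 0 < R := by
    obtain ⟨x, hx, -⟩ := hne
    exact dist_nonneg.trans_lt (mem_ball.1 hx)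
  rcases frontier_perforated_subset hp with h | h
  · obtain ⟨e, φ, U, hφ, hU, hpU, h1⟩ := exists_chart_interior hR (mem_sphere.1 h)
    obtain ⟨U', hU', hpU', h2⟩ := exists_mem_perforated_iff_of_mem_sphere hr hH (mem_sphere.1 h)
    exact ⟨e, φ, U ∩ U', hφ, hU.inter hU', ⟨hpU, hpU'⟩,
      fun x hx => (h2 x hx.2).trans (h1 x hx.1)⟩
  · simp only [mem_iUnion, exists_prop] at h
    obtain ⟨a, ha, hpa⟩ := h
    obtain ⟨e, φ, U, hφ, hU, hpU, h1⟩ := exists_chart_exterior hr (mem_sphere.1 hpa)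
    refine ⟨e, φ, U ∩ ball a (2 * r), hφ, hU.inter isOpen_ball, ⟨hpU, ?_⟩, fun x hx =>
      (mem_perforated_iff_of_dist_lt hH hd ha hx.2).trans (h1 x hx.1)⟩
    rw [mem_ball, mem_sphere.1 hpa]
    linarith

end perforated

/-! ### Poincaré inequality on a cell with a hole -/

lemma Controlled.of_subset {G : Set E2} {T : (E2 → ℝ) → ℝ≥0∞} {m : Measure E2} {L L' : Set E2}
    (h : Controlled G T (m.restrict L')) (hL : L ⊆ L') : Controlled G T (m.restrict L) :=
  h.mono (Measure.restrict_mono hL le_rfl)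

lemma Controlled.sphere {G : Set E2} {T : (E2 → ℝ) → ℝ≥0∞} {a : E2} {α a₀ b₀ β r : ℝ}
    (hα : 0 < α) (ha : α ≤ a₀) (hab : a₀ < b₀) (hb : b₀ ≤ β) (hr : r ∈ Icc α β)
    (hG : {x | α < dist x a ∧ dist x a < β} ⊆ G)
    (h : Controlled G T (volume.restrict {x | a₀ < dist x a ∧ dist x a < b₀})) :
    Controlled G T (μH[1].restrict (sphere a r)) := by
  obtain ⟨C, hC⟩ := h
  obtain ⟨D, hD⟩ := controlled_sphere a hα ha hab hb hr
  refine ⟨D * C + D, fun f hf => (hD f hf).trans ?_⟩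
  calc _ ≤ D * (C * (T f + dirEnergy G f) + (T f + dirEnergy G f)) := by
        refine mul_le_mul' le_rfl (add_le_add (hC f hf) ?_)
        exact (dirEnergy_mono hG f).trans le_add_self
    _ = _ := by
        push_cast
        ring

lemma lintegral_hausdorffMeasure_le {X Y : Type*} [MetricSpace X] [MeasurableSpace X]
    [BorelSpace X] [MetricSpace Y] [MeasurableSpace Y] [BorelSpace Y] {g : X → Y} {K : ℝ≥0}
    (hg : LipschitzWith K g) {S : Set X} {T : Set Y} (hT : T ⊆ g '' S) {F : Y → ℝ≥0∞}
    (hF : Measurable F) :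
    ∫⁻ y in T, F y ∂μH[1] ≤ K * ∫⁻ x in S, F (g x) ∂μH[1] := by
  have hgm : Measurable g := hg.continuous.measurable
  have key : μH[1].restrict T ≤ ((K : ℝ≥0∞) • μH[1].restrict S).map g := by
    refine Measure.le_iff.2 fun A hA => ?_
    rw [Measure.map_apply hgm hA, Measure.restrict_apply hA, Measure.smul_apply,
      Measure.restrict_apply (hgm hA), smul_eq_mul]
    have h1 : A ∩ T ⊆ g '' (g ⁻¹' A ∩ S) := by
      rintro y ⟨hyA, hy⟩
      obtain ⟨x, hx, rfl⟩ := hT hy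
      exact ⟨x, ⟨hyA, hx⟩, rfl⟩
    refine (measure_mono h1).trans ?_
    have h4 := hg.hausdorffMeasure_image_le zero_le_one (g ⁻¹' A ∩ S)
    rwa [ENNReal.rpow_one] at h4
  refine (lintegral_mono' key le_rfl).trans_eq ?_
  rw [lintegral_map hF hgm, lintegral_smul_measure, smul_eq_mul]

/-- The unit cell without its hole. -/
def unitCell (δ : ℝ) : Set E2 :=
  {x | (0 < x 0 ∧ x 0 < 1) ∧ -(1 / 2) < x 1 ∧ x 1 < 1 / 2} \
    closedBall !₂[1 - δ / 2, 0] (δ / 8)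

lemma abs_apply_sub_le_dist (x y : E2) (i : Fin 2) : |x i - y i| ≤ dist x y :=
  abs_coord_sub_le (LinearIsometryEquiv.refl ℝ E2) x y i

lemma isOpen_unitRect :
    IsOpen {x : E2 | (0 < x 0 ∧ x 0 < 1) ∧ -(1 / 2) < x 1 ∧ x 1 < 1 / 2} := by
  have h0 : Continuous fun x : E2 => x 0 := by fun_prop
  have h1 : Continuous fun x : E2 => x 1 := by fun_prop
  exact ((isOpen_lt continuous_const h0).inter (isOpen_lt h0 continuous_const)).inter
    ((isOpen_lt continuous_const h1).inter (isOpen_lt h1 continuous_const))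

lemma convex_unitRect :
    Convex ℝ {x : E2 | (0 < x 0 ∧ x 0 < 1) ∧ -(1 / 2) < x 1 ∧ x 1 < 1 / 2} := by
  have h0 : IsLinearMap ℝ fun x : E2 => x 0 := ⟨fun _ _ => rfl, fun _ _ => rfl⟩
  have h1 : IsLinearMap ℝ fun x : E2 => x 1 := ⟨fun _ _ => rfl, fun _ _ => rfl⟩
  exact ((convex_halfSpace_gt h0 _).inter (convex_halfSpace_lt h0 _)).inter
    ((convex_halfSpace_gt h1 _).inter (convex_halfSpace_lt h1 _))

lemma ball_subset_unitRect {δ : ℝ} (hδ1 : δ < 1 / 4) :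
    ball (!₂[1 - δ / 2, 0] : E2) (δ / 4) ⊆
      {x | (0 < x 0 ∧ x 0 < 1) ∧ -(1 / 2) < x 1 ∧ x 1 < 1 / 2} := by
  intro x hx
  rw [mem_ball] at hx
  have h0 := abs_lt.1 ((abs_apply_sub_le_dist x _ 0).trans_lt hx)
  have h1 := abs_lt.1 ((abs_apply_sub_le_dist x _ 1).trans_lt hx)
  simp at h0 h1
  refine ⟨⟨?_, ?_⟩, ?_, ?_⟩ <;> linarith

lemma exists_unitCell_le {δ : ℝ} (hδ : 0 < δ) (hδ1 : δ < 1 / 4) :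
    ∃ C : ℝ≥0, ∀ f : E2 → ℝ, ContDiff ℝ 1 f → ∃ m : ℝ,
      ∫⁻ x in {x | (δ ≤ x 0 ∧ x 0 ≤ 1 - δ) ∧ -(1 / 4) ≤ x 1 ∧ x 1 ≤ 1 / 4},
        valSq (fun z => f z - m) x ≤ C * dirEnergy (unitCell δ) f ∧
      ∫⁻ x in sphere !₂[1 - δ / 2, 0] (δ / 8), valSq (fun z => f z - m) x ∂μH[1] ≤
        C * dirEnergy (unitCell δ) f := by
  set G := unitCell δ with hG
  set c : E2 := !₂[1 - δ / 2, 0] with hc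
  have hGo : IsOpen G := isOpen_unitRect.sdiff isClosed_closedBall
  have hGc : IsPreconnected G :=
    convex_unitRect.isPreconnected.diff_closedBall isOpen_unitRect (by positivity)
      (R := δ / 4) (by linarith) (ball_subset_unitRect hδ1)
  set B : Set E2 := ball !₂[1 / 2, 0] (δ / 8) with hB
  have hBG : B ⊆ G := by
    intro x hx
    rw [hB, mem_ball] at hx
    have h0 := abs_lt.1 ((abs_apply_sub_le_dist x _ 0).trans_lt hx)
    have h1 := abs_lt.1 ((abs_apply_sub_le_dist x _ 1).trans_lt hx)
    simp at h0 h1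
    refine ⟨⟨⟨?_, ?_⟩, ?_, ?_⟩, fun h => ?_⟩
    iterate 4 linarith
    have h2 := abs_le.1 ((abs_apply_sub_le_dist x _ 0).trans (mem_closedBall.1 h))
    simp at h2
    linarith
  have hball : ∀ x ∈ G, ∃ r > 0,
      Controlled G (fun f => ∫⁻ x in B, valSq f x) (volume.restrict (ball x r)) := by
    refine Controlled.ball_of_isPreconnected hGo hGc (hBG (mem_ball_self (by positivity)))
      (r₀ := δ / 8) (by positivity) ⟨1, fun f hf => ?_⟩
    rw [ENNReal.coe_one, one_mul]
    exact le_self_add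
  obtain ⟨C₁, h₁⟩ : Controlled G (fun f => ∫⁻ x in B, valSq f x) (volume.restrict
      {x | (δ ≤ x 0 ∧ x 0 ≤ 1 - δ) ∧ -(1 / 4) ≤ x 1 ∧ x 1 ≤ 1 / 4}) := by
    refine Controlled.of_isCompact_subset hball ?_ ?_
    · have h2 : IsCompact ((frame (LinearIsometryEquiv.refl ℝ E2)) ''
          (Icc δ (1 - δ) ×ˢ Icc (-(1 / 4)) (1 / 4))) :=
        (isCompact_Icc.prod isCompact_Icc).image (continuous_frame _)
      refine h2.of_isClosed_subset ?_ fun x hx => ⟨(x 0, x 1), hx, frame_coord _ x⟩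
      have h0 : Continuous fun x : E2 => x 0 := by fun_prop
      have h1 : Continuous fun x : E2 => x 1 := by fun_prop
      exact ((isClosed_le continuous_const h0).inter (isClosed_le h0 continuous_const)).inter
        ((isClosed_le continuous_const h1).inter (isClosed_le h1 continuous_const))
    · rintro x ⟨⟨h1, h2⟩, h3, h4⟩
      refine ⟨⟨⟨?_, ?_⟩, ?_, ?_⟩, fun h => ?_⟩
      iterate 4 linarith
      have h5 := abs_le.1 ((abs_apply_sub_le_dist x _ 0).trans (mem_closedBall.1 h))
      simp at h5
      linarith
  obtain ⟨C₂, h₂⟩ : Controlled G (fun f => ∫⁻ x in B, valSq f x)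
      (μH[1].restrict (sphere c (δ / 8))) := by
    refine Controlled.sphere (a := c) (α := δ / 8) (a₀ := 5 * δ / 32) (b₀ := 6 * δ / 32)
      (β := δ / 4) (by positivity) (by linarith) (by linarith) (by linarith)
      ⟨by linarith, by linarith⟩ ?_ ?_
    · exact fun x hx => ⟨ball_subset_unitRect hδ1 (mem_ball.2 hx.2), not_le.2 hx.1⟩
    · refine Controlled.of_subset (L' := closedBall c (6 * δ / 32) \ ball c (5 * δ / 32)) ?_
        fun x hx => ⟨hx.2.le, not_lt.2 hx.1.le⟩
      refine Controlled.of_isCompact_subset hball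
        ((isCompact_closedBall _ _).diff isOpen_ball) ?_
      rintro x ⟨h1, h2⟩
      rw [mem_closedBall] at h1
      rw [mem_ball, not_lt] at h2
      refine ⟨ball_subset_unitRect hδ1 (mem_ball.2 (by linarith)), ?_⟩
      rw [mem_closedBall, not_le]
      linarith
  obtain ⟨C₃, h₃⟩ := exists_lintegral_ball_sub_le (x := !₂[1 / 2, 0]) (r := δ / 8) (by positivity)
  refine ⟨max C₁ C₂ * (C₃ + 1), fun f hf => ?_⟩
  obtain ⟨m, hm⟩ := h₃ f hf
  have hfm : ContDiff ℝ 1 fun z => f z - m := hf.sub contDiff_const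
  have h4 : ∀ D : ℝ≥0, D ≤ max C₁ C₂ → (D : ℝ≥0∞) *
      ((∫⁻ x in B, valSq (fun z => f z - m) x) + dirEnergy G fun z => f z - m) ≤
      ((max C₁ C₂ * (C₃ + 1) : ℝ≥0) : ℝ≥0∞) * dirEnergy G f := by
    intro D hD
    rw [dirEnergy_sub_const]
    calc _ ≤ ((max C₁ C₂ : ℝ≥0) : ℝ≥0∞) * (C₃ * dirEnergy G f + dirEnergy G f) := by
          refine mul_le_mul' (by exact_mod_cast hD) (add_le_add (hm.trans ?_) le_rfl)
          exact mul_le_mul' le_rfl (dirEnergy_mono hBG f)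
      _ = _ := by
          push_cast
          ring
  exact ⟨m, (h₁ _ hfm).trans (h4 C₁ (le_max_left _ _)), (h₂ _ hfm).trans (h4 C₂ (le_max_right _ _))⟩

lemma lintegral_comp_similarity (e : E2 ≃ₗᵢ[ℝ] E2) (b : E2) {s : ℝ} (hs : 0 < s)
    {F : E2 → ℝ≥0∞} (hF : Measurable F) :
    ENNReal.ofReal (s ^ 2) * ∫⁻ z, F (b + s • e.symm z) = ∫⁻ x, F x := by
  have h1 : ∫⁻ z, F (b + s • e.symm z) = ∫⁻ z, F (b + s • z) :=
    (e.symm.measurePreserving).lintegral_comp (f := fun z => F (b + s • z)) (hF.comp (by fun_prop))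
  have h2 : ∫⁻ z, F (b + s • z) = ENNReal.ofReal ((s ^ 2)⁻¹) * ∫⁻ z, F (b + z) := by
    have h3 := Measure.map_addHaar_smul (volume : Measure E2) hs.ne'
    rw [finrank_euclideanSpace_fin, abs_of_pos (by positivity)] at h3
    rw [← smul_eq_mul, ← lintegral_smul_measure, ← h3,
      lintegral_map (f := fun z => F (b + z)) (hF.comp (by fun_prop)) (by fun_prop)]
  rw [h1, h2, lintegral_add_left_eq_self F, ← mul_assoc, ← ENNReal.ofReal_mul (by positivity),
    mul_inv_cancel₀ (by positivity), ENNReal.ofReal_one, one_mul]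

/-- The centre of the hole of the cell of size `s` at `frame e p`. -/
def holeCenter (δ : ℝ) (e : E2 ≃ₗᵢ[ℝ] E2) (s : ℝ) (p : ℝ × ℝ) : E2 :=
  frame e (p.1 + s * (1 - δ / 2), p.2)

/-- The cell of size `s` at `frame e p`, without its hole. -/
def cell (δ : ℝ) (e : E2 ≃ₗᵢ[ℝ] E2) (s : ℝ) (p : ℝ × ℝ) : Set E2 :=
  {x | (p.1 < e x 0 ∧ e x 0 < p.1 + s) ∧ p.2 - s / 2 < e x 1 ∧ e x 1 < p.2 + s / 2} \
    closedBall (holeCenter δ e s p) (s * (δ / 8))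

lemma measurableSet_cell (δ : ℝ) (e : E2 ≃ₗᵢ[ℝ] E2) (s : ℝ) (p : ℝ × ℝ) :
    MeasurableSet (cell δ e s p) := by
  have h0 := continuous_coord e 0
  have h1 := continuous_coord e 1
  exact ((((isOpen_lt continuous_const h0).inter (isOpen_lt h0 continuous_const)).inter
    ((isOpen_lt continuous_const h1).inter (isOpen_lt h1 continuous_const))).sdiff
    isClosed_closedBall).measurableSet

lemma exists_cell_le {δ : ℝ} (hδ : 0 < δ) (hδ1 : δ < 1 / 4) :
    ∃ C : ℝ≥0, ∀ (e : E2 ≃ₗᵢ[ℝ] E2) (s : ℝ) (p : ℝ × ℝ) (f : E2 → ℝ), 0 < s → ContDiff ℝ 1 f →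
      ∃ m : ℝ,
      ∫⁻ x in {x | (p.1 + s * δ ≤ e x 0 ∧ e x 0 ≤ p.1 + s * (1 - δ)) ∧
          p.2 - s / 4 ≤ e x 1 ∧ e x 1 ≤ p.2 + s / 4},
        valSq (fun z => f z - m) x ≤ ENNReal.ofReal (s ^ 2) * (C * dirEnergy (cell δ e s p) f) ∧
      ∫⁻ x in sphere (holeCenter δ e s p) (s * (δ / 8)), valSq (fun z => f z - m) x ∂μH[1] ≤
        ENNReal.ofReal s * (C * dirEnergy (cell δ e s p) f) := by
  obtain ⟨C, hC⟩ := exists_unitCell_le hδ hδ1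
  refine ⟨C, fun e s p f hs hf => ?_⟩
  set A : E2 → E2 := fun z => frame e p + s • e.symm z with hA
  have hAf : ∀ z, A z = frame e (p.1 + s * z 0, p.2 + s * z 1) := by
    intro z
    simp only [hA, frame]
    rw [← map_smul, ← map_add]
    congr 1
    ext i
    fin_cases i <;> simp
  have hA0 : ∀ z, e (A z) 0 = p.1 + s * z 0 := fun z => by rw [hAf, frame_apply_zero]
  have hA1 : ∀ z, e (A z) 1 = p.2 + s * z 1 := fun z => by rw [hAf, frame_apply_one]
  have hAc : A !₂[1 - δ / 2, 0] = holeCenter δ e s p := by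
    rw [hAf, holeCenter]
    simp
  have hAd : ∀ z w, dist (A z) (A w) = s * dist z w := by
    intro z w
    rw [hA, dist_add_left, dist_smul₀, e.symm.dist_map, Real.norm_of_nonneg hs.le]
  have hAcont : Continuous A := by fun_prop
  have hAsurj : ∀ x, ∃ z, A z = x := fun x => ⟨e (s⁻¹ • (x - frame e p)), by
    simp only [hA, LinearIsometryEquiv.symm_apply_apply]
    rw [smul_inv_smul₀ hs.ne']
    abel⟩
  have hAs : ContDiff ℝ 1 A :=
    contDiff_const.add (e.symm.contDiff.const_smul s)
  have hgrad : ∀ z, gradSq (fun z => f (A z)) z = ENNReal.ofReal (s ^ 2) * gradSq f (A z) := by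
    intro z
    have h1 : HasFDerivAt A (s • (e.symm.toContinuousLinearEquiv : E2 →L[ℝ] E2)) z :=
      ((e.symm.toContinuousLinearEquiv : E2 →L[ℝ] E2).hasFDerivAt.const_smul s).const_add _
    have h2 := ((hf.differentiable (by norm_num)) (A z)).hasFDerivAt.comp z h1
    have h3 : ‖fderiv ℝ (fun z => f (A z)) z‖ = s * ‖fderiv ℝ f (A z)‖ := by
      rw [show (fun z => f (A z)) = f ∘ A from rfl, h2.fderiv, ContinuousLinearMap.comp_smul,
        norm_smul, Real.norm_of_nonneg hs.le]
      congr 1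
      exact ContinuousLinearMap.opNorm_comp_linearIsometryEquiv _ e.symm
    have h4 : (‖fderiv ℝ (fun z => f (A z)) z‖₊ : ℝ≥0∞) =
        ENNReal.ofReal s * (‖fderiv ℝ f (A z)‖₊ : ℝ≥0∞) := by
      rw [← enorm_eq_nnnorm, ← enorm_eq_nnnorm, ← ofReal_norm, ← ofReal_norm, h3,
        ENNReal.ofReal_mul hs.le]
    rw [gradSq, gradSq, h4, mul_pow, ENNReal.ofReal_pow hs.le]
  have hintegral : ∀ (X : Set E2) (F : E2 → ℝ≥0∞), MeasurableSet X → Measurable F →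
      ENNReal.ofReal (s ^ 2) * ∫⁻ z in A ⁻¹' X, F (A z) = ∫⁻ x in X, F x := by
    intro X F hX hF
    rw [← lintegral_indicator hX, ← lintegral_comp_similarity e (frame e p) hs (hF.indicator hX),
      ← lintegral_indicator (hX.preimage hAcont.measurable)]
    rfl
  obtain ⟨m, hm1, hm2⟩ := hC (fun z => f (A z)) (hf.comp hAs)
  have hcell : A ⁻¹' cell δ e s p = unitCell δ := by
    ext z
    simp only [cell, unitCell, mem_preimage, Set.mem_sdiff, mem_closedBall, ← hAc, hAd]
    refine and_congr ?_ (not_congr (mul_le_mul_iff_right₀ hs))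
    show (_ < e (A z) 0 ∧ e (A z) 0 < _) ∧ _ < e (A z) 1 ∧ e (A z) 1 < _ ↔
      (0 < z 0 ∧ z 0 < 1) ∧ -(1 / 2) < z 1 ∧ z 1 < 1 / 2
    rw [hA0, hA1]
    constructor
    · rintro ⟨⟨h1, h2⟩, h3, h4⟩
      refine ⟨⟨?_, ?_⟩, ?_, ?_⟩ <;> nlinarith
    · rintro ⟨⟨h1, h2⟩, h3, h4⟩
      refine ⟨⟨?_, ?_⟩, ?_, ?_⟩ <;> nlinarith
  have hE : dirEnergy (unitCell δ) (fun z => f (A z)) = dirEnergy (cell δ e s p) f := by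
    rw [dirEnergy_eq, dirEnergy_eq,
      ← hintegral _ _ (measurableSet_cell δ e s p) (measurable_gradSq hf),
      hcell, ← lintegral_const_mul' _ _ ENNReal.ofReal_ne_top]
    exact lintegral_congr hgrad
  have hfm : ContDiff ℝ 1 fun z => f z - m := hf.sub contDiff_const
  rw [hE] at hm1 hm2
  refine ⟨m, ?_, ?_⟩
  · have h0 := continuous_coord e 0
    have h1 := continuous_coord e 1
    rw [← hintegral _ _ _ (measurable_valSq hfm)]
    · refine mul_le_mul' le_rfl (le_trans (lintegral_mono_set ?_) hm1)
      intro z hz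
      have hz' : (p.1 + s * δ ≤ e (A z) 0 ∧ e (A z) 0 ≤ p.1 + s * (1 - δ)) ∧
          p.2 - s / 4 ≤ e (A z) 1 ∧ e (A z) 1 ≤ p.2 + s / 4 := hz
      rw [hA0, hA1] at hz'
      obtain ⟨⟨h1, h2⟩, h3, h4⟩ := hz'
      refine ⟨⟨?_, ?_⟩, ?_, ?_⟩ <;> nlinarith
    · exact (((isClosed_le continuous_const h0).inter (isClosed_le h0 continuous_const)).inter
        ((isClosed_le continuous_const h1).inter (isClosed_le h1 continuous_const))).measurableSet
  · have hAL : LipschitzWith s.toNNReal A := LipschitzWith.of_dist_le_mul fun z w => by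
      rw [hAd, Real.coe_toNNReal _ hs.le]
    refine (lintegral_hausdorffMeasure_le hAL (S := sphere !₂[1 - δ / 2, 0] (δ / 8)) ?_
      (measurable_valSq hfm)).trans (mul_le_mul' le_rfl hm2)
    intro x hx
    obtain ⟨z, rfl⟩ := hAsurj x
    refine ⟨z, ?_, rfl⟩
    rw [mem_sphere, ← hAc, hAd] at hx
    exact mul_left_cancel₀ hs.ne' hx

/-! ### A column of holes -/

lemma measure_mul_sq_le {f : E2 → ℝ} (hf : ContDiff ℝ 1 f) (e : E2 ≃ₗᵢ[ℝ] E2) {φ : ℝ → ℝ}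
    (hφ : Continuous φ) {m : Measure ℝ} [IsFiniteMeasure m] {C₀ : ℝ≥0} (hm : m ≤ C₀ • volume)
    {Z X : Set E2} (hZ : MeasurableSet Z) (hX : MeasurableSet X) {A : Set ℝ} (hA : MeasurableSet A)
    {ε : ℝ} (hε : 0 < ε) {s y d : ℝ} (hs : 0 < s)
    (hy : ∀ t ∈ A, y + s / 4 ≤ φ t) (hd : ∀ t ∈ A, φ t - (y - s / 4) ≤ d)
    (hpath : ∀ t ∈ A, ∀ h ∈ Ioo (y - s / 4) (φ t), frame e (t, h) ∈ Z)
    (hAX : ∀ t ∈ A, ∀ h ∈ Icc (y - s / 4) (y + s / 4), frame e (t, h) ∈ X) (M : ℝ) :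
    m A * ENNReal.ofReal (M ^ 2) ≤
      ENNReal.ofReal (1 + ε) ^ 2 * ∫⁻ t in A, valSq f (frame e (t, φ t)) ∂m +
      ENNReal.ofReal (1 + ε) * ENNReal.ofReal (1 + 1 / ε) *
        (ENNReal.ofReal d * (C₀ * dirEnergy Z f)) +
      ENNReal.ofReal (1 + 1 / ε) * (ENNReal.ofReal (2 / s) *
        (C₀ * ∫⁻ x in X, valSq (fun z => f z - M) x)) := by
  set q := ENNReal.ofReal (1 + ε) with hq
  set q' := ENNReal.ofReal (1 + 1 / ε) with hq'
  have hfc := hf.continuous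
  have hfr := continuous_frame e
  have hfm : ContDiff ℝ 1 fun z => f z - M := hf.sub contDiff_const
  set J := Icc (y - s / 4) (y + s / 4) with hJ
  have hJv : volume J = ENNReal.ofReal (s / 2) := by
    rw [hJ, Real.volume_Icc]
    congr 1
    ring
  have hmeas : Measurable fun p : ℝ × ℝ => valSq (fun z => f z - M) (frame e (p.2, p.1)) :=
    (measurable_valSq hfm).comp (by fun_prop)
  obtain ⟨h, hhJ, hh⟩ := exists_le_setLAverage (μ := volume) (s := J)
    (f := fun h => ∫⁻ t in A, valSq (fun z => f z - M) (frame e (t, h)) ∂m)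
    (by rw [hJv]; simpa using hs) (by rw [hJv]; simp)
    (Measurable.lintegral_prod_right' hmeas).aemeasurable
  have h1 : ∫⁻ t in A, valSq (fun z => f z - M) (frame e (t, h)) ∂m ≤
      ENNReal.ofReal (2 / s) * (C₀ * ∫⁻ x in X, valSq (fun z => f z - M) x) := by
    refine hh.trans ?_
    rw [setLAverage_eq, hJv, ENNReal.div_eq_inv_mul, ← ENNReal.ofReal_inv_of_pos (by positivity),
      inv_div]
    refine mul_le_mul' le_rfl ?_
    rw [lintegral_lintegral_swap hmeas.aemeasurable]
    exact lintegral_lintegral_frame_le e hm hX (measurable_valSq hfm) hA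
      (fun _ => measurableSet_Icc) hAX
  have h2 : ∫⁻ t in A, ENNReal.ofReal ((f (frame e (t, φ t)) - f (frame e (t, h))) ^ 2) ∂m ≤
      ENNReal.ofReal d * (C₀ * dirEnergy Z f) := by
    refine lintegral_sq_sub_vertical_le hf e hm hZ hA (fun t ht => hhJ.2.trans (hy t ht)) ?_ ?_
    · intro t ht
      have := hd t ht
      have := hhJ.1
      linarith
    · exact fun t ht y' hy' => hpath t ht y' ⟨hhJ.1.trans_lt hy'.1, hy'.2⟩
  calc m A * ENNReal.ofReal (M ^ 2) = ∫⁻ t in A, ENNReal.ofReal (M ^ 2) ∂m := by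
        rw [setLIntegral_const, mul_comm]
    _ ≤ ∫⁻ t in A, (q ^ 2 * valSq f (frame e (t, φ t)) +
          q * q' * ENNReal.ofReal ((f (frame e (t, φ t)) - f (frame e (t, h))) ^ 2) +
          q' * valSq (fun z => f z - M) (frame e (t, h))) ∂m := by
        refine lintegral_mono fun t => ?_
        have h3 := ofReal_sq_le_add hε M (f (frame e (t, h)))
        have h4 := ofReal_sq_le_add hε (f (frame e (t, h))) (f (frame e (t, φ t)))
        rw [← neg_sq (M - _), neg_sub] at h3
        rw [← neg_sq (_ - f (frame e (t, φ t))), neg_sub] at h4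
        refine h3.trans ?_
        rw [sq q, mul_assoc q q, mul_assoc q q', ← mul_add]
        exact add_le_add (mul_le_mul' le_rfl h4) le_rfl
    _ = q ^ 2 * ∫⁻ t in A, valSq f (frame e (t, φ t)) ∂m +
          q * q' * ∫⁻ t in A, ENNReal.ofReal
            ((f (frame e (t, φ t)) - f (frame e (t, h))) ^ 2) ∂m +
          q' * ∫⁻ t in A, valSq (fun z => f z - M) (frame e (t, h)) ∂m := by
        have m1 : Measurable fun t => valSq f (frame e (t, φ t)) :=
          (measurable_valSq hf).comp (by fun_prop)
        have m2 : Measurable fun t =>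
            ENNReal.ofReal ((f (frame e (t, φ t)) - f (frame e (t, h))) ^ 2) := by fun_prop
        have m3 : Measurable fun t => valSq (fun z => f z - M) (frame e (t, h)) :=
          (measurable_valSq hfm).comp (by fun_prop)
        rw [lintegral_add_right _ (m3.const_mul _), lintegral_add_right _ (m2.const_mul _),
          lintegral_const_mul _ m1, lintegral_const_mul _ m2, lintegral_const_mul _ m3]
    _ ≤ _ := by gcongr

lemma hausdorffMeasure_sphere_eq (a b : E2) (r : ℝ) : μH[1] (sphere a r) = μH[1] (sphere b r) := by
  have h : (IsometryEquiv.addRight (b - a)) '' sphere a r = sphere b r := by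
    rw [IsometryEquiv.image_sphere]
    simp
  rw [← h, (IsometryEquiv.addRight (b - a)).hausdorffMeasure_image]

lemma sum_dirEnergy_le {ι : Type*} (I : Finset ι) {Y : ι → Set E2} {Z : Set E2}
    (hY : ∀ i ∈ I, MeasurableSet (Y i)) (hd : (I : Set ι).PairwiseDisjoint Y)
    (hZ : ∀ i ∈ I, Y i ⊆ Z) (f : E2 → ℝ) : ∑ i ∈ I, dirEnergy (Y i) f ≤ dirEnergy Z f := by
  simp only [dirEnergy_eq]
  rw [← lintegral_biUnion_finset hd hY]
  exact lintegral_mono_set (iUnion₂_subset hZ)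

lemma sum_mul_le_of_mul_le {N : ℕ} {Λ μ c X : ℝ≥0∞} {M Y : ℕ → ℝ≥0∞} (hμ : μ ≠ ∞)
    (hN : N * Λ ≤ c * μ) (h : ∀ l < N, μ * M l ≤ X + Y l) :
    ∑ l ∈ Finset.range N, Λ * M l ≤ c * (X + ∑ l ∈ Finset.range N, Y l) := by
  rcases Nat.eq_zero_or_pos N with rfl | hN0
  · simp
  have hN1 : Λ ≤ c * μ := by
    refine le_trans ?_ hN
    refine le_mul_of_one_le_left' ?_
    exact_mod_cast hN0
  rcases eq_or_ne μ 0 with rfl | hμ0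
  · rw [mul_zero, nonpos_iff_eq_zero] at hN1
    simp [hN1]
  have hM : ∀ l < N, M l ≤ μ⁻¹ * (X + Y l) := fun l hl => by
    rw [← ENNReal.div_eq_inv_mul, ENNReal.le_div_iff_mul_le (Or.inl hμ0) (Or.inl hμ), mul_comm]
    exact h l hl
  have h1 : ∀ x : ℝ≥0∞, c * μ * (μ⁻¹ * x) = c * x := fun x => by
    rw [mul_assoc, ← mul_assoc μ, ENNReal.mul_inv_cancel hμ0 hμ, one_mul]
  calc ∑ l ∈ Finset.range N, Λ * M l
      ≤ ∑ l ∈ Finset.range N, (Λ * (μ⁻¹ * X) + c * Y l) := by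
        refine Finset.sum_le_sum fun l hl => ?_
        refine (mul_le_mul' le_rfl (hM l (Finset.mem_range.1 hl))).trans ?_
        rw [mul_add, mul_add, ← h1 (Y l)]
        exact add_le_add le_rfl (mul_le_mul' hN1 le_rfl)
    _ = N * Λ * (μ⁻¹ * X) + c * ∑ l ∈ Finset.range N, Y l := by
        rw [Finset.sum_add_distrib, Finset.sum_const, Finset.card_range, nsmul_eq_mul, mul_assoc,
          Finset.mul_sum]
    _ ≤ c * μ * (μ⁻¹ * X) + c * ∑ l ∈ Finset.range N, Y l := by gcongr
    _ = _ := by rw [h1, mul_add]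

set_option maxHeartbeats 1000000 in
lemma exists_column_le {δ : ℝ} (hδ : 0 < δ) (hδ1 : δ < 1 / 4) (C₀ : ℝ≥0) {ε : ℝ} (hε : 0 < ε) :
    ∃ A : ℝ≥0, ∀ (e : E2 ≃ₗᵢ[ℝ] E2) (φ : ℝ → ℝ) (m : Measure ℝ) (B : Set ℝ) (Z : Set E2)
      (s w c t₀ y₀ : ℝ) (N : ℕ), Continuous φ → IsFiniteMeasure m → m ≤ C₀ • volume →
      MeasurableSet B → MeasurableSet Z → 0 < s → 0 ≤ w → 1 ≤ c →
      B ⊆ Icc (t₀ + s * δ) (t₀ + s * (1 - δ)) →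
      (∀ t ∈ B, y₀ + s / 4 ≤ φ t) → (∀ t ∈ B, φ t - y₀ + N * s ≤ 3 * w) →
      (∀ t ∈ B, ∀ y ∈ Ioo (y₀ - N * s) (φ t), frame e (t, y) ∈ Z) →
      (∀ l < N, cell δ e s (t₀, y₀ - l * s) ⊆ Z) →
      N * μH[1] (sphere (0 : E2) (s * (δ / 8))) ≤ ENNReal.ofReal c * m B →
      ∀ f : E2 → ℝ, ContDiff ℝ 1 f →
        ∑ l ∈ Finset.range N, ∫⁻ x in sphere (holeCenter δ e s (t₀, y₀ - l * s)) (s * (δ / 8)),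
          valSq f x ∂μH[1] ≤
        ENNReal.ofReal c * (ENNReal.ofReal (1 + ε) ^ 3 *
          ∫⁻ t in B, valSq f (frame e (t, φ t)) ∂m +
            A * (ENNReal.ofReal (s + w) * dirEnergy Z f)) := by
  obtain ⟨C, hC⟩ := exists_cell_le hδ hδ1
  set q : ℝ≥0 := (1 + ε).toNNReal with hq
  set q' : ℝ≥0 := (1 + 1 / ε).toNNReal with hq'
  have hqe : ENNReal.ofReal (1 + ε) = q := rfl
  have hqe' : ENNReal.ofReal (1 + 1 / ε) = q' := rfl
  refine ⟨3 * q ^ 2 * q' * C₀ + 2 * q * q' * C₀ * C + q' * C, ?_⟩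
  intro e φ m B Z s w c t₀ y₀ N hφ hmf hm hB hZ hs hw hc hBI hlow hhigh hpath hcell hN f hf
  set Λ := μH[1] (sphere (0 : E2) (s * (δ / 8))) with hΛ
  set E := dirEnergy Z f with hE
  set F := ∫⁻ t in B, valSq f (frame e (t, φ t)) ∂m with hF
  have hex := fun l : ℕ => hC e s (t₀, y₀ - l * s) f hs hf
  choose M hM1 hM2 using hex
  set El : ℕ → ℝ≥0∞ := fun l => dirEnergy (cell δ e s (t₀, y₀ - l * s)) f with hEl
  have hsum : ∑ l ∈ Finset.range N, El l ≤ E := by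
    refine sum_dirEnergy_le _ (fun l _ => measurableSet_cell _ _ _ _) ?_
      (fun l hl => hcell l (Finset.mem_range.1 hl)) f
    intro l _ l' _ hll
    refine Set.disjoint_left.2 ?_
    rintro x ⟨⟨-, h1, h2⟩, -⟩ ⟨⟨-, h3, h4⟩, -⟩
    simp only at h1 h2 h3 h4
    rcases lt_or_gt_of_ne hll with h | h
    · have h5 : (l : ℝ) + 1 ≤ l' := by exact_mod_cast h
      nlinarith
    · have h5 : (l' : ℝ) + 1 ≤ l := by exact_mod_cast h
      nlinarith
  have hkey : ∀ l < N, m B * ENNReal.ofReal (M l ^ 2) ≤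
      (q ^ 2 * F + q * q' * (ENNReal.ofReal (3 * w) * (C₀ * E))) +
      q' * (C₀ * (C * (2 * ENNReal.ofReal s * El l))) := by
    intro l hl
    have hl1 : (l : ℝ) + 1 ≤ N := by exact_mod_cast hl
    have hl0 : (0 : ℝ) ≤ l := by positivity
    set X : Set E2 := {x | (t₀ + s * δ ≤ e x 0 ∧ e x 0 ≤ t₀ + s * (1 - δ)) ∧
      y₀ - l * s - s / 4 ≤ e x 1 ∧ e x 1 ≤ y₀ - l * s + s / 4} with hX
    have hXm : MeasurableSet X := by
      have h0 := continuous_coord e 0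
      have h1 := continuous_coord e 1
      exact (((isClosed_le continuous_const h0).inter (isClosed_le h0 continuous_const)).inter
        ((isClosed_le continuous_const h1).inter (isClosed_le h1 continuous_const))).measurableSet
    have h1 := measure_mul_sq_le hf e hφ hm hZ hXm hB hε (y := y₀ - l * s) (d := 3 * w) hs
      (fun t ht => by nlinarith [hlow t ht]) (fun t ht => by nlinarith [hhigh t ht])
      (fun t ht h hh => hpath t ht h ⟨by nlinarith [hh.1], hh.2⟩)
      (fun t ht h hh => by
        show (_ ≤ e (frame e (t, h)) 0 ∧ e (frame e (t, h)) 0 ≤ _) ∧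
          _ ≤ e (frame e (t, h)) 1 ∧ e (frame e (t, h)) 1 ≤ _
        rw [frame_apply_zero, frame_apply_one]
        exact ⟨hBI ht, hh⟩) (M l)
    refine h1.trans ?_
    rw [hqe, hqe']
    refine add_le_add le_rfl (mul_le_mul' le_rfl ?_)
    calc _ ≤ ENNReal.ofReal (2 / s) * (C₀ * (ENNReal.ofReal (s ^ 2) * (C * El l))) :=
          mul_le_mul' le_rfl (mul_le_mul' le_rfl (hM1 l))
      _ = C₀ * (C * (ENNReal.ofReal (2 / s) * ENNReal.ofReal (s ^ 2) * El l)) := by ring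
      _ = _ := by
          rw [← ENNReal.ofReal_mul (by positivity),
            show 2 / s * s ^ 2 = 2 * s by field_simp, ENNReal.ofReal_mul zero_le_two]
          norm_num
  have hsumM := sum_mul_le_of_mul_le (measure_ne_top m B) hN hkey
  have hsphere : ∀ l : ℕ, ∫⁻ x in sphere (holeCenter δ e s (t₀, y₀ - l * s)) (s * (δ / 8)),
      valSq f x ∂μH[1] ≤ q * (Λ * ENNReal.ofReal (M l ^ 2)) +
        q' * (ENNReal.ofReal s * (C * El l)) := by
    intro l
    have hfm : ContDiff ℝ 1 fun z => f z - M l := hf.sub contDiff_const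
    calc _ ≤ ∫⁻ x in sphere (holeCenter δ e s (t₀, y₀ - l * s)) (s * (δ / 8)),
          (q * ENNReal.ofReal (M l ^ 2) + q' * valSq (fun z => f z - M l) x) ∂μH[1] :=
          lintegral_mono fun x => ofReal_sq_le_add hε (f x) (M l)
      _ = q * ENNReal.ofReal (M l ^ 2) * Λ +
          q' * ∫⁻ x in sphere (holeCenter δ e s (t₀, y₀ - l * s)) (s * (δ / 8)),
            valSq (fun z => f z - M l) x ∂μH[1] := by
          rw [lintegral_add_left measurable_const, setLIntegral_const,
            hausdorffMeasure_sphere_eq _ 0, lintegral_const_mul _ (measurable_valSq hfm)]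
      _ ≤ q * ENNReal.ofReal (M l ^ 2) * Λ + q' * (ENNReal.ofReal s * (C * El l)) :=
          add_le_add le_rfl (mul_le_mul' le_rfl (hM2 l))
      _ = _ := by ring
  calc _ ≤ ∑ l ∈ Finset.range N, (q * (Λ * ENNReal.ofReal (M l ^ 2)) +
        q' * (ENNReal.ofReal s * (C * El l))) := Finset.sum_le_sum fun l _ => hsphere l
    _ = q * ∑ l ∈ Finset.range N, Λ * ENNReal.ofReal (M l ^ 2) +
        q' * (ENNReal.ofReal s * (C * ∑ l ∈ Finset.range N, El l)) := by
        rw [Finset.sum_add_distrib]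
        simp only [Finset.mul_sum]
    _ ≤ q * (ENNReal.ofReal c * ((q ^ 2 * F + q * q' * (ENNReal.ofReal (3 * w) * (C₀ * E))) +
          q' * (C₀ * (C * (2 * ENNReal.ofReal s * E))))) +
        ENNReal.ofReal c * (q' * (ENNReal.ofReal s * (C * E))) := by
        refine add_le_add (mul_le_mul' le_rfl (hsumM.trans ?_)) ?_
        · refine mul_le_mul' le_rfl (add_le_add le_rfl ?_)
          simp only [← Finset.mul_sum]
          gcongr
        · refine le_trans ?_ (le_mul_of_one_le_left' (by rwa [ENNReal.one_le_ofReal]))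
          gcongr
    _ = ENNReal.ofReal c * (q ^ 3 * F + (3 * q ^ 2 * q' * C₀ * (ENNReal.ofReal w * E) +
          (2 * q * q' * C₀ * C + q' * C) * (ENNReal.ofReal s * E))) := by
        rw [ENNReal.ofReal_mul (by norm_num : (0 : ℝ) ≤ 3)]
        norm_num
        ring
    _ ≤ _ := by
        rw [hqe, ENNReal.ofReal_add hs.le hw]
        push_cast
        refine mul_le_mul' le_rfl (add_le_add le_rfl ?_)
        calc _ ≤ 3 * q ^ 2 * q' * C₀ * ((ENNReal.ofReal s + ENNReal.ofReal w) * E) +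
              (2 * q * q' * C₀ * C + q' * C) * ((ENNReal.ofReal s + ENNReal.ofReal w) * E) := by
              gcongr
              · exact le_add_self
              · exact le_self_add
          _ = _ := by ring

/-! ### Holes below a piece of a graph -/

lemma exists_hausdorffMeasure_sphere :
    ∃ l : ℝ≥0, 0 < l ∧ ∀ r : ℝ, 0 < r → μH[1] (sphere (0 : E2) r) = ENNReal.ofReal r * l := by
  have hfin := (hausdorffMeasure_sphere_lt_top (0 : E2) zero_le_one).ne
  refine ⟨(μH[1] (sphere (0 : E2) 1)).toNNReal, ?_, ?_⟩
  · refine ENNReal.toNNReal_pos ?_ hfin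
    intro h0
    have hL : LipschitzWith 1 fun x : E2 => x 0 := by
      refine LipschitzWith.of_dist_le_mul fun x y => ?_
      rw [NNReal.coe_one, one_mul, Real.dist_eq]
      exact abs_coord_sub_le (LinearIsometryEquiv.refl ℝ E2) x y 0
    have h1 := hL.hausdorffMeasure_image_le (d := 1) zero_le_one (sphere (0 : E2) 1)
    rw [h0, mul_zero, nonpos_iff_eq_zero, hausdorffMeasure_real] at h1
    have h2 : Icc (-1 : ℝ) 1 ⊆ (fun x : E2 => x 0) '' sphere (0 : E2) 1 := by
      intro t ht
      have ht2 : 0 ≤ 1 - t ^ 2 := by nlinarith [ht.1, ht.2]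
      refine ⟨!₂[t, √(1 - t ^ 2)], ?_, by simp⟩
      rw [mem_sphere_zero_iff_norm, EuclideanSpace.norm_eq]
      simp [Real.sq_sqrt ht2]
    have h3 := measure_mono_null h2 h1
    rw [Real.volume_Icc] at h3
    norm_num at h3
  · intro r hr
    have h := Measure.hausdorffMeasure_smul₀ (𝕜 := ℝ) (d := 1) zero_le_one hr.ne'
      (sphere (0 : E2) 1)
    rw [smul_sphere' hr.ne', smul_zero, mul_one, Real.norm_of_nonneg hr.le] at h
    rw [h, NNReal.rpow_one, ENNReal.smul_def, smul_eq_mul, ENNReal.coe_toNNReal hfin,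
      Real.nnnorm_of_nonneg hr.le, ENNReal.ofReal, Real.toNNReal_of_nonneg hr.le]

lemma measure_univ_le_sum_column {m : Measure ℝ} {C₀ : ℝ≥0} (hm : m ≤ C₀ • volume) {T : Set ℝ}
    {R s δ : ℝ} (hT : T ⊆ Icc (-R) R) (hmT : m Tᶜ = 0) (hs : 0 < s) (hs1 : s ≤ 1) (hδ : 0 < δ)
    (hR : 0 ≤ R) :
    m univ ≤ ∑ i ∈ Finset.Ico (-(⌊R / s⌋ + 1)) (⌊R / s⌋ + 1),
      m (T ∩ Icc (i * s + s * δ) (i * s + s * (1 - δ))) +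
      C₀ * ENNReal.ofReal (4 * δ * (R + 1)) := by
  set M := ⌊R / s⌋ + 1 with hM
  have hM1 : R < M * s := by
    rw [hM, ← div_lt_iff₀ hs]
    push_cast
    exact Int.lt_floor_add_one _
  have hM2 : M * s ≤ R + 1 := by
    have : (⌊R / s⌋ : ℝ) * s ≤ R := by
      rw [← le_div_iff₀ hs]
      exact Int.floor_le _
    rw [hM]
    push_cast
    linarith
  have hM0 : 0 ≤ M := by
    have : 0 ≤ ⌊R / s⌋ := Int.floor_nonneg.2 (by positivity)
    omega
  set P : ℤ → Set ℝ := fun i => Icc (i * s) (i * s + s * δ) ∪ Icc (i * s + s * (1 - δ)) (i * s + s)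
    with hP
  have hcov : (univ : Set ℝ) ⊆ Tᶜ ∪ ((⋃ i ∈ Finset.Ico (-M) M,
      T ∩ Icc (i * s + s * δ) (i * s + s * (1 - δ))) ∪ ⋃ i ∈ Finset.Ico (-M) M, P i) := by
    intro t _
    by_cases ht : t ∈ T
    · right
      have h1 : (⌊t / s⌋ : ℝ) * s ≤ t := by
        rw [← le_div_iff₀ hs]
        exact Int.floor_le _
      have h2 : t < ⌊t / s⌋ * s + s := by
        have := Int.lt_floor_add_one (t / s)
        rw [div_lt_iff₀ hs] at this
        linarith
      have hi : ⌊t / s⌋ ∈ Finset.Ico (-M) M := by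
        rw [Finset.mem_Ico, Int.le_floor, Int.floor_lt, le_div_iff₀ hs, div_lt_iff₀ hs]
        push_cast
        constructor <;> linarith [(hT ht).1, (hT ht).2]
      by_cases ht2 : t ∈ P ⌊t / s⌋
      · exact Or.inr (mem_iUnion₂.2 ⟨_, hi, ht2⟩)
      · refine Or.inl (mem_iUnion₂.2 ⟨_, hi, ht, ?_⟩)
        simp only [hP, mem_union, mem_Icc, not_or, not_and_or, not_le] at ht2
        constructor
        · rcases ht2.1 with h | h <;> linarith
        · rcases ht2.2 with h | h <;> linarith
    · exact Or.inl ht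
  have hPm : ∀ i : ℤ, m (P i) ≤ C₀ * ENNReal.ofReal (2 * s * δ) := fun i => by
    refine (hm (P i)).trans ?_
    rw [Measure.smul_apply, ENNReal.smul_def, smul_eq_mul]
    refine mul_le_mul' le_rfl ((measure_union_le _ _).trans ?_)
    rw [Real.volume_Icc, Real.volume_Icc, ← ENNReal.ofReal_add (by ring_nf; positivity)
      (by ring_nf; positivity)]
    exact ENNReal.ofReal_le_ofReal (by linarith)
  calc m univ ≤ m Tᶜ + (m (⋃ i ∈ Finset.Ico (-M) M,
        T ∩ Icc (i * s + s * δ) (i * s + s * (1 - δ))) + m (⋃ i ∈ Finset.Ico (-M) M, P i)) :=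
        (measure_mono hcov).trans ((measure_union_le _ _).trans
          (add_le_add le_rfl (measure_union_le _ _)))
    _ ≤ 0 + (∑ i ∈ Finset.Ico (-M) M, m (T ∩ Icc (i * s + s * δ) (i * s + s * (1 - δ))) +
        ∑ i ∈ Finset.Ico (-M) M, C₀ * ENNReal.ofReal (2 * s * δ)) := by
        refine add_le_add hmT.le (add_le_add (measure_biUnion_finset_le _ _) ?_)
        exact (measure_biUnion_finset_le _ _).trans (Finset.sum_le_sum fun i _ => hPm i)
    _ ≤ _ := by
        rw [zero_add]
        refine add_le_add le_rfl ?_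
        rw [Finset.sum_const, nsmul_eq_mul, Int.card_Ico, mul_left_comm]
        refine mul_le_mul' le_rfl ?_
        rw [← ENNReal.ofReal_natCast, ← ENNReal.ofReal_mul (by positivity)]
        refine ENNReal.ofReal_le_ofReal ?_
        have h1 : (((M - -M).toNat : ℕ) : ℝ) = 2 * M := by
          have : (((M - -M).toNat : ℕ) : ℤ) = 2 * M := by omega
          exact_mod_cast this
        rw [h1]
        nlinarith

/-- The region just below the part of the graph of `φ` lying over `T`. -/
def lowerStrip (e : E2 ≃ₗᵢ[ℝ] E2) (φ : ℝ → ℝ) (T : Set ℝ) (w : ℝ) : Set E2 :=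
  {x | (φ (e x 0) - 4 * w < e x 1 ∧ e x 1 < φ (e x 0)) ∧
    ∃ t ∈ T, dist x (frame e (t, φ t)) < 6 * w}

/-- The square of side `s` at `frame e p`. -/
def rect (e : E2 ≃ₗᵢ[ℝ] E2) (s : ℝ) (p : ℝ × ℝ) : Set E2 :=
  {x | (p.1 < e x 0 ∧ e x 0 < p.1 + s) ∧ p.2 - s / 2 < e x 1 ∧ e x 1 < p.2 + s / 2}

lemma rect_subset_lowerStrip (e : E2 ≃ₗᵢ[ℝ] E2) {φ : ℝ → ℝ} {K : ℝ≥0} (hφ : LipschitzWith K φ)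
    {s w a d t : ℝ} {T : Set ℝ} (hs : 0 < s) (hsw : s * (1 + K) ≤ w) (htT : t ∈ T)
    (ht : t ∈ Icc a (a + s)) (hd0 : 0 ≤ d) (hd : d + s ≤ w) :
    rect e s (a, φ a - w - d) ⊆ lowerStrip e φ T w := by
  rintro x ⟨⟨h1, h2⟩, h3, h4⟩
  simp only at h1 h2 h3 h4
  have hK : ∀ y ∈ Icc a (a + s), |φ y - φ a| ≤ K * s := fun y hy => by
    have h := hφ.dist_le_mul y a
    rw [Real.dist_eq, Real.dist_eq] at h
    refine h.trans (mul_le_mul_of_nonneg_left ?_ K.2)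
    rw [abs_le]
    constructor <;> linarith [hy.1, hy.2]
  have hx := abs_le.1 (hK (e x 0) ⟨h1.le, h2.le⟩)
  have ht' := abs_le.1 (hK t ht)
  refine ⟨⟨by linarith, by linarith⟩, t, htT, ?_⟩
  have h5 := dist_frame_le e (e x 0, e x 1) (t, φ t)
  rw [frame_coord] at h5
  have h6 : |e x 0 - t| ≤ s := by
    rw [abs_le]
    constructor <;> linarith [ht.1, ht.2]
  have h7 : |e x 1 - φ t| ≤ 3 * w := by
    rw [abs_le]
    constructor <;> linarith
  have hKs : 0 ≤ s * (K : ℝ) := by positivity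
  simp only at h5
  linarith

lemma closedBall_subset_rect (e : E2 ≃ₗᵢ[ℝ] E2) {s δ : ℝ} (hs : 0 < s) (hδ : 0 < δ)
    (hδ1 : δ < 1 / 4) (p : ℝ × ℝ) :
    closedBall (holeCenter δ e s p) (2 * (s * (δ / 8))) ⊆ rect e s p := by
  intro x hx
  have h0 := abs_le.1 ((abs_coord_sub_le e x (holeCenter δ e s p) 0).trans hx)
  have h1 := abs_le.1 ((abs_coord_sub_le e x (holeCenter δ e s p) 1).trans hx)
  rw [holeCenter, frame_apply_zero] at h0
  rw [holeCenter, frame_apply_one] at h1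
  have hsδ : 0 < s * δ := by positivity
  have hsδ1 : s * δ < s * (1 / 4) := by gcongr
  simp only at h0 h1
  exact ⟨⟨by linarith, by linarith⟩, by linarith, by linarith⟩

lemma le_dist_holeCenter (e : E2 ≃ₗᵢ[ℝ] E2) {s δ : ℝ} (hs : 0 < s) (y : ℤ → ℝ) {i i' : ℤ}
    {l l' : ℕ} (h : i ≠ i' ∨ l ≠ l') :
    s ≤ dist (holeCenter δ e s (i * s, y i - l * s))
      (holeCenter δ e s (i' * s, y i' - l' * s)) := by
  have h0 := abs_coord_sub_le e (holeCenter δ e s (i * s, y i - l * s))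
    (holeCenter δ e s (i' * s, y i' - l' * s)) 0
  have h1 := abs_coord_sub_le e (holeCenter δ e s (i * s, y i - l * s))
    (holeCenter δ e s (i' * s, y i' - l' * s)) 1
  simp only [holeCenter, frame_apply_zero, frame_apply_one] at h0 h1 ⊢
  by_cases hi : i = i'
  · subst hi
    refine le_trans ?_ h1
    have h2 : (1 : ℝ) ≤ |(l' : ℝ) - l| := by
      have h3 : (l' : ℤ) - l ≠ 0 := by
        have := h.resolve_left (by simp)
        omega
      exact_mod_cast Int.one_le_abs h3
    rw [show y i - l * s - (y i - l' * s) = (l' - l) * s by ring, abs_mul, abs_of_pos hs]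
    nlinarith
  · refine le_trans ?_ h0
    have h2 : (1 : ℝ) ≤ |(i : ℝ) - i'| := by exact_mod_cast Int.one_le_abs (sub_ne_zero.2 hi)
    rw [show i * s + s * (1 - δ / 2) - (i' * s + s * (1 - δ / 2)) = (i - i') * s by ring, abs_mul,
      abs_of_pos hs]
    nlinarith

lemma eq_of_mem_column {s u : ℝ} {i i' : ℤ} (hs : 0 < s) (h : i * s < u ∧ u < i * s + s)
    (h' : i' * s < u ∧ u < i' * s + s) : i = i' := by
  by_contra hne
  rcases lt_or_gt_of_ne hne with h1 | h1
  · have h2 : (i : ℝ) + 1 ≤ i' := by exact_mod_cast h1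
    nlinarith
  · have h2 : (i' : ℝ) + 1 ≤ i := by exact_mod_cast h1
    nlinarith

lemma disjoint_cell_closedBall (e : E2 ≃ₗᵢ[ℝ] E2) {s δ : ℝ} (hs : 0 < s) (hδ : 0 < δ)
    (hδ1 : δ < 1 / 4) (y : ℤ → ℝ) (i i' : ℤ) (l l' : ℕ) :
    Disjoint (cell δ e s (i * s, y i - l * s))
      (closedBall (holeCenter δ e s (i' * s, y i' - l' * s)) (s * (δ / 8))) := by
  refine Set.disjoint_left.2 fun x hx hx' => ?_
  have h' := closedBall_subset_rect e hs hδ hδ1 _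
    (closedBall_subset_closedBall (by have : 0 < s * (δ / 8) := by positivity
                                      linarith) hx')
  obtain ⟨⟨h1, h2, h3⟩, h4⟩ := hx
  obtain ⟨h1', h2', h3'⟩ := h'
  obtain rfl := eq_of_mem_column hs h1 h1'
  simp only at h2 h3 h2' h3'
  rcases lt_trichotomy l l' with h | rfl | h
  · have h5 : (l : ℝ) + 1 ≤ l' := by exact_mod_cast h
    nlinarith
  · exact h4 hx'
  · have h5 : (l' : ℝ) + 1 ≤ l := by exact_mod_cast h
    nlinarith

set_option maxHeartbeats 1000000 in
lemma exists_holes (C₀ K : ℝ≥0) {R : ℝ} (hR : 0 ≤ R) :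
    ∃ D : ℝ≥0, ∀ δ : ℝ, 0 < δ → δ < 1 / 4 → ∀ ε : ℝ, 0 < ε → ∃ A : ℝ≥0, ∃ κ : ℝ, 0 < κ ∧
      ∀ (e : E2 ≃ₗᵢ[ℝ] E2) (φ : ℝ → ℝ) (m : Measure ℝ) (T : Set ℝ) (s w c : ℝ),
        LipschitzWith K φ → m ≤ C₀ • volume → IsFiniteMeasure m → MeasurableSet T →
        T ⊆ Icc (-R) R → m Tᶜ = 0 → 0 < s → s ≤ 1 → s * (1 + K) ≤ w → 1 ≤ c → c * s ≤ κ * w →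
        ∃ (H : Finset E2) (Z : Set E2), MeasurableSet Z ∧ Z ⊆ lowerStrip e φ T w ∧
          (∀ a ∈ H, closedBall a (2 * (s * (δ / 8))) ⊆ lowerStrip e φ T w) ∧
          (∀ a ∈ H, Disjoint Z (closedBall a (s * (δ / 8)))) ∧
          (∀ a ∈ H, ∀ b ∈ H, a ≠ b → 3 * (s * (δ / 8)) ≤ dist a b) ∧
          ENNReal.ofReal c * m univ ≤ ∑ a ∈ H, μH[1] (sphere a (s * (δ / 8))) +
            ENNReal.ofReal c * (D * ENNReal.ofReal δ) ∧
          ∀ f : E2 → ℝ, ContDiff ℝ 1 f →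
            ∑ a ∈ H, ∫⁻ x in sphere a (s * (δ / 8)), valSq f x ∂μH[1] ≤
              ENNReal.ofReal c * (ENNReal.ofReal (1 + ε) ^ 3 *
                ∫⁻ t, valSq f (frame e (t, φ t)) ∂m +
                A * (ENNReal.ofReal (s + w) * dirEnergy Z f)) := by
  classical
  obtain ⟨lam, hlam, hsph⟩ := exists_hausdorffMeasure_sphere
  refine ⟨(4 * (R + 1)).toNNReal * (C₀ + lam), ?_⟩
  intro δ hδ hδ1 ε hε
  obtain ⟨A, hA⟩ := exists_column_le hδ hδ1 C₀ hε
  refine ⟨A, lam * δ / (8 * (C₀ + 1)), by positivity, ?_⟩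
  intro e φ m T s w c hφ hm hmf hT hTR hmT hs hs1 hsw hc hcs
  have hKs : 0 ≤ s * (K : ℝ) := by positivity
  have hsw1 : s ≤ w := by linarith
  have hw : 0 < w := hs.trans_le hsw1
  set r := s * (δ / 8) with hr
  have hr0 : 0 < r := by positivity
  set L := r * lam with hL
  have hL0 : 0 < L := by positivity
  have hLe : ∀ a, μH[1] (sphere a r) = ENNReal.ofReal L := fun a => by
    rw [hausdorffMeasure_sphere_eq a 0, hsph r hr0, hL, ENNReal.ofReal_mul hr0.le]
    simp
  set M := ⌊R / s⌋ + 1 with hM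
  set B : ℤ → Set ℝ := fun i => T ∩ Icc (i * s + s * δ) (i * s + s * (1 - δ)) with hB
  have hsδ : 0 < s * δ := by positivity
  have hBm : ∀ i, MeasurableSet (B i) := fun i => hT.inter measurableSet_Icc
  have hBI : ∀ i, ∀ t ∈ B i, i * s < t ∧ t < i * s + s := fun i t ht =>
    ⟨by linarith [ht.2.1], by linarith [ht.2.2]⟩
  set N : ℤ → ℕ := fun i => ⌊c * (m (B i)).toReal / L⌋₊ with hN
  have hN1 : ∀ i, N i * L ≤ c * (m (B i)).toReal := fun i => by
    rw [← le_div_iff₀ hL0]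
    exact Nat.floor_le (by positivity)
  have hN2 : ∀ i, c * (m (B i)).toReal ≤ N i * L + L := fun i => by
    have := (div_le_iff₀ hL0).1 (Nat.lt_floor_add_one (c * (m (B i)).toReal / L)).le
    linarith
  have hmB : ∀ i, (m (B i)).toReal ≤ C₀ * s := fun i => by
    refine ENNReal.toReal_le_of_le_ofReal (by positivity) ?_
    calc m (B i) ≤ m (Icc (i * s : ℝ) (i * s + s)) :=
          measure_mono fun t ht => ⟨(hBI i t ht).1.le, (hBI i t ht).2.le⟩
      _ ≤ (C₀ • volume) (Icc (i * s : ℝ) (i * s + s)) := hm _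
      _ = _ := by
        rw [Measure.smul_apply, ENNReal.smul_def, smul_eq_mul, Real.volume_Icc,
          ENNReal.ofReal_mul C₀.coe_nonneg]
        simp
  have hNs : ∀ i, N i * s ≤ w := fun i => by
    have h1 : N i * L ≤ C₀ * (lam * δ / (8 * (C₀ + 1)) * w) :=
      calc N i * L ≤ c * (C₀ * s) :=
            (hN1 i).trans (mul_le_mul_of_nonneg_left (hmB i) (by linarith))
        _ = C₀ * (c * s) := by ring
        _ ≤ _ := mul_le_mul_of_nonneg_left hcs C₀.2
    have h2 : (C₀ : ℝ) * (lam * δ / (8 * (C₀ + 1)) * w) ≤ lam * δ / 8 * w := by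
      rw [show (C₀ : ℝ) * (lam * δ / (8 * (C₀ + 1)) * w) =
        C₀ / (C₀ + 1) * (lam * δ / 8 * w) by field_simp]
      refine mul_le_of_le_one_left (by positivity) ?_
      rw [div_le_one (by positivity)]
      linarith
    have h3 : (N i * s) * (lam * δ / 8) ≤ w * (lam * δ / 8) := by
      rw [hL, hr] at h1
      linarith
    exact le_of_mul_le_mul_right h3 (by positivity)
  have hBne : ∀ i, ∀ l < N i, ∃ t ∈ T, t ∈ Icc (i * s) (i * s + s) := fun i l hl => by
    rcases (B i).eq_empty_or_nonempty with h | ⟨t, ht⟩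
    · simp [hN, h] at hl
    · exact ⟨t, ht.1, (hBI i t ht).1.le, (hBI i t ht).2.le⟩
  set y : ℤ → ℝ := fun i => φ (i * s) - w with hy
  have hrect : ∀ i, ∀ l < N i, rect e s (i * s, y i - l * s) ⊆ lowerStrip e φ T w :=
    fun i l hl => by
      obtain ⟨t, ht, hti⟩ := hBne i l hl
      refine rect_subset_lowerStrip e hφ hs hsw ht hti (by positivity) ?_
      have h1 : (l : ℝ) + 1 ≤ N i := by exact_mod_cast hl
      nlinarith [hNs i]
  set ctr : (Σ _ : ℤ, ℕ) → E2 := fun p => holeCenter δ e s (p.1 * s, y p.1 - p.2 * s) with hctr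
  set J : Finset (Σ _ : ℤ, ℕ) := (Finset.Ico (-M) M).sigma fun i => Finset.range (N i) with hJ
  have hdist : ∀ p q, p ≠ q → s ≤ dist (ctr p) (ctr q) := fun p q hpq => by
    refine le_dist_holeCenter e hs y ?_
    by_contra! h
    exact hpq (Sigma.ext h.1 (heq_of_eq h.2))
  have hinj : InjOn ctr (J : Set (Σ _ : ℤ, ℕ)) := fun p _ q _ h => by
    by_contra hpq
    have := hdist p q hpq
    rw [h, dist_self] at this
    linarith
  set Y : ℤ → Set E2 := fun i =>
    {x | e x 0 ∈ B i ∧ φ (e x 0) - 4 * w < e x 1 ∧ e x 1 < φ (e x 0)} ∪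
      ⋃ l ∈ Finset.range (N i), cell δ e s (i * s, y i - l * s) with hY
  have hc0 := continuous_coord e 0
  have hc1 := continuous_coord e 1
  have hYm : ∀ i, MeasurableSet (Y i) := fun i => by
    refine MeasurableSet.union ?_
      (Finset.measurableSet_biUnion _ fun l _ => measurableSet_cell _ _ _ _)
    refine ((hBm i).preimage hc0.measurable).inter (IsOpen.measurableSet ?_)
    exact (isOpen_lt ((hφ.continuous.comp hc0).sub continuous_const) hc1).inter
      (isOpen_lt hc1 (hφ.continuous.comp hc0))
  have hYcol : ∀ i, ∀ x ∈ Y i, i * s < e x 0 ∧ e x 0 < i * s + s := by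
    rintro i x (hx | hx)
    · exact hBI i _ hx.1
    · obtain ⟨l, -, hl⟩ := mem_iUnion₂.1 hx
      exact hl.1.1
  have hYd : ((Finset.Ico (-M) M : Finset ℤ) : Set ℤ).PairwiseDisjoint Y := by
    intro i _ i' _ hii
    refine Set.disjoint_left.2 fun x hx hx' => hii ?_
    exact eq_of_mem_column hs (hYcol i x hx) (hYcol i' x hx')
  have hYstrip : ∀ i, Y i ⊆ lowerStrip e φ T w := by
    rintro i x (hx | hx)
    · refine ⟨hx.2, e x 0, hx.1.1, ?_⟩
      have h5 := dist_frame_le e (e x 0, e x 1) (e x 0, φ (e x 0))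
      rw [frame_coord] at h5
      have h6 : |e x 1 - φ (e x 0)| ≤ 4 * w := by
        rw [abs_le]
        constructor <;> linarith [hx.2.1, hx.2.2]
      simp only [sub_self, abs_zero, zero_add] at h5
      linarith
    · obtain ⟨l, hlN, hl⟩ := mem_iUnion₂.1 hx
      exact hrect i l (Finset.mem_range.1 hlN) hl.1
  refine ⟨J.image ctr, ⋃ i ∈ Finset.Ico (-M) M, Y i,
    Finset.measurableSet_biUnion _ fun i _ => hYm i, iUnion₂_subset fun i _ => hYstrip i,
    ?_, ?_, ?_, ?_, ?_⟩
  · intro a ha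
    obtain ⟨p, hp, rfl⟩ := Finset.mem_image.1 ha
    exact (closedBall_subset_rect e hs hδ hδ1 _).trans
      (hrect p.1 p.2 (Finset.mem_range.1 (Finset.mem_sigma.1 hp).2))
  · intro a ha
    obtain ⟨p, hp, rfl⟩ := Finset.mem_image.1 ha
    rw [Set.disjoint_iUnion₂_left]
    intro i _
    refine Disjoint.union_left ?_ ?_
    · refine Set.disjoint_left.2 fun x hx hx' => ?_
      have h0 := abs_le.1 ((abs_coord_sub_le e x (ctr p) 0).trans hx')
      simp only [hctr, holeCenter, frame_apply_zero] at h0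
      have h2 : i = p.1 := by
        refine eq_of_mem_column hs (hBI i _ hx.1) ?_
        exact (closedBall_subset_rect e hs hδ hδ1 _
          (closedBall_subset_closedBall (by linarith) hx')).1
      subst h2
      have := hx.1.2.2
      nlinarith
    · rw [Set.disjoint_iUnion₂_left]
      exact fun l _ => disjoint_cell_closedBall e hs hδ hδ1 y i p.1 l p.2
  · intro a ha b hb hab
    obtain ⟨p, hp, rfl⟩ := Finset.mem_image.1 ha
    obtain ⟨q, hq, rfl⟩ := Finset.mem_image.1 hb
    refine le_trans ?_ (hdist p q fun h => hab (by rw [h]))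
    nlinarith
  · rw [Finset.sum_image hinj, hJ, Finset.sum_sigma]
    simp only [hLe, Finset.sum_const, Finset.card_range, nsmul_eq_mul]
    have hm1 := measure_univ_le_sum_column hm hTR hmT hs hs1 hδ hR
    have hcol : ∀ i, ENNReal.ofReal c * m (B i) ≤ N i * ENNReal.ofReal L + ENNReal.ofReal L :=
      fun i => by
        rw [← ENNReal.ofReal_toReal (measure_ne_top m (B i)), ← ENNReal.ofReal_mul (by linarith),
          ← ENNReal.ofReal_natCast, ← ENNReal.ofReal_mul (by positivity),
          ← ENNReal.ofReal_add (by positivity) hL0.le]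
        exact ENNReal.ofReal_le_ofReal (hN2 i)
    have hML : M * s ≤ R + 1 := by
      have : (⌊R / s⌋ : ℝ) * s ≤ R := by
        rw [← le_div_iff₀ hs]
        exact Int.floor_le _
      rw [hM]
      push_cast
      linarith
    have hM0 : 0 ≤ M := by
      have : 0 ≤ ⌊R / s⌋ := Int.floor_nonneg.2 (by positivity)
      omega
    have hcard : ((Finset.Ico (-M) M).card : ℝ≥0∞) * ENNReal.ofReal L ≤
        ENNReal.ofReal c * ENNReal.ofReal (4 * (R + 1) * (lam * δ)) := by
      rw [← ENNReal.ofReal_natCast, ← ENNReal.ofReal_mul (by positivity),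
        ← ENNReal.ofReal_mul (by linarith)]
      refine ENNReal.ofReal_le_ofReal ?_
      have h1 : ((Finset.Ico (-M) M).card : ℝ) = 2 * M := by
        rw [Int.card_Ico]
        have : (((M - -M).toNat : ℕ) : ℤ) = 2 * M := by omega
        exact_mod_cast this
      have h2 : 0 ≤ 4 * (R + 1) * (lam * δ) := by positivity
      calc _ = (M * s) * (lam * δ / 4) := by
            rw [h1, hL, hr]
            ring
        _ ≤ (R + 1) * (lam * δ / 4) := by gcongr
        _ ≤ 4 * (R + 1) * (lam * δ) := by linarith
        _ ≤ _ := le_mul_of_one_le_left h2 hc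
    calc ENNReal.ofReal c * m univ ≤ ENNReal.ofReal c * (∑ i ∈ Finset.Ico (-M) M, m (B i) +
          C₀ * ENNReal.ofReal (4 * δ * (R + 1))) := mul_le_mul' le_rfl hm1
      _ ≤ ∑ i ∈ Finset.Ico (-M) M, (N i * ENNReal.ofReal L + ENNReal.ofReal L) +
          ENNReal.ofReal c * (C₀ * ENNReal.ofReal (4 * δ * (R + 1))) := by
          rw [mul_add, Finset.mul_sum]
          exact add_le_add (Finset.sum_le_sum fun i _ => hcol i) le_rfl
      _ ≤ ∑ i ∈ Finset.Ico (-M) M, N i * ENNReal.ofReal L +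
          (ENNReal.ofReal c * ENNReal.ofReal (4 * (R + 1) * (lam * δ)) +
          ENNReal.ofReal c * (C₀ * ENNReal.ofReal (4 * δ * (R + 1)))) := by
          rw [Finset.sum_add_distrib, Finset.sum_const, nsmul_eq_mul, add_assoc]
          gcongr
      _ = _ := by
          rw [← mul_add]
          congr 2
          rw [ENNReal.ofReal_mul (by positivity), ENNReal.ofReal_mul lam.coe_nonneg,
            show 4 * δ * (R + 1) = 4 * (R + 1) * δ by ring,
            ENNReal.ofReal_mul (by positivity : 0 ≤ 4 * (R + 1)), ENNReal.ofReal_coe_nnreal]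
          push_cast
          rw [show ((4 * (R + 1)).toNNReal : ℝ≥0∞) = ENNReal.ofReal (4 * (R + 1)) from rfl]
          ring
  · intro f hf
    rw [Finset.sum_image hinj, hJ, Finset.sum_sigma]
    have hcol : ∀ i, ∑ l ∈ Finset.range (N i),
        ∫⁻ x in sphere (holeCenter δ e s (i * s, y i - l * s)) r, valSq f x ∂μH[1] ≤
        ENNReal.ofReal c * (ENNReal.ofReal (1 + ε) ^ 3 *
          ∫⁻ t in B i, valSq f (frame e (t, φ t)) ∂m +
          A * (ENNReal.ofReal (s + w) * dirEnergy (Y i) f)) := fun i => by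
      have hφB : ∀ t ∈ B i, |φ t - φ (i * s)| ≤ K * s := fun t ht => by
        have h := hφ.dist_le_mul t (i * s)
        rw [Real.dist_eq, Real.dist_eq] at h
        refine h.trans (mul_le_mul_of_nonneg_left ?_ K.2)
        rw [abs_le]
        constructor <;> linarith [(hBI i t ht).1, (hBI i t ht).2]
      have hNsi := hNs i
      refine hA e φ m (B i) (Y i) s w c (i * s) (y i) (N i) hφ.continuous hmf hm (hBm i) (hYm i)
        hs hw.le hc inter_subset_right ?_ ?_ ?_ ?_ ?_ f hf
      · intro t ht
        have := abs_le.1 (hφB t ht)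
        simp only [hy]
        linarith
      · intro t ht
        have := abs_le.1 (hφB t ht)
        simp only [hy]
        linarith
      · intro t ht h hh
        have := abs_le.1 (hφB t ht)
        refine Or.inl ?_
        show e (frame e (t, h)) 0 ∈ B i ∧ φ (e (frame e (t, h)) 0) - 4 * w < e (frame e (t, h)) 1 ∧
          e (frame e (t, h)) 1 < φ (e (frame e (t, h)) 0)
        rw [frame_apply_zero, frame_apply_one]
        refine ⟨ht, ?_, hh.2⟩
        have := hh.1
        simp only [hy] at this
        linarith
      · intro l hl
        exact subset_union_of_subset_right
          (subset_biUnion_of_mem (u := fun l : ℕ => cell δ e s (i * s, y i - l * s))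
            (Finset.mem_range.2 hl)) _
      · rw [hLe, ← ENNReal.ofReal_toReal (measure_ne_top m (B i)), ← ENNReal.ofReal_natCast,
          ← ENNReal.ofReal_mul (by positivity), ← ENNReal.ofReal_mul (by linarith)]
        exact ENNReal.ofReal_le_ofReal (hN1 i)
    refine (Finset.sum_le_sum fun i _ => hcol i).trans ?_
    rw [← Finset.mul_sum, Finset.sum_add_distrib]
    simp only [← Finset.mul_sum]
    refine mul_le_mul' le_rfl (add_le_add (mul_le_mul' le_rfl ?_) (mul_le_mul' le_rfl
      (mul_le_mul' le_rfl ?_)))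
    · rw [← lintegral_biUnion_finset ?_ fun i _ => hBm i]
      · exact setLIntegral_le_lintegral _ _
      · intro i _ i' _ hii
        refine Set.disjoint_left.2 fun x hx hx' => hii ?_
        exact eq_of_mem_column hs (hBI i x hx) (hBI i' x hx')
    · exact sum_dirEnergy_le _ (fun i _ => hYm i) hYd
        (fun i hi => subset_biUnion_of_mem (u := Y) hi) f

/-! ### Decomposition of the boundary into graph pieces -/

/-- A compact part of the boundary of `Ω`, parametrized as a graph over `T`, with a measure `m`
on the parameter space. -/
structure IsPiece (Ω : Set E2) (K C₀ : ℝ≥0) (R : ℝ) (e : E2 ≃ₗᵢ[ℝ] E2) (φ : ℝ → ℝ)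
    (m : Measure ℝ) (T : Set ℝ) : Prop where
  lipschitz : LipschitzWith K φ
  le_volume : m ≤ C₀ • volume
  isFiniteMeasure : IsFiniteMeasure m
  isCompact : IsCompact T
  subset : T ⊆ Icc (-R) R
  compl_eq_zero : m Tᶜ = 0
  exists_chart : ∃ U : Set E2, IsOpen U ∧ (∀ t ∈ T, frame e (t, φ t) ∈ U) ∧
    ∀ x ∈ U, (x ∈ Ω ↔ φ (e x 0) < e x 1)

lemma lipschitzWith_graph (e : E2 ≃ₗᵢ[ℝ] E2) {K : ℝ≥0} {φ : ℝ → ℝ} (hφ : LipschitzWith K φ) :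
    LipschitzWith (1 + K) fun t => frame e (t, φ t) := by
  refine LipschitzWith.of_dist_le_mul fun t u => (dist_frame_le e _ _).trans ?_
  have h := hφ.dist_le_mul t u
  rw [Real.dist_eq, Real.dist_eq] at h
  rw [Real.dist_eq, NNReal.coe_add, NNReal.coe_one, add_mul, one_mul]
  exact add_le_add le_rfl h

lemma coord_eq_of_mem_frontier {Ω U : Set E2} (hΩ : IsOpen Ω) (hU : IsOpen U)
    {e : E2 ≃ₗᵢ[ℝ] E2} {K : ℝ≥0} {φ : ℝ → ℝ} (hφ : LipschitzWith K φ)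
    (h : ∀ x ∈ U, (x ∈ Ω ↔ φ (e x 0) < e x 1)) {x : E2} (hx : x ∈ frontier Ω) (hxU : x ∈ U) :
    e x 1 = φ (e x 0) := by
  rw [hΩ.frontier_eq] at hx
  refine le_antisymm (not_lt.1 fun h1 => hx.2 ((h x hxU).2 h1)) (not_lt.1 fun h1 => ?_)
  have hV : IsOpen {z : E2 | e z 1 < φ (e z 0)} :=
    isOpen_lt (continuous_coord e 1) (hφ.continuous.comp (continuous_coord e 0))
  obtain ⟨z, ⟨hz1, hz2⟩, hzΩ⟩ := mem_closure_iff.1 hx.1 _ (hU.inter hV) ⟨hxU, h1⟩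
  exact lt_asymm ((h z hz1).1 hzΩ) hz2

lemma exists_isPiece {Ω : Set E2} (hΩ : IsLipschitzDomain Ω) {ν : Measure E2} {Cν : ℝ≥0}
    (hν : ν ≤ Cν • μH[1].restrict (frontier Ω)) (p₀ : E2) {η : ℝ≥0∞} (hη : η ≠ 0) :
    ∃ (n : ℕ) (K C₀ : ℝ≥0) (R : ℝ) (e : Fin n → E2 ≃ₗᵢ[ℝ] E2) (φ : Fin n → ℝ → ℝ)
      (m : Fin n → Measure ℝ) (T : Fin n → Set ℝ), 0 ≤ R ∧
      (∀ j, IsPiece Ω K C₀ R (e j) (φ j) (m j) (T j)) ∧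
      (∀ i j, i ≠ j → ∀ t ∈ T i, ∀ u ∈ T j, frame (e i) (t, φ i t) ≠ frame (e j) (u, φ j u)) ∧
      (∀ j, ∀ t ∈ T j, frame (e j) (t, φ j t) ∈ frontier Ω ∧ frame (e j) (t, φ j t) ≠ p₀) ∧
      ν univ ≤ ∑ j, m j univ + η ∧ IsFiniteMeasure ν ∧
      ∀ F : E2 → ℝ≥0∞, Measurable F →
        ∑ j, ∫⁻ t, F (frame (e j) (t, φ j t)) ∂m j ≤ ∫⁻ x, F x ∂ν := by
  obtain ⟨hO, -, hb, hchart⟩ := hΩ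
  choose! e K φ U hφ hU hpU hUΩ using hchart
  have hcpt : IsCompact (frontier Ω) := by
    refine Metric.isCompact_of_isClosed_isBounded isClosed_frontier ?_
    exact hb.closure.subset frontier_subset_closure
  obtain ⟨R, hR⟩ := hcpt.isBounded.subset_closedBall (0 : E2)
  obtain ⟨t, htf, htc⟩ := hcpt.elim_nhds_subcover U fun p hp => (hU p hp).mem_nhds (hpU p hp)
  set n := t.card with hn
  set g : Fin n → E2 := fun j => t.equivFin.symm j with hg
  have hgf : ∀ j, g j ∈ frontier Ω := fun j => htf _ (t.equivFin.symm j).2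
  set V : Fin n → Set E2 := fun j => U (g j) with hV
  have hVm : ∀ j, MeasurableSet (V j) := fun j => (hU _ (hgf j)).measurableSet
  have hcov : frontier Ω ⊆ ⋃ j, V j := by
    intro x hx
    obtain ⟨p, hp, hxp⟩ := mem_iUnion₂.1 (htc hx)
    refine mem_iUnion.2 ⟨t.equivFin ⟨p, hp⟩, ?_⟩
    simp only [hV, hg, Equiv.symm_apply_apply]
    exact hxp
  have hgraph : ∀ j, ∀ x ∈ frontier Ω, x ∈ V j →
      frame (e (g j)) (e (g j) x 0, φ (g j) (e (g j) x 0)) = x := fun j x hx hxV => by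
    rw [← coord_eq_of_mem_frontier hO (hU _ (hgf j)) (hφ _ (hgf j)) (hUΩ _ (hgf j)) hx hxV,
      frame_coord]
  have hproj : ∀ j, ∀ x ∈ frontier Ω, e (g j) x 0 ∈ Icc (-|R|) |R| := fun j x hx => by
    have h1 := abs_coord_sub_le (e (g j)) x 0 0
    rw [map_zero] at h1
    have h2 := hR hx
    rw [mem_closedBall] at h2
    rw [mem_Icc, ← abs_le]
    simpa using (h1.trans h2).trans (le_abs_self R)
  have hbd : ∀ j, ∀ X ⊆ V j, ∀ A : Set ℝ, (∀ x ∈ X, x ∈ frontier Ω → e (g j) x 0 ∈ A) →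
      MeasurableSet X →
      ν X ≤ (Cν * (1 + K (g j)) : ℝ≥0) * volume A := by
    intro j X hXV A hA hX
    calc ν X ≤ (Cν • μH[1].restrict (frontier Ω)) X := hν X
      _ = Cν * μH[1] (X ∩ frontier Ω) := by
        rw [Measure.smul_apply, Measure.restrict_apply hX, ENNReal.smul_def, smul_eq_mul]
      _ ≤ Cν * ((1 + K (g j) : ℝ≥0) * volume A) := by
        refine mul_le_mul' le_rfl ?_
        have h1 := (lipschitzWith_graph (e (g j)) (hφ _ (hgf j))).hausdorffMeasure_image_le
          (d := 1) zero_le_one A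
        rw [hausdorffMeasure_real, ENNReal.rpow_one] at h1
        refine (measure_mono ?_).trans h1
        exact fun x hx => ⟨_, hA x hx.1 hx.2, hgraph j x hx.2 (hXV hx.1)⟩
      _ = _ := by
        push_cast
        ring
  have hνc : ν (frontier Ω)ᶜ = 0 := by
    refine nonpos_iff_eq_zero.1 ((hν _).trans ?_)
    rw [Measure.smul_apply, Measure.restrict_apply isClosed_frontier.measurableSet.compl]
    simp
  have hfin : IsFiniteMeasure ν := by
    refine ⟨?_⟩
    have h1 : (univ : Set E2) ⊆ (frontier Ω)ᶜ ∪ ⋃ j, V j := fun x _ => by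
      by_cases hx : x ∈ frontier Ω
      · exact Or.inr (hcov hx)
      · exact Or.inl hx
    refine ((measure_mono h1).trans (measure_union_le _ _)).trans_lt ?_
    rw [hνc, zero_add]
    refine (measure_iUnion_fintype_le _ _).trans_lt (ENNReal.sum_lt_top.2 fun j _ => ?_)
    refine (hbd j (V j) subset_rfl (Icc (-|R|) |R|) (fun x _ hx => hproj j x hx)
      (hVm j)).trans_lt ?_
    rw [Real.volume_Icc]
    exact ENNReal.mul_lt_top ENNReal.coe_lt_top ENNReal.ofReal_lt_top
  set Q : Fin n → Set E2 := fun j => (disjointed V j ∩ frontier Ω) \ {p₀} with hQ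
  have hQm : ∀ j, MeasurableSet (Q j) := fun j => by
    refine MeasurableSet.diff (MeasurableSet.inter ?_ isClosed_frontier.measurableSet)
      (measurableSet_singleton p₀)
    exact disjointedRec (fun _ _ ht => MeasurableSet.diff ht (hVm _)) (hVm j)
  have hQV : ∀ j, Q j ⊆ V j := fun j x hx => disjointed_subset V j hx.1.1
  have hp₀ : ν {p₀} = 0 := by
    refine nonpos_iff_eq_zero.1 ((hν _).trans ?_)
    rw [Measure.smul_apply, Measure.restrict_apply (measurableSet_singleton p₀)]
    have : μH[1] ({p₀} ∩ frontier Ω) = 0 := by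
      refine measure_mono_null inter_subset_left ?_
      have := Measure.nullSingletonClass_hausdorff E2 (d := 1) one_pos
      exact measure_singleton p₀
    simp [this]
  obtain ⟨η', hη', hsum⟩ := ENNReal.exists_pos_sum_of_countable' hη (Fin n)
  have hK := fun j => (hQm j).exists_isCompact_lt_add (measure_ne_top ν _) (hη' j).ne'
  choose X hXQ hXc hX using hK
  set Ks : ℝ≥0 := Finset.univ.sup fun j => K (g j) with hKs
  have hKle : ∀ j, K (g j) ≤ Ks := fun j =>
    Finset.le_sup (f := fun j => K (g j)) (Finset.mem_univ j)
  have hcm : ∀ j, Measurable fun x : E2 => e (g j) x 0 := fun j =>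
    (continuous_coord _ 0).measurable
  have hXgraph : ∀ j, ∀ x ∈ X j,
      frame (e (g j)) (e (g j) x 0, φ (g j) (e (g j) x 0)) = x := fun j x hx =>
    hgraph j x (hXQ j hx).1.2 (hQV j (hXQ j hx))
  have hXd : Pairwise fun i j => Disjoint (X i) (X j) := fun i j hij =>
    (disjoint_disjointed V hij).mono (fun x hx => (hXQ i hx).1.1) fun x hx => (hXQ j hx).1.1
  refine ⟨n, Ks, Cν * (1 + Ks), |R|, fun j => e (g j), fun j => φ (g j),
    fun j => (ν.restrict (X j)).map fun x => e (g j) x 0, fun j => (fun x => e (g j) x 0) '' X j,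
    abs_nonneg R, ?_, ?_, ?_, ?_, hfin, ?_⟩
  · intro j
    refine ⟨(hφ _ (hgf j)).weaken (hKle j), ?_, inferInstance,
      (hXc j).image (continuous_coord _ 0), ?_, ?_, ⟨V j, hU _ (hgf j), ?_, hUΩ _ (hgf j)⟩⟩
    · refine Measure.le_iff.2 fun A hA => ?_
      rw [Measure.map_apply (hcm j) hA, Measure.restrict_apply (hcm j hA), Measure.smul_apply,
        ENNReal.smul_def, smul_eq_mul]
      refine (hbd j _ (inter_subset_right.trans ((hXQ j).trans (hQV j))) A
        (fun x hx _ => hx.1) ((hcm j hA).inter (hXc j).measurableSet)).trans ?_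
      refine mul_le_mul' (ENNReal.coe_le_coe.2 ?_) le_rfl
      gcongr
      exact hKle j
    · rintro _ ⟨x, hx, rfl⟩
      exact hproj j x (hXQ j hx).1.2
    · rw [Measure.map_apply (hcm j) ((hXc j).image (continuous_coord _ 0)).measurableSet.compl,
        Measure.restrict_apply (hcm j ((hXc j).image (continuous_coord _ 0)).measurableSet.compl)]
      refine measure_mono_null (t := ∅) ?_ measure_empty
      exact fun x hx => hx.1 ⟨x, hx.2, rfl⟩
    · rintro _ ⟨x, hx, rfl⟩
      simp only [hXgraph j x hx]
      exact hQV j (hXQ j hx)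
  · rintro i j hij _ ⟨x, hx, rfl⟩ _ ⟨z, hz, rfl⟩
    simp only [hXgraph i x hx, hXgraph j z hz]
    rintro rfl
    exact Set.disjoint_left.1 (hXd hij) hx hz
  · rintro j _ ⟨x, hx, rfl⟩
    simp only [hXgraph j x hx]
    exact ⟨(hXQ j hx).1.2, (hXQ j hx).2⟩
  · have h1 : (univ : Set E2) ⊆ ((frontier Ω)ᶜ ∪ {p₀}) ∪ ⋃ j, Q j := fun x _ => by
      by_cases hx : x ∈ frontier Ω
      · by_cases hxp : x = p₀
        · exact Or.inl (Or.inr hxp)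
        · have := hcov hx
          rw [← iUnion_disjointed] at this
          obtain ⟨j, hj⟩ := mem_iUnion.1 this
          exact Or.inr (mem_iUnion.2 ⟨j, ⟨hj, hx⟩, hxp⟩)
      · exact Or.inl (Or.inl hx)
    calc ν univ ≤ ν (⋃ j, Q j) := by
          refine (measure_mono h1).trans ((measure_union_le _ _).trans ?_)
          rw [measure_union_null hνc hp₀, zero_add]
      _ ≤ ∑ j, ν (Q j) := measure_iUnion_fintype_le _ _
      _ ≤ ∑ j, (ν (X j) + η' j) := Finset.sum_le_sum fun j _ => (hX j).le
      _ ≤ _ := by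
          rw [Finset.sum_add_distrib]
          refine add_le_add (Finset.sum_le_sum fun j _ => ?_) ?_
          · rw [Measure.map_apply (hcm j) MeasurableSet.univ, preimage_univ,
              Measure.restrict_apply_univ]
          · rw [← tsum_fintype (L := .unconditional _)]
            exact hsum.le
  · intro F hF
    calc _ = ∑ j, ∫⁻ x in X j, F x ∂ν := by
          refine Finset.sum_congr rfl fun j _ => ?_
          have hgm : Measurable fun t => frame (e (g j)) (t, φ (g j) t) :=
            (lipschitzWith_graph (e (g j)) (hφ _ (hgf j))).continuous.measurable
          refine (lintegral_map (hF.comp hgm) (hcm j)).trans ?_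
          exact setLIntegral_congr_fun (hXc j).measurableSet fun x hx => by
            simp only [Function.comp_apply, hXgraph j x hx]
      _ = ∫⁻ x in ⋃ j ∈ Finset.univ, X j, F x ∂ν := by
          rw [lintegral_biUnion_finset (fun i _ j _ hij => hXd hij)
            fun j _ => (hXc j).measurableSet]
      _ ≤ _ := setLIntegral_le_lintegral _ _

/-! ### The core domain -/

lemma exists_graph_strip_subset (e : E2 ≃ₗᵢ[ℝ] E2) {φ : ℝ → ℝ} (hφ : Continuous φ) {T : Set ℝ}
    (hT : IsCompact T) {U : Set E2} (hU : IsOpen U) (h : ∀ t ∈ T, frame e (t, φ t) ∈ U) :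
    ∃ τ > 0, ∀ t ∈ T, ∀ x, dist x (frame e (t, φ t)) < τ → x ∈ U := by
  have hc : IsCompact ((fun t => frame e (t, φ t)) '' T) :=
    hT.image ((continuous_frame e).comp (continuous_id.prodMk hφ))
  obtain ⟨τ, hτ, hsub⟩ := hc.exists_thickening_subset_open hU (by
    rintro _ ⟨t, ht, rfl⟩
    exact h t ht)
  exact ⟨τ, hτ, fun t ht x hx => hsub (mem_thickening_iff.2 ⟨_, mem_image_of_mem _ ht, hx⟩)⟩

lemma setLIntegral_map_frame (e : E2 ≃ₗᵢ[ℝ] E2) (m : Measure ℝ) [SFinite m] {φ : ℝ → ℝ} {T : Set ℝ}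
    (hT : MeasurableSet T) (h : ℝ) {V : Set E2} (hV : MeasurableSet V)
    (hVe : V = {x | e x 0 ∈ T ∧ e x 1 ∈ Ioo (φ (e x 0)) (φ (e x 0) + h)}) {F : E2 → ℝ≥0∞}
    (hF : Measurable F) :
    ∫⁻ x in V, F x ∂((m.prod volume).map (frame e)) =
      ∫⁻ t in T, (∫⁻ y in Ioo (φ t) (φ t + h), F (frame e (t, y))) ∂m := by
  have hFV := hF.indicator hV
  rw [← lintegral_indicator hV, lintegral_map hFV (measurable_frame e), ← lintegral_indicator hT]
  refine (lintegral_prod _ (hFV.comp (measurable_frame e)).aemeasurable).trans ?_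
  refine lintegral_congr fun t => ?_
  have hmem : ∀ y, frame e (t, y) ∈ V ↔ t ∈ T ∧ y ∈ Ioo (φ t) (φ t + h) := fun y => by
    rw [hVe]
    show _ ∧ _ ↔ _
    rw [frame_apply_zero, frame_apply_one]
  by_cases ht : t ∈ T
  · rw [indicator_of_mem ht, ← lintegral_indicator measurableSet_Ioo]
    refine lintegral_congr fun y => ?_
    by_cases hy : y ∈ Ioo (φ t) (φ t + h)
    · rw [Function.comp_apply, indicator_of_mem ((hmem y).2 ⟨ht, hy⟩), indicator_of_mem hy]
    · rw [Function.comp_apply, indicator_of_notMem fun h' => hy ((hmem y).1 h').2,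
        indicator_of_notMem hy]
  · rw [indicator_of_notMem ht]
    simp [hmem, ht]

lemma IsPiece.exists_controlled_ball {Ω : Set E2} {K C₀ : ℝ≥0} {R : ℝ} {e : E2 ≃ₗᵢ[ℝ] E2}
    {φ : ℝ → ℝ} {m : Measure ℝ} {T : Set ℝ} (hp : IsPiece Ω K C₀ R e φ m T) (hΩ : IsOpen Ω)
    (hm : m univ ≠ 0) {G : Set E2} (hΩG : Ω ⊆ G) :
    ∃ x ∈ Ω, ∃ r > 0, Controlled G (fun f => ∫⁻ t, valSq f (frame e (t, φ t)) ∂m)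
      (volume.restrict (ball x r)) := by
  have := hp.isFiniteMeasure
  have hφ := hp.lipschitz.continuous
  have hT := hp.isCompact.measurableSet
  obtain ⟨U, hU, hTU, hchart⟩ := hp.exists_chart
  obtain ⟨h, hh, hhU⟩ := exists_graph_strip_subset e hφ hp.isCompact hU hTU
  have hc0 := continuous_coord e 0
  have hc1 := continuous_coord e 1
  set V : Set E2 := {x | e x 0 ∈ T ∧ e x 1 ∈ Ioo (φ (e x 0)) (φ (e x 0) + h)} with hV
  have hVm : MeasurableSet V := (hT.preimage hc0.measurable).inter
    ((isOpen_lt (hφ.comp hc0) hc1).inter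
      (isOpen_lt hc1 ((hφ.comp hc0).add continuous_const))).measurableSet
  have hVΩ : V ⊆ Ω := by
    rintro x ⟨hx0, hx1, hx2⟩
    refine (hchart x (hhU _ hx0 x ?_)).2 hx1
    have h5 := dist_frame_le e (e x 0, e x 1) (e x 0, φ (e x 0))
    rw [frame_coord] at h5
    simp only [sub_self, abs_zero, zero_add] at h5
    refine h5.trans_lt ?_
    rw [abs_of_pos (by linarith)]
    linarith
  set μ₀ := (m.prod (volume : Measure ℝ)).map (frame e) with hμ₀
  have hintegral := fun {F : E2 → ℝ≥0∞} (hF : Measurable F) =>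
    setLIntegral_map_frame e m (φ := φ) hT h hVm hV hF
  have hIoo : ∀ t, volume (Ioo (φ t) (φ t + h)) = ENNReal.ofReal h := fun t => by
    rw [Real.volume_Ioo, add_sub_cancel_left]
  have hmT : m T = m univ := by
    rw [← measure_add_measure_compl hT, hp.compl_eq_zero, add_zero]
  have hβ1 : μ₀ V = ENNReal.ofReal h * m univ := by
    have h1 := hintegral (F := fun _ => 1) measurable_const
    simp only [lintegral_const, Measure.restrict_apply_univ, one_mul, hIoo] at h1
    rw [h1, hmT]
  have hle : μ₀ ≤ (C₀ : ℝ≥0∞) • volume := by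
    refine Measure.le_iff.2 fun A hA => ?_
    have h1 := lintegral_lintegral_frame_le e (m := m) (C := C₀) hp.le_volume hA
      (measurable_const (a := (1 : ℝ≥0∞))) MeasurableSet.univ
      (I := fun t => {y | frame e (t, y) ∈ A})
      (fun t => (measurable_frame e).comp measurable_prodMk_left hA) (fun _ _ _ hy => hy)
    simp only [lintegral_const, Measure.restrict_apply_univ, one_mul, Measure.restrict_univ] at h1
    rw [hμ₀, Measure.map_apply (measurable_frame e) hA,
      Measure.prod_apply (measurable_frame e hA)]
    exact h1
  have hfin : IsFiniteMeasure (μ₀.restrict V) := ⟨by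
    rw [Measure.restrict_apply_univ, hβ1]
    exact ENNReal.mul_lt_top ENNReal.ofReal_lt_top (measure_lt_top m _)⟩
  have hctrl : Controlled Ω (fun f => ∫⁻ t, valSq f (frame e (t, φ t)) ∂m) (μ₀.restrict V) := by
    refine ⟨2 * h.toNNReal + 2 * h.toNNReal ^ 2 * C₀, fun f hf => ?_⟩
    have hval : Measurable fun t => valSq f (frame e (t, φ t)) :=
      (measurable_valSq hf).comp ((measurable_frame e).comp (by fun_prop))
    have hcol : ∀ t, ∫⁻ y in Ioo (φ t) (φ t + h), valSq f (frame e (t, y)) ≤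
        2 * ENNReal.ofReal h * valSq f (frame e (t, φ t)) + 2 * ENNReal.ofReal h ^ 2 *
          ∫⁻ y in Ioo (φ t) (φ t + h), gradSq f (frame e (t, y)) := fun t => by
      calc _ ≤ ∫⁻ y in Ioo (φ t) (φ t + h), (2 * valSq f (frame e (t, φ t)) +
            2 * (ENNReal.ofReal h *
              ∫⁻ y in Ioo (φ t) (φ t + h), gradSq f (frame e (t, y)))) := by
            refine setLIntegral_mono' measurableSet_Ioo fun y hy => ?_
            refine (ofReal_sq_le_two _ (f (frame e (t, φ t)))).trans ?_
            refine add_le_add le_rfl (mul_le_mul' le_rfl ?_)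
            refine (ofReal_sq_sub_le_vertical hf e t hy.1.le).trans ?_
            refine mul_le_mul' (ENNReal.ofReal_le_ofReal (by linarith [hy.2])) ?_
            exact lintegral_mono_set fun z hz => ⟨hz.1, hz.2.trans_lt hy.2⟩
        _ = _ := by
            rw [setLIntegral_const, hIoo]
            ring
    have hgrad : ∫⁻ t in T, (∫⁻ y in Ioo (φ t) (φ t + h), gradSq f (frame e (t, y))) ∂m ≤
        C₀ * dirEnergy Ω f := by
      rw [dirEnergy_eq]
      refine lintegral_lintegral_frame_le e hp.le_volume hΩ.measurableSet (measurable_gradSq hf) hT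
        (fun _ => measurableSet_Ioo) fun t ht y hy => hVΩ ?_
      show e (frame e (t, y)) 0 ∈ T ∧
        e (frame e (t, y)) 1 ∈ Ioo (φ (e (frame e (t, y)) 0)) (φ (e (frame e (t, y)) 0) + h)
      rw [frame_apply_zero, frame_apply_one]
      exact ⟨ht, hy⟩
    rw [hintegral (measurable_valSq hf)]
    calc _ ≤ ∫⁻ t in T, (2 * ENNReal.ofReal h * valSq f (frame e (t, φ t)) +
          2 * ENNReal.ofReal h ^ 2 *
            ∫⁻ y in Ioo (φ t) (φ t + h), gradSq f (frame e (t, y))) ∂m :=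
          lintegral_mono fun t => hcol t
      _ = 2 * ENNReal.ofReal h * ∫⁻ t in T, valSq f (frame e (t, φ t)) ∂m +
          2 * ENNReal.ofReal h ^ 2 *
            ∫⁻ t in T, (∫⁻ y in Ioo (φ t) (φ t + h), gradSq f (frame e (t, y))) ∂m := by
          rw [lintegral_add_left (hval.const_mul _), lintegral_const_mul _ hval,
            lintegral_const_mul' _ _ (by finiteness)]
      _ ≤ 2 * ENNReal.ofReal h * ∫⁻ t, valSq f (frame e (t, φ t)) ∂m +
          2 * ENNReal.ofReal h ^ 2 * (C₀ * dirEnergy Ω f) :=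
          add_le_add (mul_le_mul' le_rfl (setLIntegral_le_lintegral _ _))
            (mul_le_mul' le_rfl hgrad)
      _ ≤ _ := by
          push_cast
          rw [show ((h.toNNReal : ℝ≥0) : ℝ≥0∞) = ENNReal.ofReal h from rfl, add_mul, mul_add,
            mul_add, ← mul_assoc (2 * ENNReal.ofReal h ^ 2)]
          exact add_le_add le_self_add le_add_self
  have h0 : (μ₀.restrict V) Ω ≠ 0 := by
    rw [Measure.restrict_apply' hVm, inter_eq_right.2 hVΩ, hβ1]
    exact mul_ne_zero (by simpa using hh) hm
  obtain ⟨x, hx, r, hr, -, C, hC⟩ :=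
    _root_.exists_controlled_ball hΩ (Measure.restrict_le_self.trans hle) h0 hctrl
  refine ⟨x, hx, r, hr, C, fun f hf => (hC f hf).trans ?_⟩
  exact mul_le_mul' le_rfl (add_le_add le_rfl (dirEnergy_mono hΩG f))

/-- A connected open set joining `Ω` to an annulus around it, which is not larger than `Ω` near a
compact set `K` missing a farthest point `p` of the closure of `Ω`. -/
lemma exists_connected_enlargement {Ω K : Set E2} (hΩ : IsOpen Ω) (hc : IsPreconnected Ω) {p : E2}
    (hp : p ∈ closure Ω) (hp0 : p ≠ 0) (hmax : ∀ x ∈ closure Ω, dist x 0 ≤ dist p 0)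
    (hK : IsCompact K) (hKΩ : K ⊆ closure Ω) (hpK : p ∉ K) :
    ∃ G : Set E2, ∃ τ > 0, IsOpen G ∧ IsPreconnected G ∧ Ω ⊆ G ∧ G ⊆ ball 0 (dist p 0 + 2) ∧
      {x | dist p 0 + 1 < dist x 0 ∧ dist x 0 < dist p 0 + 2} ⊆ G ∧
      ∀ x ∈ thickening τ K, x ∈ ball 0 (dist p 0 + 2) ∧ (x ∉ Ω → x ∉ G) := by
  set R := dist p 0 with hR
  have hR0 : 0 < R := dist_pos.2 hp0
  set q : E2 := p + (3 / 2 / R) • p with hq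
  have hnorm : ∀ t : ℝ, 0 ≤ t → dist (p + (t / R) • p) 0 = R + t := fun t ht => by
    rw [show p + (t / R) • p = (1 + t / R) • p by rw [add_smul, one_smul], dist_zero_right,
      norm_smul, ← dist_zero_right p, ← hR, Real.norm_of_nonneg (by positivity)]
    field_simp
  set L := segment ℝ p q with hL
  have hLpt : ∀ x ∈ L, ∃ t ∈ Icc (0 : ℝ) (3 / 2), x = p + (t / R) • p := by
    rw [hL, segment_eq_image']
    rintro _ ⟨θ, hθ, rfl⟩
    refine ⟨θ * (3 / 2), ⟨by linarith [hθ.1], by linarith [hθ.2]⟩, ?_⟩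
    simp only [hq, add_sub_cancel_left, smul_smul]
    rw [mul_div_assoc]
  have hLc : IsCompact L := by
    rw [hL, segment_eq_image']
    exact isCompact_Icc.image (by fun_prop)
  have hdisj : Disjoint L K := by
    rw [Set.disjoint_left]
    intro x hxL hxK
    obtain ⟨t, ht, rfl⟩ := hLpt x hxL
    have h1 := hmax _ (hKΩ hxK)
    rw [hnorm t ht.1] at h1
    have h2 : t = 0 := le_antisymm (by linarith) ht.1
    rw [h2, zero_div, zero_smul, add_zero] at hxK
    exact hpK hxK
  obtain ⟨δ, hδ, hδd⟩ := hdisj.exists_thickenings hLc hK.isClosed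
  set τ := min δ (1 / 4) with hτ
  have hτ0 : 0 < τ := lt_min hδ (by norm_num)
  have hτ1 : τ ≤ 1 / 4 := min_le_right _ _
  set A : Set E2 := {x | R + 1 < dist x 0 ∧ dist x 0 < R + 2} with hA
  have hAo : IsOpen A := (isOpen_lt continuous_const (continuous_id.dist continuous_const)).inter
    (isOpen_lt (continuous_id.dist continuous_const) continuous_const)
  have hAc : IsPreconnected A :=
    isPreconnected_setOf_dist_mem 0 (I := Ioo (R + 1) (R + 2)) isPreconnected_Ioo
      fun t ht => by linarith [ht.1]
  set B := thickening τ L with hB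
  have hBc : IsPreconnected B := ((convex_segment p q).thickening τ).isPreconnected
  have hLB : L ⊆ B := self_subset_thickening hτ0 L
  have hqA : q ∈ A := by
    have h1 := hnorm (3 / 2) (by norm_num)
    exact ⟨by linarith, by linarith⟩
  have hΩB : (Ω ∩ B).Nonempty := by
    obtain ⟨x, hxB, hxΩ⟩ := mem_closure_iff.1 hp B isOpen_thickening
      (hLB (left_mem_segment ℝ p q))
    exact ⟨x, hxΩ, hxB⟩
  have hBA : ((Ω ∪ B) ∩ A).Nonempty := ⟨q, Or.inr (hLB (right_mem_segment ℝ p q)), hqA⟩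
  have hthick : ∀ x ∈ thickening τ K, dist x 0 < R + 1 := fun x hx => by
    obtain ⟨z, hz, hxz⟩ := mem_thickening_iff.1 hx
    linarith [dist_triangle x z 0, hmax z (hKΩ hz)]
  refine ⟨Ω ∪ B ∪ A, τ, hτ0, (hΩ.union isOpen_thickening).union hAo,
    IsPreconnected.union' hBA (IsPreconnected.union' hΩB hc hBc) hAc,
    subset_union_left.trans subset_union_left, ?_, subset_union_right, fun x hx => ⟨?_, ?_⟩⟩
  · rintro x ((hx | hx) | hx)
    · exact mem_ball.2 (by linarith [hmax x (subset_closure hx)])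
    · obtain ⟨z, hz, hxz⟩ := mem_thickening_iff.1 hx
      obtain ⟨t, ht, rfl⟩ := hLpt z hz
      have h1 := hnorm t ht.1
      exact mem_ball.2 (by linarith [dist_triangle x (p + (t / R) • p) 0, ht.2])
    · exact hx.2
  · exact mem_ball.2 (by linarith [hthick x hx])
  · rintro hxΩ ((h1 | h1) | h1)
    · exact hxΩ h1
    · exact Set.disjoint_left.1 hδd (thickening_mono (min_le_left _ _) _ h1)
        (thickening_mono (min_le_left _ _) _ hx)
    · exact absurd h1.1 (not_lt.2 (hthick x hx).le)

lemma exists_core {Ω : Set E2} (hΩ : IsOpen Ω) (hc : IsPreconnected Ω) {p : E2}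
    (hp : p ∈ closure Ω) (hp0 : p ≠ 0) (hmax : ∀ x ∈ closure Ω, dist x 0 ≤ dist p 0)
    {n : ℕ} {K C₀ : ℝ≥0} {R : ℝ} {e : Fin n → E2 ≃ₗᵢ[ℝ] E2} {φ : Fin n → ℝ → ℝ}
    {m : Fin n → Measure ℝ} {T : Fin n → Set ℝ}
    (hpiece : ∀ j, IsPiece Ω K C₀ R (e j) (φ j) (m j) (T j))
    (hne : ∀ i j, i ≠ j → ∀ t ∈ T i, ∀ u ∈ T j, frame (e i) (t, φ i t) ≠ frame (e j) (u, φ j u))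
    (hfr : ∀ j, ∀ t ∈ T j, frame (e j) (t, φ j t) ∈ frontier Ω ∧ frame (e j) (t, φ j t) ≠ p)
    {j₀ : Fin n} (hm : m j₀ univ ≠ 0) :
    ∃ G : Set E2, ∃ R₁ > 0, ∃ τ > 0, Ω ⊆ G ∧ G ⊆ ball 0 R₁ ∧
      (∀ w, 6 * w ≤ τ → ∀ j, lowerStrip (e j) (φ j) (T j) w ⊆ ball 0 R₁ \ G) ∧
      (∀ w, 6 * w ≤ τ → ∀ i j, i ≠ j → ∀ x ∈ lowerStrip (e i) (φ i) (T i) w,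
        ∀ y ∈ lowerStrip (e j) (φ j) (T j) w, τ ≤ dist x y) ∧
      Controlled G (fun f => ∑ j, ∫⁻ t, valSq f (frame (e j) (t, φ j t)) ∂m j)
        (μH[1].restrict (sphere 0 R₁)) := by
  set Γ : Fin n → Set E2 := fun j => (fun t => frame (e j) (t, φ j t)) '' T j with hΓ
  have hΓc : ∀ j, IsCompact (Γ j) := fun j => (hpiece j).isCompact.image
    ((continuous_frame _).comp (continuous_id.prodMk (hpiece j).lipschitz.continuous))
  have hKc : IsCompact (⋃ j, Γ j) := isCompact_iUnion hΓc
  obtain ⟨G, τ₀, hτ₀, hGo, hGc, hΩG, hGB, hAG, hG⟩ := exists_connected_enlargement hΩ hc hp hp0 hmax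
    hKc (iUnion_subset fun j => by
      rintro _ ⟨t, ht, rfl⟩
      exact frontier_subset_closure (hfr j t ht).1) (fun hpK => by
      obtain ⟨j, t, ht, htp⟩ := mem_iUnion.1 hpK
      exact (hfr j t ht).2 htp)
  have hchart : ∀ᶠ τ : ℝ in 𝓝[>] 0, ∀ j, ∀ t ∈ T j, ∀ x,
      dist x (frame (e j) (t, φ j t)) < τ → (x ∈ Ω ↔ φ j (e j x 0) < e j x 1) := by
    refine eventually_all.2 fun j => ?_
    obtain ⟨U, hU, hTU, hUΩ⟩ := (hpiece j).exists_chart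
    obtain ⟨τ, hτ, h⟩ := exists_graph_strip_subset (e j) (hpiece j).lipschitz.continuous
      (hpiece j).isCompact hU hTU
    filter_upwards [Ioc_mem_nhdsGT hτ] with σ hσ t ht x hx
    exact hUΩ x (h t ht x (hx.trans_le hσ.2))
  have hsep : ∀ᶠ τ : ℝ in 𝓝[>] 0, ∀ i j, i ≠ j →
      Disjoint (thickening (2 * τ) (Γ i)) (thickening (2 * τ) (Γ j)) := by
    refine eventually_all.2 fun i => eventually_all.2 fun j => ?_
    by_cases hij : i = j
    · exact .of_forall fun _ h => absurd hij h
    have hd : Disjoint (Γ i) (Γ j) := by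
      rw [Set.disjoint_left]
      rintro _ ⟨t, ht, rfl⟩ ⟨u, hu, h⟩
      exact hne i j hij t ht u hu h.symm
    obtain ⟨δ, hδ, h⟩ := hd.exists_thickenings (hΓc i) (hΓc j).isClosed
    filter_upwards [Ioc_mem_nhdsGT (half_pos hδ)] with σ hσ _
    exact h.mono (thickening_mono (by linarith [hσ.2]) _) (thickening_mono (by linarith [hσ.2]) _)
  obtain ⟨τ, ⟨hτchart, hτsep⟩, hτ⟩ := ((hchart.and hsep).and (Ioc_mem_nhdsGT hτ₀)).exists
  have hstrip : ∀ w, 6 * w ≤ τ → ∀ j, ∀ x ∈ lowerStrip (e j) (φ j) (T j) w,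
      x ∈ thickening τ (Γ j) := by
    rintro w hw j x ⟨-, t, ht, hx⟩
    exact mem_thickening_iff.2 ⟨_, mem_image_of_mem _ ht, hx.trans_le hw⟩
  refine ⟨G, dist p 0 + 2, by positivity, τ, hτ.1, hΩG, hGB, ?_, ?_, ?_⟩
  · intro w hw j x hx
    have h1 := hG x (thickening_mono hτ.2 _
      (thickening_subset_of_subset τ (subset_iUnion Γ j) (hstrip w hw j x hx)))
    obtain ⟨⟨-, hx1⟩, t, ht, hxt⟩ := hx
    exact ⟨h1.1, h1.2 fun hxΩ => lt_asymm hx1 ((hτchart j t ht x (hxt.trans_le hw)).1 hxΩ)⟩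
  · intro w hw i j hij x hx y hy
    by_contra! hxy
    obtain ⟨z, hz, hyz⟩ := mem_thickening_iff.1 (hstrip w hw j y hy)
    refine Set.disjoint_left.1 (hτsep i j hij)
      (thickening_mono (by linarith [hτ.1]) _ (hstrip w hw i x hx))
      (mem_thickening_iff.2 ⟨z, hz, ?_⟩)
    linarith [dist_triangle x y z]
  · obtain ⟨x, hx, r, hr, C, hC⟩ := (hpiece j₀).exists_controlled_ball hΩ hm hΩG
    have h1 : Controlled G (fun f => ∑ j, ∫⁻ t, valSq f (frame (e j) (t, φ j t)) ∂m j)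
        (volume.restrict (ball x r)) := by
      refine ⟨C, fun f hf => (hC f hf).trans (mul_le_mul' le_rfl (add_le_add ?_ le_rfl))⟩
      exact Finset.single_le_sum
        (f := fun j => ∫⁻ t, valSq f (frame (e j) (t, φ j t)) ∂m j) (fun _ _ => zero_le)
        (Finset.mem_univ j₀)
    have hL : IsCompact {x : E2 | dist p 0 + 5 / 4 ≤ dist x 0 ∧ dist x 0 ≤ dist p 0 + 7 / 4} := by
      refine (isCompact_closedBall 0 (dist p 0 + 7 / 4)).of_isClosed_subset ?_ fun z hz => hz.2
      exact (isClosed_le continuous_const (continuous_id.dist continuous_const)).inter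
        (isClosed_le (continuous_id.dist continuous_const) continuous_const)
    have h2 := (Controlled.of_isCompact_subset
      (Controlled.ball_of_isPreconnected hGo hGc (hΩG hx) hr h1) hL fun z hz =>
        hAG ⟨by linarith [hz.1], by linarith [hz.2]⟩).of_subset
      (L := {z | dist p 0 + 5 / 4 < dist z 0 ∧ dist z 0 < dist p 0 + 7 / 4})
      fun z hz => ⟨hz.1.le, hz.2.le⟩
    exact Controlled.sphere (by positivity) (by linarith) (by linarith) (by linarith)
      ⟨by linarith, le_rfl⟩ hAG h2

/-! ### Smooth domains approximating a weighted Lipschitz domain -/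

lemma pairwiseDisjoint_sphere {r : ℝ} (hr : 0 < r) {H : Finset E2}
    (hd : ∀ a ∈ H, ∀ b ∈ H, a ≠ b → 3 * r ≤ dist a b) :
    (H : Set E2).PairwiseDisjoint fun a => sphere a r := fun a ha b hb hab =>
  (closedBall_disjoint_closedBall (by linarith [hd a ha b hb hab])).mono
    sphere_subset_closedBall sphere_subset_closedBall

lemma sum_hausdorffMeasure_sphere_le {R r : ℝ} {H : Finset E2} (hr : 0 < r)
    (hH : ∀ a ∈ H, closedBall a (2 * r) ⊆ ball (0 : E2) R)
    (hd : ∀ a ∈ H, ∀ b ∈ H, a ≠ b → 3 * r ≤ dist a b) :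
    ∑ a ∈ H, μH[1] (sphere a r) ≤ μH[1] (frontier (perforated R r H)) := by
  rw [← measure_biUnion_finset (pairwiseDisjoint_sphere hr hd)
    fun a _ => isClosed_sphere.measurableSet]
  exact measure_mono (iUnion₂_subset fun a ha => sphere_subset_frontier_perforated hr hH hd ha)

lemma lintegral_frontier_perforated_le {R r : ℝ} {H : Finset E2} (hr : 0 < r)
    (hd : ∀ a ∈ H, ∀ b ∈ H, a ≠ b → 3 * r ≤ dist a b) (F : E2 → ℝ≥0∞) :
    ∫⁻ x in frontier (perforated R r H), F x ∂μH[1] ≤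
      ∫⁻ x in sphere 0 R, F x ∂μH[1] + ∑ a ∈ H, ∫⁻ x in sphere a r, F x ∂μH[1] := by
  rw [← lintegral_biUnion_finset (pairwiseDisjoint_sphere hr hd)
    fun a _ => isClosed_sphere.measurableSet]
  exact (lintegral_mono_set frontier_perforated_subset).trans (lintegral_union_le _ _ _)

lemma exists_isSmoothDomain_approx {Ω G : Set E2} (hΩ : Ω.Nonempty) {n : ℕ} {K C₀ : ℝ≥0} {R : ℝ}
    (hR : 0 ≤ R) {e : Fin n → E2 ≃ₗᵢ[ℝ] E2} {φ : Fin n → ℝ → ℝ}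
    {m : Fin n → Measure ℝ} {T : Fin n → Set ℝ}
    (hpiece : ∀ j, IsPiece Ω K C₀ R (e j) (φ j) (m j) (T j)) {R₁ τ : ℝ} (hR₁ : 0 < R₁)
    (hτ : 0 < τ) (hΩG : Ω ⊆ G) (hGB : G ⊆ ball 0 R₁)
    (hstrip : ∀ w, 6 * w ≤ τ → ∀ j, lowerStrip (e j) (φ j) (T j) w ⊆ ball 0 R₁ \ G)
    (hsep : ∀ w, 6 * w ≤ τ → ∀ i j, i ≠ j → ∀ x ∈ lowerStrip (e i) (φ i) (T i) w,
      ∀ y ∈ lowerStrip (e j) (φ j) (T j) w, τ ≤ dist x y)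
    (hctrl : Controlled G (fun f => ∑ j, ∫⁻ t, valSq f (frame (e j) (t, φ j t)) ∂m j)
      (μH[1].restrict (sphere 0 R₁))) {ε : ℝ} (hε : 0 < ε) :
    ∃ Ω' : Set E2, IsSmoothDomain Ω' ∧ Ω ⊆ Ω' ∧ μH[1] (frontier Ω') ≠ ⊤ ∧ ∃ c : ℝ, 0 < c ∧
      ENNReal.ofReal c * ∑ j, m j univ ≤
        μH[1] (frontier Ω') + ENNReal.ofReal c * ENNReal.ofReal ε ∧
      ∀ f : E2 → ℝ, ContDiff ℝ 1 f →
        ∫⁻ x in frontier Ω', valSq f x ∂μH[1] ≤ ENNReal.ofReal c *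
          ((ENNReal.ofReal (1 + ε) ^ 3 + ENNReal.ofReal ε) *
            ∑ j, ∫⁻ t, valSq f (frame (e j) (t, φ j t)) ∂m j +
          2 * ENNReal.ofReal ε * dirEnergy Ω' f) := by
  classical
  obtain ⟨D, hD⟩ := exists_holes C₀ K hR
  obtain ⟨C, hC⟩ := hctrl
  set δ := min (1 / 8) (ε / (n * D + 1)) with hδ
  have hδ0 : 0 < δ := by positivity
  have hδ1 : δ < 1 / 4 := (min_le_left _ _).trans_lt (by norm_num)
  have hδε : n * D * δ ≤ ε := by
    have h1 : δ * (n * D + 1) ≤ ε := (le_div_iff₀ (by positivity)).1 (min_le_right _ _)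
    linarith
  obtain ⟨A, κ, hκ, hA⟩ := hD δ hδ0 hδ1 ε hε
  set w := min (τ / 6) (ε / (2 * (n * A) + 1)) with hw
  have hw0 : 0 < w := by positivity
  have hwτ : 6 * w ≤ τ := by linarith [min_le_left (τ / 6) (ε / (2 * (n * A) + 1))]
  have hwε : n * A * (2 * w) ≤ ε := by
    have h1 : w * (2 * (n * A) + 1) ≤ ε := (le_div_iff₀ (by positivity)).1 (min_le_right _ _)
    linarith
  set c := max 1 (C / ε) with hc
  have hc1 : 1 ≤ c := le_max_left _ _
  have hc0 : 0 < c := by positivity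
  have hCc : (C : ℝ) ≤ c * ε := (div_le_iff₀ hε).1 (le_max_right _ _)
  set s := min (min 1 (w / (1 + K))) (κ * w / c) with hs
  have hs0 : 0 < s := by positivity
  have hs1 : s ≤ 1 := (min_le_left _ _).trans (min_le_left _ _)
  have hsw : s * (1 + K) ≤ w :=
    (le_div_iff₀ (by positivity)).1 ((min_le_left _ _).trans (min_le_right _ _))
  have hcs : c * s ≤ κ * w := by
    rw [mul_comm]
    exact (le_div_iff₀ hc0).1 (min_le_right _ _)
  have hKs : 0 ≤ s * (K : ℝ) := by positivity
  have hsw1 : s ≤ w := by linarith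
  choose H Z hZm hZs hHs hZH hHd hHm hHf using fun j => hA (e j) (φ j) (m j) (T j) s w c
    (hpiece j).lipschitz (hpiece j).le_volume (hpiece j).isFiniteMeasure
    (hpiece j).isCompact.measurableSet (hpiece j).subset (hpiece j).compl_eq_zero hs0 hs1
    hsw hc1 hcs
  set r := s * (δ / 8) with hr
  have hr0 : 0 < r := by positivity
  have hrs : 8 * r ≤ s := by
    have h1 : s * δ ≤ s * 1 := mul_le_mul_of_nonneg_left (by linarith) hs0.le
    rw [hr]
    linarith
  have hHmem : ∀ j, ∀ a ∈ H j, a ∈ lowerStrip (e j) (φ j) (T j) w := fun j a ha =>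
    hHs j a ha (mem_closedBall_self (by positivity))
  set N : Finset E2 := Finset.univ.biUnion H with hN
  have hmemN : ∀ {a}, a ∈ N ↔ ∃ j, a ∈ H j := fun {a} => by simp [hN]
  have hNB : ∀ a ∈ N, closedBall a (2 * r) ⊆ ball 0 R₁ \ G := fun a ha => by
    obtain ⟨j, hj⟩ := hmemN.1 ha
    exact (hHs j a hj).trans (hstrip w hwτ j)
  have hNB' : ∀ a ∈ N, closedBall a (2 * r) ⊆ ball 0 R₁ := fun a ha =>
    (hNB a ha).trans sdiff_subset
  have hNd : ∀ a ∈ N, ∀ b ∈ N, a ≠ b → 3 * r ≤ dist a b := fun a ha b hb hab => by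
    obtain ⟨i, hi⟩ := hmemN.1 ha
    obtain ⟨j, hj⟩ := hmemN.1 hb
    rcases eq_or_ne i j with rfl | hij
    · exact hHd i a hi b hj hab
    · linarith [hsep w hwτ i j hij a (hHmem i a hi) b (hHmem j b hj)]
  set Ω' := perforated R₁ r N with hΩ'
  have hsub : ∀ Y : Set E2, Y ⊆ ball 0 R₁ → (∀ a ∈ N, Disjoint Y (closedBall a r)) → Y ⊆ Ω' :=
    fun Y hY hd x hx => ⟨hY hx, fun hx' => by
      obtain ⟨a, ha, hxa⟩ := mem_iUnion₂.1 hx'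
      exact Set.disjoint_left.1 (hd a ha) hx hxa⟩
  have hGΩ' : G ⊆ Ω' := hsub G hGB fun a ha => Set.disjoint_left.2 fun x hx hxa =>
    (hNB a ha (closedBall_subset_closedBall (by linarith) hxa)).2 hx
  have hZΩ' : ∀ j, Z j ⊆ Ω' := fun j => by
    refine hsub _ ((hZs j).trans ((hstrip w hwτ j).trans sdiff_subset)) fun a ha => ?_
    obtain ⟨i, hi⟩ := hmemN.1 ha
    rcases eq_or_ne i j with rfl | hij
    · exact hZH i a hi
    · refine Set.disjoint_left.2 fun x hx hxa => ?_
      have h1 := hsep w hwτ i j hij a (hHmem i a hi) x (hZs j hx)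
      rw [dist_comm] at h1
      linarith [mem_closedBall.1 hxa]
  have hsum : ∀ F : E2 → ℝ≥0∞, ∑ a ∈ N, F a = ∑ j, ∑ a ∈ H j, F a := fun F => by
    refine Finset.sum_biUnion fun i _ j _ hij => ?_
    refine Finset.disjoint_left.2 fun a hi hj => ?_
    have h1 := hsep w hwτ i j hij a (hHmem i a hi) a (hHmem j a hj)
    rw [dist_self] at h1
    linarith
  refine ⟨Ω', isSmoothDomain_perforated hr0 hNB' hNd (hΩ.mono (hΩG.trans hGΩ')),
    hΩG.trans hGΩ', ?_, c, hc0, ?_, fun f hf => ?_⟩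
  · have h1 := lintegral_frontier_perforated_le (R := R₁) hr0 hNd fun _ => 1
    simp only [lintegral_const, Measure.restrict_apply_univ, one_mul] at h1
    refine (h1.trans_lt (ENNReal.add_lt_top.2 ⟨hausdorffMeasure_sphere_lt_top 0 hR₁.le, ?_⟩)).ne
    exact ENNReal.sum_lt_top.2 fun a _ => hausdorffMeasure_sphere_lt_top a hr0.le
  · calc ENNReal.ofReal c * ∑ j, m j univ = ∑ j, ENNReal.ofReal c * m j univ := Finset.mul_sum _ _ _
      _ ≤ ∑ j, (∑ a ∈ H j, μH[1] (sphere a r) +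
          ENNReal.ofReal c * (D * ENNReal.ofReal δ)) := Finset.sum_le_sum fun j _ => hHm j
      _ = ∑ a ∈ N, μH[1] (sphere a r) + ENNReal.ofReal c * (n * D * ENNReal.ofReal δ) := by
          rw [Finset.sum_add_distrib, hsum, Finset.sum_const, Finset.card_univ, Fintype.card_fin,
            nsmul_eq_mul]
          ring
      _ ≤ _ := by
          refine add_le_add (sum_hausdorffMeasure_sphere_le hr0 hNB' hNd)
            (mul_le_mul' le_rfl ?_)
          refine le_trans (le_of_eq ?_) (ENNReal.ofReal_le_ofReal hδε)
          rw [ENNReal.ofReal_mul (by positivity), ENNReal.ofReal_mul (by positivity),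
            ENNReal.ofReal_natCast, ENNReal.ofReal_coe_nnreal]
  · set Tf := ∑ j, ∫⁻ t, valSq f (frame (e j) (t, φ j t)) ∂m j with hTf
    have hout : ∫⁻ x in sphere 0 R₁, valSq f x ∂μH[1] ≤
        ENNReal.ofReal c * (ENNReal.ofReal ε * (Tf + dirEnergy Ω' f)) := by
      refine (hC f hf).trans ?_
      rw [← mul_assoc, ← ENNReal.ofReal_mul hc0.le]
      refine mul_le_mul' ?_ (add_le_add le_rfl (dirEnergy_mono hGΩ' f))
      rw [← ENNReal.ofReal_coe_nnreal]
      exact ENNReal.ofReal_le_ofReal hCc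
    have hin : ∑ a ∈ N, ∫⁻ x in sphere a r, valSq f x ∂μH[1] ≤
        ENNReal.ofReal c * (ENNReal.ofReal (1 + ε) ^ 3 * Tf +
          ENNReal.ofReal ε * dirEnergy Ω' f) := by
      rw [hsum]
      calc _ ≤ ∑ j, ENNReal.ofReal c * (ENNReal.ofReal (1 + ε) ^ 3 *
            ∫⁻ t, valSq f (frame (e j) (t, φ j t)) ∂m j +
            A * (ENNReal.ofReal (2 * w) * dirEnergy Ω' f)) := by
            refine Finset.sum_le_sum fun j _ => (hHf j f hf).trans (mul_le_mul' le_rfl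
              (add_le_add le_rfl (mul_le_mul' le_rfl (mul_le_mul' ?_ ?_))))
            · exact ENNReal.ofReal_le_ofReal (by linarith)
            · exact dirEnergy_mono (hZΩ' j) f
        _ = ENNReal.ofReal c * (ENNReal.ofReal (1 + ε) ^ 3 * Tf +
            n * A * ENNReal.ofReal (2 * w) * dirEnergy Ω' f) := by
            rw [← Finset.mul_sum, Finset.sum_add_distrib, ← Finset.mul_sum, Finset.sum_const,
              Finset.card_univ, Fintype.card_fin, nsmul_eq_mul]
            ring
        _ ≤ _ := by
            refine mul_le_mul' le_rfl (add_le_add le_rfl (mul_le_mul' ?_ le_rfl))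
            refine le_trans (le_of_eq ?_) (ENNReal.ofReal_le_ofReal hwε)
            rw [ENNReal.ofReal_mul (p := n * A) (by positivity),
              ENNReal.ofReal_mul (p := n) (by positivity),
              ENNReal.ofReal_natCast, ENNReal.ofReal_coe_nnreal]
    refine (lintegral_frontier_perforated_le hr0 hNd _).trans ((add_le_add hout hin).trans ?_)
    refine le_of_eq ?_
    ring

lemma exists_weighted_approx {Ω : Set E2} (hΩ : IsLipschitzDomain Ω) {ν : Measure E2} {Cν : ℝ≥0}
    (hν : ν ≤ Cν • μH[1].restrict (frontier Ω)) {η : ℝ≥0∞} (hη : η ≠ 0) (hην : η < ν univ) :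
    ∃ M : ℝ, 0 < M ∧ ν univ ≤ ENNReal.ofReal M + η ∧ ∀ ε : ℝ, 0 < ε →
      ∃ Ω' : Set E2, IsSmoothDomain Ω' ∧ Ω ⊆ Ω' ∧ μH[1] (frontier Ω') ≠ ⊤ ∧ ∃ c : ℝ, 0 < c ∧
        ENNReal.ofReal c * ENNReal.ofReal M ≤
          μH[1] (frontier Ω') + ENNReal.ofReal c * ENNReal.ofReal ε ∧
        ∀ f : E2 → ℝ, ContDiff ℝ 1 f →
          ∫⁻ x in frontier Ω', valSq f x ∂μH[1] ≤ ENNReal.ofReal c *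
            ((ENNReal.ofReal (1 + ε) ^ 3 + ENNReal.ofReal ε) * ∫⁻ x, valSq f x ∂ν +
            2 * ENNReal.ofReal ε * dirEnergy Ω' f) := by
  obtain ⟨hO, hc, hb, -⟩ := id hΩ
  obtain ⟨p, hp, hmax⟩ := (Metric.isCompact_of_isClosed_isBounded isClosed_closure
    hb.closure).exists_isMaxOn hc.nonempty.closure
    (f := fun x => dist x 0) (continuous_id.dist continuous_const).continuousOn
  have hmax' : ∀ x ∈ closure Ω, dist x 0 ≤ dist p 0 := fun x hx => hmax hx
  have hp0 : p ≠ 0 := by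
    rintro rfl
    have h1 : Ω ⊆ {0} := fun x hx => by
      have h2 := hmax' x (subset_closure hx)
      rw [dist_self] at h2
      exact dist_le_zero.1 h2
    have h3 := interior_mono h1
    rw [hO.interior_eq, interior_singleton] at h3
    exact hc.nonempty.ne_empty (subset_empty_iff.1 h3)
  obtain ⟨n, K, C₀, R, e, φ, m, T, hR, hpiece, hne, hfr, hle, hfin, hintegral⟩ :=
    exists_isPiece hΩ hν p hη
  have hmfin : ∑ j, m j univ ≠ ⊤ := (ENNReal.sum_lt_top.2 fun j _ => by
    have := (hpiece j).isFiniteMeasure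
    exact measure_lt_top _ _).ne
  have hm0 : ∑ j, m j univ ≠ 0 := fun h0 => by
    rw [h0, zero_add] at hle
    exact absurd hle (not_le.2 hην)
  obtain ⟨j₀, -, hj₀⟩ := Finset.exists_ne_zero_of_sum_ne_zero hm0
  obtain ⟨G, R₁, hR₁, τ, hτ, hΩG, hGB, hstrip, hsep, hctrl⟩ :=
    exists_core hO hc.isPreconnected hp hp0 hmax' hpiece hne hfr hj₀
  refine ⟨(∑ j, m j univ).toReal, ENNReal.toReal_pos hm0 hmfin, ?_, fun ε hε => ?_⟩
  · rwa [ENNReal.ofReal_toReal hmfin]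
  · obtain ⟨Ω', hΩ', hsub, hfr', c, hc0, hlen, hval⟩ := exists_isSmoothDomain_approx hc.nonempty hR
      hpiece hR₁ hτ hΩG hGB hstrip hsep hctrl hε
    refine ⟨Ω', hΩ', hsub, hfr', c, hc0, ?_, fun f hf => (hval f hf).trans ?_⟩
    · rwa [ENNReal.ofReal_toReal hmfin]
    · exact mul_le_mul' le_rfl (add_le_add (mul_le_mul' le_rfl
        (hintegral _ (measurable_valSq hf))) le_rfl)

/-! ### Comparison of eigenvalues -/

lemma dirEnergy_ne_top {Ω : Set E2} (hΩ : Bornology.IsBounded Ω) {f : E2 → ℝ}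
    (hf : ContDiff ℝ 1 f) : dirEnergy Ω f ≠ ⊤ := by
  have hK : IsCompact (closure Ω) :=
    Metric.isCompact_of_isClosed_isBounded isClosed_closure hΩ.closure
  obtain ⟨C, hC⟩ := hK.exists_bound_of_continuousOn (hf.continuous_fderiv one_ne_zero).continuousOn
  refine (lt_of_le_of_lt ?_ (ENNReal.mul_lt_top (a := ENNReal.ofReal C ^ 2) (by finiteness)
    (hΩ.measure_lt_top (μ := volume)))).ne
  rw [← setLIntegral_const]
  refine setLIntegral_mono measurable_const fun x hx => pow_le_pow_left' ?_ 2
  rw [← enorm_eq_nnnorm, ← ofReal_norm]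
  exact ENNReal.ofReal_le_ofReal (hC x (subset_closure hx))

lemma eqOn_closure_of_dirEnergy_eq_zero {Ω : Set E2} (hO : IsOpen Ω) (hc : IsPreconnected Ω)
    {f : E2 → ℝ} (hf : ContDiff ℝ 1 f) (h : dirEnergy Ω f = 0) {x : E2} (hx : x ∈ Ω)
    (hfx : f x = 0) : EqOn f 0 (closure Ω) := by
  have h1 : gradSq f =ᵐ[volume.restrict Ω] fun _ => 0 :=
    (lintegral_eq_zero_iff (measurable_gradSq hf)).1 h
  have h2 : EqOn (gradSq f) (fun _ => 0) Ω :=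
    Measure.eqOn_open_of_ae_eq h1 hO (continuous_gradSq hf).continuousOn continuousOn_const
  have h3 : EqOn (fderiv ℝ f) 0 Ω := fun y hy => by
    have h4 : (‖fderiv ℝ f y‖₊ : ℝ≥0∞) ^ 2 = 0 := h2 hy
    simpa using h4
  have h5 : EqOn f 0 Ω := fun y hy => by
    rw [hO.is_const_of_fderiv_eq_zero hc (hf.differentiable one_ne_zero).differentiableOn h3 hy hx,
      hfx]
    rfl
  exact h5.closure hf.continuous continuous_const

lemma le_mul_of_le_add_mul {E X : ℝ≥0∞} {b : ℝ} (hb0 : 0 ≤ b) (hb : b < 1) (hE : E ≠ ⊤)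
    (h : E ≤ X + ENNReal.ofReal b * E) : E ≤ ENNReal.ofReal (1 / (1 - b)) * X := by
  have h1 : ENNReal.ofReal (1 - b) * E ≤ X := by
    refine (ENNReal.add_le_add_iff_right
      (ENNReal.mul_ne_top (ENNReal.ofReal_ne_top (r := b)) hE)).1 ?_
    rwa [← add_mul, ← ENNReal.ofReal_add (by linarith) hb0, sub_add_cancel, ENNReal.ofReal_one,
      one_mul]
  calc E = ENNReal.ofReal (1 / (1 - b)) * (ENNReal.ofReal (1 - b) * E) := by
        rw [← mul_assoc, ← ENNReal.ofReal_mul (by have := sub_pos.2 hb; positivity),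
          one_div_mul_cancel (by linarith), ENNReal.ofReal_one, one_mul]
    _ ≤ _ := mul_le_mul' le_rfl h1

lemma exists_submodule_of_steklov_lt {Ω : Set E2} {k : ℕ} {Λ : ℝ}
    (h : steklov Ω k < ENNReal.ofReal Λ) :
    ∃ V : Submodule ℝ (E2 → ℝ), Module.finrank ℝ V = k + 1 ∧
      (∀ f ∈ V, ContDiff ℝ (⊤ : ℕ∞) f) ∧ (∀ f ∈ V, EqOn f 0 (closure Ω) → f = 0) ∧
      ∀ f ∈ V, dirEnergy Ω f ≤ ENNReal.ofReal Λ * ∫⁻ x in frontier Ω, valSq f x ∂μH[1] := by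
  have hΛ : ENNReal.ofReal Λ ≠ 0 := (zero_le.trans_lt h).ne'
  simp only [steklov, steklovW, steklovMixed, iInf_lt_iff] at h
  obtain ⟨V, hV, hs, -, h0, hlt⟩ := h
  refine ⟨V, hV, hs, h0, fun f hf => ?_⟩
  by_cases hf0 : EqOn f 0 (closure Ω)
  · rw [h0 f hf hf0]
    simp [dirEnergy]
  · have h1 : rayleigh Ω (frontier Ω) (fun _ => 1) f ≤ ENNReal.ofReal Λ :=
      (le_iSup₂_of_le f hf (le_iSup (fun _ : ¬ EqOn f 0 (closure Ω) =>
        rayleigh Ω (frontier Ω) (fun _ => 1) f) hf0)).trans hlt.le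
    rw [rayleigh, ENNReal.div_le_iff_le_mul (Or.inr ENNReal.ofReal_ne_top) (Or.inr hΛ)] at h1
    simpa only [bdryInt, one_mul, valSq] using h1

lemma steklovW_le_of_approx {k : ℕ} {Ω Ω' : Set E2} {ρ : E2 → ℝ}
    (hne : Ω.Nonempty) (hΩ' : IsSmoothDomain Ω') (hsub : Ω ⊆ Ω') {ν : Measure E2} {Cν : ℝ≥0}
    (hν : ν ≤ Cν • μH[1].restrict (frontier Ω))
    (hνρ : ∀ f : E2 → ℝ, ContDiff ℝ 1 f → ∫⁻ x, valSq f x ∂ν ≤ bdryInt (frontier Ω) ρ f)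
    {Λ a b : ℝ} (hb : 0 ≤ b) (hΛ0 : 0 ≤ Λ) (hb1 : Λ * b < 1)
    (hΛ : steklov Ω' k < ENNReal.ofReal Λ)
    (h : ∀ f : E2 → ℝ, ContDiff ℝ 1 f → ∫⁻ x in frontier Ω', valSq f x ∂μH[1] ≤
      ENNReal.ofReal a * ∫⁻ x, valSq f x ∂ν + ENNReal.ofReal b * dirEnergy Ω' f) :
    steklovW Ω ρ k ≤ ENNReal.ofReal (1 / (1 - Λ * b) * (Λ * a)) := by
  obtain ⟨hO', hc', hbd', -⟩ := hΩ'
  obtain ⟨V, hV, hs, h0, hVΛ⟩ := exists_submodule_of_steklov_lt hΛ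
  have hs1 : ∀ f ∈ V, ContDiff ℝ 1 f := fun f hf => (hs f hf).of_le (by exact_mod_cast le_top)
  have hE : ∀ f ∈ V, dirEnergy Ω' f ≤
      ENNReal.ofReal (1 / (1 - Λ * b) * (Λ * a)) * ∫⁻ x, valSq f x ∂ν := fun f hf => by
    have h1 := (hVΛ f hf).trans (mul_le_mul' le_rfl (h f (hs1 f hf)))
    rw [mul_add, ← mul_assoc, ← mul_assoc, ← ENNReal.ofReal_mul hΛ0, ← ENNReal.ofReal_mul hΛ0] at h1
    refine (le_mul_of_le_add_mul (by positivity) hb1 (dirEnergy_ne_top hbd' (hs1 f hf)) h1).trans ?_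
    rw [← mul_assoc, ← ENNReal.ofReal_mul (by have := sub_pos.2 hb1; positivity)]
  have hinj : ∀ f ∈ V, EqOn f 0 (closure Ω) → f = 0 := fun f hf hf0 => by
    refine h0 f hf ?_
    obtain ⟨x, hx⟩ := hne
    refine eqOn_closure_of_dirEnergy_eq_zero hO' hc'.isPreconnected (hs1 f hf) ?_ (hsub hx)
      (hf0 (subset_closure hx))
    have hzero : ∫⁻ x, valSq f x ∂ν = 0 := by
      refine le_antisymm ((lintegral_mono' hν le_rfl).trans ?_) zero_le
      rw [lintegral_smul_measure, setLIntegral_congr_fun (g := fun _ => 0)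
        isClosed_frontier.measurableSet fun x hx => by
          show ENNReal.ofReal (f x ^ 2) = 0
          rw [hf0 (frontier_subset_closure hx)]
          simp]
      simp
    refine le_antisymm ((hE f hf).trans ?_) zero_le
    rw [hzero, mul_zero]
  refine iInf_le_of_le V (iInf_le_of_le hV (iInf_le_of_le hs (iInf_le_of_le ?_
    (iInf_le_of_le hinj ?_))))
  · intro f _
    rw [nhdsSet_empty]
    exact eventually_bot
  · refine iSup₂_le fun f hf => iSup_le fun _ => ENNReal.div_le_of_le_mul ?_
    exact (dirEnergy_mono hsub f).trans ((hE f hf).trans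
      (mul_le_mul' le_rfl (hνρ f (hs1 f hf))))

lemma steklovW_le_of_forall_isSmoothDomain {k : ℕ} {S : ℝ} (hS : 0 < S)
    (h : ∀ Ω : Set E2, IsSmoothDomain Ω →
      steklov Ω k * μH[1] (frontier Ω) ≤ ENNReal.ofReal S)
    {Ω : Set E2} (hΩ : IsLipschitzDomain Ω) {ρ : E2 → ℝ} {ν : Measure E2} {Cν : ℝ≥0}
    (hν : ν ≤ Cν • μH[1].restrict (frontier Ω))
    (hνρ : ∀ f : E2 → ℝ, ContDiff ℝ 1 f → ∫⁻ x, valSq f x ∂ν ≤ bdryInt (frontier Ω) ρ f)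
    {η : ℝ≥0∞} (hη : η ≠ 0) (hην : η < ν univ) :
    steklovW Ω ρ k ≠ ⊤ ∧ steklovW Ω ρ k * ν univ ≤ ENNReal.ofReal S + steklovW Ω ρ k * η := by
  obtain ⟨M, hM, hMν, happrox⟩ := exists_weighted_approx hΩ hν hη hην
  set q : ℝ → ℝ := fun ε => S * (1 + ε) / (M - ε) with hq
  have hev : ∀ᶠ ε : ℝ in 𝓝[>] 0, steklovW Ω ρ k ≤
      ENNReal.ofReal (1 / (1 - q ε * (2 * ε)) * (q ε * ((1 + ε) ^ 3 + ε))) := by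
    have hlim : Tendsto (fun ε => q ε * (2 * ε)) (𝓝 0) (𝓝 (q 0 * (2 * 0))) := by
      refine ContinuousAt.mul (ContinuousAt.div (by fun_prop) (by fun_prop) ?_) (by fun_prop)
      simpa using hM.ne'
    have hlt : ∀ᶠ ε : ℝ in 𝓝[>] 0, q ε * (2 * ε) < 1 :=
      (hlim.eventually_lt_const (by simp)).filter_mono nhdsWithin_le_nhds
    filter_upwards [hlt, Ioo_mem_nhdsGT hM] with ε hε1 hε
    obtain ⟨hε0, hεM⟩ := hε
    have hMε : 0 < M - ε := sub_pos.2 hεM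
    obtain ⟨Ω', hΩ', hsub, hfr, c, hc, hlen, hval⟩ := happrox ε hε0
    have hlen' : ENNReal.ofReal (c * (M - ε)) ≤ μH[1] (frontier Ω') := by
      rw [← ENNReal.ofReal_mul hc.le, ← ENNReal.ofReal_mul hc.le, ← tsub_le_iff_right,
        ← ENNReal.ofReal_sub _ (by positivity)] at hlen
      rwa [mul_sub]
    have hst : steklov Ω' k < ENNReal.ofReal (q ε / c) := by
      have h1 : steklov Ω' k * ENNReal.ofReal (c * (M - ε)) ≤ ENNReal.ofReal S :=
        (mul_le_mul' le_rfl hlen').trans (h Ω' hΩ')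
      rw [← ENNReal.le_div_iff_mul_le (Or.inl (by simpa using by positivity))
        (Or.inl ENNReal.ofReal_ne_top), ← ENNReal.ofReal_div_of_pos (by positivity)] at h1
      refine h1.trans_lt ((ENNReal.ofReal_lt_ofReal_iff (by positivity)).2 ?_)
      rw [hq, div_div, mul_comm (M - ε) c]
      refine div_lt_div_of_pos_right ?_ (by positivity)
      nlinarith
    have hle := steklovW_le_of_approx (ρ := ρ) hΩ.2.1.nonempty hΩ' hsub hν hνρ
      (Λ := q ε / c) (a := c * ((1 + ε) ^ 3 + ε)) (b := c * (2 * ε)) (by positivity)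
      (by positivity) (by rwa [div_mul_eq_mul_div, mul_left_comm, mul_div_cancel_left₀ _ hc.ne'])
      hst fun f hf => by
        refine (hval f hf).trans (le_of_eq ?_)
        rw [ENNReal.ofReal_mul hc.le, ENNReal.ofReal_mul hc.le,
          ENNReal.ofReal_add (p := (1 + ε) ^ 3) (by positivity) hε0.le,
          ENNReal.ofReal_pow (by positivity),
          ENNReal.ofReal_mul (by norm_num : (0 : ℝ) ≤ 2), ENNReal.ofReal_ofNat]
        ring
    refine hle.trans (le_of_eq ?_)
    congr 1
    field_simp
  have hlim : Tendsto (fun ε => 1 / (1 - q ε * (2 * ε)) * (q ε * ((1 + ε) ^ 3 + ε))) (𝓝[>] 0)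
      (𝓝 (S / M)) := by
    have h1 : ContinuousAt (fun ε => 1 / (1 - q ε * (2 * ε)) * (q ε * ((1 + ε) ^ 3 + ε))) 0 := by
      have hqc : ContinuousAt q 0 :=
        ContinuousAt.div (by fun_prop) (by fun_prop) (by simpa using hM.ne')
      refine ContinuousAt.mul (ContinuousAt.div (by fun_prop) (by fun_prop) ?_) (by fun_prop)
      simp
    have h2 := h1.tendsto
    simp only [hq, mul_zero, sub_zero, add_zero, one_pow, mul_one, div_one, one_mul] at h2
    exact h2.mono_left nhdsWithin_le_nhds
  have hle : steklovW Ω ρ k ≤ ENNReal.ofReal (S / M) :=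
    ge_of_tendsto (ENNReal.tendsto_ofReal hlim) hev
  refine ⟨ne_top_of_le_ne_top ENNReal.ofReal_ne_top hle, ?_⟩
  calc _ ≤ steklovW Ω ρ k * ENNReal.ofReal M + steklovW Ω ρ k * η := by
        rw [← mul_add]
        exact mul_le_mul' le_rfl hMν
    _ ≤ ENNReal.ofReal (S / M) * ENNReal.ofReal M + steklovW Ω ρ k * η :=
        add_le_add (mul_le_mul' hle le_rfl) le_rfl
    _ = _ := by rw [← ENNReal.ofReal_mul (by positivity), div_mul_cancel₀ _ hM.ne']

lemma steklovW_mul_Lweight_le {k : ℕ} {S : ℝ} (hS : 0 < S)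
    (h : ∀ Ω : Set E2, IsSmoothDomain Ω →
      steklov Ω k * μH[1] (frontier Ω) ≤ ENNReal.ofReal S)
    {Ω : Set E2} (hΩ : IsLipschitzDomain Ω) {ρ : E2 → ℝ}
    (hρ : ∃ C : ℝ, ∀ᵐ x ∂(μH[1].restrict (frontier Ω)), ρ x ≤ C) :
    steklovW Ω ρ k * Lweight Ω ρ ≤ ENNReal.ofReal S := by
  obtain ⟨C, hC⟩ := hρ
  obtain ⟨g, hgm, hg, hgL⟩ := exists_measurable_le_lintegral_eq
    (μ := μH[1].restrict (frontier Ω)) fun x => ENNReal.ofReal (ρ x)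
  set ν := (μH[1].restrict (frontier Ω)).withDensity g with hνdef
  have hνuniv : ν univ = Lweight Ω ρ := by
    rw [hνdef, withDensity_apply _ MeasurableSet.univ, Measure.restrict_univ, ← hgL, Lweight]
  have hν : ν ≤ C.toNNReal • μH[1].restrict (frontier Ω) := by
    have h1 : ν ≤ (μH[1].restrict (frontier Ω)).withDensity fun _ => ENNReal.ofReal C :=
      withDensity_mono (by
        filter_upwards [hC] with x hx
        exact (hg x).trans (ENNReal.ofReal_le_ofReal hx))
    rwa [withDensity_const] at h1
  have hνρ : ∀ f : E2 → ℝ, ContDiff ℝ 1 f →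
      ∫⁻ x, valSq f x ∂ν ≤ bdryInt (frontier Ω) ρ f := fun f hf => by
    rw [hνdef, lintegral_withDensity_eq_lintegral_mul _ hgm (measurable_valSq hf)]
    refine lintegral_mono fun x => ?_
    rw [ENNReal.ofReal_mul' (sq_nonneg _)]
    exact mul_le_mul' (hg x) le_rfl
  rw [← hνuniv]
  rcases eq_or_ne (ν univ) 0 with h0 | h0
  · rw [h0, mul_zero]
    exact zero_le
  have hev : ∀ᶠ η : ℝ≥0∞ in 𝓝[>] 0, steklovW Ω ρ k ≠ ⊤ ∧
      steklovW Ω ρ k * ν univ ≤ ENNReal.ofReal S + steklovW Ω ρ k * η := by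
    filter_upwards [Ioo_mem_nhdsGT (pos_iff_ne_zero.2 h0)] with η hη
    exact steklovW_le_of_forall_isSmoothDomain hS h hΩ hν hνρ hη.1.ne' hη.2
  obtain ⟨-, htop, -⟩ := hev.exists
  have hlim : Tendsto (fun η => ENNReal.ofReal S + steklovW Ω ρ k * η) (𝓝[>] 0)
      (𝓝 (ENNReal.ofReal S + steklovW Ω ρ k * 0)) :=
    (tendsto_const_nhds.add (ENNReal.Tendsto.const_mul tendsto_id (Or.inr htop))).mono_left
      nhdsWithin_le_nhds
  rw [mul_zero, add_zero] at hlim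
  exact ge_of_tendsto hlim (hev.mono fun _ hη => hη.2)

theorem statement16 (k : ℕ) (hk : 1 ≤ k) (S : ℝ) (hS : 0 < S)
    (h : ∀ Ω : Set E2, IsSmoothDomain Ω →
      steklov Ω k * μH[1] (frontier Ω) ≤ ENNReal.ofReal S) :
    (∀ Ω : Set E2, IsLipschitzDomain Ω →
      steklov Ω k * μH[1] (frontier Ω) ≤ ENNReal.ofReal S)
    ∧ (∀ (Ω : Set E2) (ρ : E2 → ℝ), IsLipschitzDomain Ω →
        (∀ x, 0 ≤ ρ x) →
        (∃ C : ℝ, ∀ᵐ x ∂(μH[1].restrict (frontier Ω)), ρ x ≤ C) →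
        0 < μH[1] {x ∈ frontier Ω | 0 < ρ x} →
        steklovW Ω ρ k * Lweight Ω ρ ≤ ENNReal.ofReal S) := by
  refine ⟨fun Ω hΩ => ?_, fun Ω ρ hΩ _ hρ _ => steklovW_mul_Lweight_le hS h hΩ hρ⟩
  have h1 := steklovW_mul_Lweight_le hS h hΩ (ρ := fun _ => 1) ⟨1, .of_forall fun _ => le_rfl⟩
  simpa [steklov, Lweight] using h1

end
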